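/- arXiv:1510.07537 — 2 statements merged into one kernel-verified Lean document; each statement's English description precedes it below -/
import Mathlib

section
/- Assume the Hessian of h is positive semidefinite everywhere (i.e., ∇²h ≥ 0, the case k₁ = k₂ = 0). Then for every t ∈ (0,T) and every (x,v) ∈ ℝⁿ×ℝⁿ, the 2n×2n symmetric matrix inequality ∇² log ρ(t,x,v) − ½∇²U(x,v) ≥ [[−(6/t³) I, (3/t²) I],[(3/t²) I, −(2/t) I]] holds (this is ½·[[−(s₁/s₀) I, (s₂/s₀) I],[(s₂/s₀) I, −(s₀'/s₀) I]] with s₀(t) = t⁴, s₁(t) = 12t, s₂(t) = 6t²; equality holds for the fundamental solution of the Kolmogorov equation). -/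
noncomputable section
open Real Set Matrix

/-- `ℝⁿ` with the Euclidean norm. -/
abbrev E (n : ℕ) := EuclideanSpace ℝ (Fin n)

/-- The standard basis of `ℝⁿ × ℝⁿ`, indexed by `Fin n ⊕ Fin n`: `Sum.inl i` is the `i`-th
`x`-direction and `Sum.inr i` is the `i`-th `v`-direction. -/
def stdBasis (n : ℕ) : Fin n ⊕ Fin n → E n × E n
  | Sum.inl i => (EuclideanSpace.single i 1, 0)
  | Sum.inr i => (0, EuclideanSpace.single i 1)

/-- Partial derivative of `φ : ℝⁿ × ℝⁿ → ℝ` in the `j`-th coordinate direction. -/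
def pd {n : ℕ} (φ : E n × E n → ℝ) (j : Fin n ⊕ Fin n) (p : E n × E n) : ℝ :=
  fderiv ℝ φ p (stdBasis n j)

/-- The full Hessian of `φ` in the variables `(x, v)`, as a `2n × 2n` matrix. -/
def Hess {n : ℕ} (φ : E n × E n → ℝ) (p : E n × E n) :
    Matrix (Fin n ⊕ Fin n) (Fin n ⊕ Fin n) ℝ :=
  Matrix.of fun i j => pd (pd φ j) i p

/-- The Laplacian in the `v`-variables: `Δ_v φ = Σᵢ ∂²φ/∂vᵢ²`. -/
def lapV {n : ℕ} (φ : E n × E n → ℝ) (p : E n × E n) : ℝ :=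
  ∑ i : Fin n, pd (pd φ (Sum.inr i)) (Sum.inr i) p

/-- The squared Euclidean norm of the full gradient `∇φ`. -/
def gradNormSq {n : ℕ} (φ : E n × E n → ℝ) (p : E n × E n) : ℝ :=
  ∑ j : Fin n ⊕ Fin n, (pd φ j p) ^ 2

/-- The function `h = -½⟨v, ∇ₓU⟩ + ½Δ_v U - ¼|∇_v U|²`. -/
def hfun {n : ℕ} (U : E n × E n → ℝ) (p : E n × E n) : ℝ :=
  -(1/2) * (∑ i : Fin n, p.2 i * pd U (Sum.inl i) p) + (1/2) * lapV U p
    - (1/4) * ∑ i : Fin n, (pd U (Sum.inr i) p) ^ 2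

/-- The block-diagonal matrix `[[a·I, 0], [0, b·I]]`. -/
def blockDiag (n : ℕ) (a b : ℝ) : Matrix (Fin n ⊕ Fin n) (Fin n ⊕ Fin n) ℝ :=
  Matrix.fromBlocks (a • 1) 0 0 (b • 1)

/-- The right-hand side `½·[[-(s₁/s₀)I, (s₂/s₀)I], [(s₂/s₀)I, -(s₀'/s₀)I]]` of the
matrix differential Harnack inequality. -/
def harnackMatrix (n : ℕ) (s₀ s₁ s₂ : ℝ → ℝ) (t : ℝ) :
    Matrix (Fin n ⊕ Fin n) (Fin n ⊕ Fin n) ℝ :=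
  (1/2 : ℝ) • Matrix.fromBlocks (-(s₁ t / s₀ t) • 1) ((s₂ t / s₀ t) • 1)
    ((s₂ t / s₀ t) • 1) (-(deriv s₀ t / s₀ t) • 1)

section Calculus

variable {n : ℕ}

/-- The Kolmogorov operator `Δ_v − ⟨v, ∇ₓ ·⟩`. -/
def kolm (φ : E n × E n → ℝ) (p : E n × E n) : ℝ :=
  lapV φ p - ∑ i : Fin n, p.2 i * pd φ (Sum.inl i) p

/-- Coordinates of a point of `ℝⁿ × ℝⁿ` in the basis `stdBasis`. -/
def coords (y : E n × E n) : Fin n ⊕ Fin n → ℝ :=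
  Sum.elim (fun i => y.1 i) (fun i => y.2 i)

/-- Second derivative of `φ` at `p` in the direction `y`. -/
def secondDeriv (φ : E n × E n → ℝ) (p y : E n × E n) : ℝ :=
  fderiv ℝ (fun q => fderiv ℝ φ q y) p y

theorem sum_coords_smul_stdBasis (y : E n × E n) :
    ∑ j, coords y j • stdBasis n j = y := by
  rw [Fintype.sum_sum_type]
  ext i
  · simp [coords, _root_.stdBasis, Prod.fst_sum, Pi.single_apply]
  · simp [coords, _root_.stdBasis, Prod.snd_sum, Pi.single_apply]

theorem fderiv_apply_eq_sum (φ : E n × E n → ℝ) (p y : E n × E n) :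
    fderiv ℝ φ p y = ∑ j, coords y j * pd φ j p := by
  conv_lhs => rw [← sum_coords_smul_stdBasis y]
  simp [pd, map_sum]

theorem fderiv_prod_apply_eq_sum (φ : E n × E n → ℝ) (p : E n × E n) (a b : E n) :
    fderiv ℝ φ p (a, b) =
      ∑ i, a i * pd φ (Sum.inl i) p + ∑ i, b i * pd φ (Sum.inr i) p := by
  rw [fderiv_apply_eq_sum, Fintype.sum_sum_type]
  simp [coords]

theorem contDiff_pd {φ : E n × E n → ℝ} {k m : WithTop ℕ∞} (hφ : ContDiff ℝ k φ)
    (h : m + 1 ≤ k) (j : Fin n ⊕ Fin n) : ContDiff ℝ m (pd φ j) :=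
  (hφ.fderiv_right h).clm_apply contDiff_const

theorem differentiable_pd {φ : E n × E n → ℝ} (hφ : ContDiff ℝ 2 φ)
    (j : Fin n ⊕ Fin n) : Differentiable ℝ (pd φ j) :=
  (contDiff_pd hφ (m := 1) (by norm_num) j).differentiable (by norm_num)

theorem differentiable_of_contDiff_two {φ : E n × E n → ℝ} (hφ : ContDiff ℝ 2 φ) :
    Differentiable ℝ φ :=
  hφ.differentiable (by norm_num)

theorem differentiable_fderiv_apply {φ : E n × E n → ℝ} (hφ : ContDiff ℝ 2 φ)
    (y : E n × E n) : Differentiable ℝ (fun q => fderiv ℝ φ q y) :=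
  ((hφ.fderiv_right (m := 1) (by norm_num)).clm_apply contDiff_const).differentiable
    (by norm_num)

theorem secondDeriv_const_mul {φ : E n × E n → ℝ} (hφ : ContDiff ℝ 2 φ) (c : ℝ)
    (p y : E n × E n) : secondDeriv (fun z => c * φ z) p y = c * secondDeriv φ p y := by
  have h1 : ∀ q, fderiv ℝ (fun z => c * φ z) q y = c * fderiv ℝ φ q y := fun q => by
    rw [fderiv_const_mul (differentiable_of_contDiff_two hφ q)]
    simp
  simp only [secondDeriv, h1]
  rw [fderiv_const_mul (differentiable_fderiv_apply hφ y p)]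
  simp

theorem secondDeriv_add {φ ψ : E n × E n → ℝ} (hφ : ContDiff ℝ 2 φ) (hψ : ContDiff ℝ 2 ψ)
    (p y : E n × E n) :
    secondDeriv (fun z => φ z + ψ z) p y = secondDeriv φ p y + secondDeriv ψ p y := by
  have h1 : ∀ q, fderiv ℝ (fun z => φ z + ψ z) q y = fderiv ℝ φ q y + fderiv ℝ ψ q y :=
    fun q => by
      rw [fderiv_fun_add (differentiable_of_contDiff_two hφ q)
        (differentiable_of_contDiff_two hψ q)]
      rfl
  simp only [secondDeriv, h1]
  rw [fderiv_fun_add (differentiable_fderiv_apply hφ y p) (differentiable_fderiv_apply hψ y p)]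
  rfl

theorem secondDeriv_eq {φ : E n × E n → ℝ} (hφ : ContDiff ℝ 2 φ) (p y : E n × E n) :
    secondDeriv φ p y = coords y ⬝ᵥ (Hess φ p *ᵥ coords y) := by
  have h1 : (fun q => fderiv ℝ φ q y) = fun q => ∑ j, coords y j * pd φ j q := by
    funext q; exact fderiv_apply_eq_sum φ q y
  have h2 : ∀ i, pd (fun q => ∑ j, coords y j * pd φ j q) i p
      = ∑ j, coords y j * pd (pd φ j) i p := by
    intro i
    rw [pd, fderiv_fun_sum (fun j _ => (differentiable_pd hφ j p).const_mul _)]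
    simp only [_root_.sum_apply]
    refine Finset.sum_congr rfl fun j _ => ?_
    rw [fderiv_const_mul (differentiable_pd hφ j p)]
    rfl
  rw [secondDeriv, h1, fderiv_apply_eq_sum]
  simp only [h2, dotProduct, mulVec, Hess, Matrix.of_apply]
  refine Finset.sum_congr rfl fun i _ => ?_
  congr 1
  exact Finset.sum_congr rfl fun j _ => mul_comm _ _

theorem Hess_isHermitian {φ : E n × E n → ℝ} (hφ : ContDiff ℝ 2 φ) (p : E n × E n) :
    (Hess φ p).IsHermitian := by
  have hs : IsSymmSndFDerivAt ℝ φ p := hφ.contDiffAt.isSymmSndFDerivAt (by simp)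
  have key : ∀ i j, pd (pd φ j) i p
      = fderiv ℝ (fderiv ℝ φ) p (stdBasis n i) (stdBasis n j) := by
    intro i j
    have hd : DifferentiableAt ℝ (fderiv ℝ φ) p :=
      (hφ.fderiv_right (m := 1) (by norm_num)).differentiable (by norm_num) p
    have h := (hd.hasFDerivAt.clm_apply (hasFDerivAt_const (stdBasis n j) p)).fderiv
    have : fderiv ℝ (pd φ j) p = fderiv ℝ (fun y => fderiv ℝ φ y (stdBasis n j)) p := rfl
    unfold pd at this ⊢
    rw [this, h]
    simp
  ext i j
  simp only [Matrix.conjTranspose_apply, Hess, Matrix.of_apply, star_trivial, key]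
  exact hs _ _

theorem posSemidef_of_secondDeriv {φ : E n × E n → ℝ} (hφ : ContDiff ℝ 2 φ) (p : E n × E n)
    {M : Matrix (Fin n ⊕ Fin n) (Fin n ⊕ Fin n) ℝ} (hM : M.IsHermitian)
    (h : ∀ y, coords y ⬝ᵥ (M *ᵥ coords y) ≤ secondDeriv φ p y) :
    (Hess φ p - M).PosSemidef := by
  refine Matrix.PosSemidef.of_dotProduct_mulVec_nonneg ((Hess_isHermitian hφ p).sub hM)
    fun x => ?_
  have hx : coords (WithLp.toLp 2 (fun i => x (Sum.inl i)),
      WithLp.toLp 2 (fun i => x (Sum.inr i))) = x := by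
    ext j; rcases j with j | j <;> simp [coords]
  have := h (WithLp.toLp 2 (fun i => x (Sum.inl i)), WithLp.toLp 2 (fun i => x (Sum.inr i)))
  rw [secondDeriv_eq hφ, hx] at this
  simpa [Matrix.sub_mulVec, dotProduct_sub] using this

theorem secondDeriv_nonneg {φ : E n × E n → ℝ} (hφ : ContDiff ℝ 2 φ) {p : E n × E n}
    (h : (Hess φ p).PosSemidef) (y : E n × E n) : 0 ≤ secondDeriv φ p y := by
  rw [secondDeriv_eq hφ]
  simpa using h.dotProduct_mulVec_nonneg (coords y)

theorem coords_dotProduct_coords (y : E n × E n) :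
    coords y ⬝ᵥ coords y = ‖y.1‖ ^ 2 + ‖y.2‖ ^ 2 := by
  rw [EuclideanSpace.norm_sq_eq, EuclideanSpace.norm_sq_eq]
  simp [dotProduct, coords, Fintype.sum_sum_type, sq]

theorem secondDeriv_le {φ : E n × E n → ℝ} (hφ : ContDiff ℝ 2 φ) {p : E n × E n} {c : ℝ}
    (h : (c • (1 : Matrix (Fin n ⊕ Fin n) (Fin n ⊕ Fin n) ℝ) - Hess φ p).PosSemidef)
    (y : E n × E n) : secondDeriv φ p y ≤ c * (‖y.1‖ ^ 2 + ‖y.2‖ ^ 2) := by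
  rw [secondDeriv_eq hφ, ← coords_dotProduct_coords]
  have := h.dotProduct_mulVec_nonneg (coords y)
  simpa [Matrix.sub_mulVec, dotProduct_sub, Matrix.smul_mulVec] using this

theorem hasDerivAt_line {φ : E n × E n → ℝ} (hφ : Differentiable ℝ φ) (p y : E n × E n)
    (s : ℝ) : HasDerivAt (fun s : ℝ => φ (p + s • y)) (fderiv ℝ φ (p + s • y) y) s := by
  have h1 : HasDerivAt (fun s : ℝ => p + s • y) y s := by
    simpa using ((hasDerivAt_id s).smul_const y).const_add p
  exact (hφ (p + s • y)).hasFDerivAt.comp_hasDerivAt s h1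

theorem hasDerivAt_line_fderiv {φ : E n × E n → ℝ} (hφ : ContDiff ℝ 2 φ) (p y : E n × E n)
    (s : ℝ) : HasDerivAt (fun s : ℝ => fderiv ℝ φ (p + s • y) y)
      (secondDeriv φ (p + s • y) y) s :=
  hasDerivAt_line (differentiable_fderiv_apply hφ y) p y s

/-- Second order Taylor lower bound on `[0, 1]`. -/
theorem taylor_lower_bound {g g₁ g₂ : ℝ → ℝ} {c : ℝ} (h₁ : ∀ s, HasDerivAt g (g₁ s) s)
    (h₂ : ∀ s, HasDerivAt g₁ (g₂ s) s) (hc : ∀ s ∈ Icc (0 : ℝ) 1, -c ≤ g₂ s) :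
    g 0 + g₁ 0 - c / 2 ≤ g 1 := by
  have m₁ : MonotoneOn (fun s => g₁ s + c * s) (Icc 0 1) := by
    refine monotoneOn_of_hasDerivWithinAt_nonneg (f' := fun s => g₂ s + c) (convex_Icc 0 1)
      (fun s _ => ?_) (fun s _ => ?_) (fun s hs => ?_)
    · exact ((h₂ s).continuousAt.add (by fun_prop)).continuousWithinAt
    · exact (((h₂ s).add ((hasDerivAt_id s).const_mul c)).congr_deriv (by simp)).hasDerivWithinAt
    · linarith [hc s (interior_subset hs)]
  have m₂ : MonotoneOn (fun s => g s + c * s ^ 2 / 2 - g₁ 0 * s) (Icc 0 1) := by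
    refine monotoneOn_of_hasDerivWithinAt_nonneg (f' := fun s => g₁ s + c * s - g₁ 0)
      (convex_Icc 0 1) (fun s _ => ?_) (fun s _ => ?_) (fun s hs => ?_)
    · exact (((h₁ s).continuousAt.add (by fun_prop)).sub (by fun_prop)).continuousWithinAt
    · have e := (((h₁ s).add ((((hasDerivAt_id s).pow 2).const_mul c).div_const 2)).sub
        ((hasDerivAt_id s).const_mul (g₁ 0))).hasDerivWithinAt (s := interior (Icc 0 1))
      refine e.congr_deriv ?_
      simp; ring
    · have := m₁ (left_mem_Icc.2 zero_le_one) (interior_subset hs) (interior_subset hs).1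
      simp at this
      linarith
  have := m₂ (left_mem_Icc.2 zero_le_one) (right_mem_Icc.2 zero_le_one) zero_le_one
  simp at this
  linarith

theorem taylor_lower_bound_secondDeriv {φ : E n × E n → ℝ} (hφ : ContDiff ℝ 2 φ)
    (p y : E n × E n) {c : ℝ}
    (hc : ∀ s ∈ Icc (0 : ℝ) 1, -c ≤ secondDeriv φ (p + s • y) y) :
    φ p + fderiv ℝ φ p y - c / 2 ≤ φ (p + y) := by
  have := taylor_lower_bound (hasDerivAt_line (differentiable_of_contDiff_two hφ) p y)
    (hasDerivAt_line_fderiv hφ p y) hc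
  simpa using this

/-- The second derivative test, necessary condition. -/
theorem nonneg_of_isLocalMin {g g₁ : ℝ → ℝ} {d : ℝ} (h₁ : ∀ s, HasDerivAt g (g₁ s) s)
    (h₂ : HasDerivAt g₁ d 0) (hmin : IsLocalMin g 0) : 0 ≤ d := by
  by_contra hd
  push Not at hd
  have hg₁ : deriv g = g₁ := funext fun s => (h₁ s).deriv
  have hmax : IsLocalMax g 0 := by
    refine isLocalMax_of_deriv_deriv_neg ?_ ?_ (h₁ 0).continuousAt
    · rw [hg₁, h₂.deriv]; exact hd
    · exact hmin.deriv_eq_zero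
  have hconst : g =ᶠ[nhds 0] fun _ => g 0 := by
    filter_upwards [hmin, hmax] with s h h' using le_antisymm h' h
  have h0 : g₁ =ᶠ[nhds 0] fun _ => 0 := by
    have := hconst.deriv
    rw [hg₁] at this
    filter_upwards [this] with s hs
    simpa using hs
  have := h₂.congr_of_eventuallyEq h0.symm
  have := this.unique (hasDerivAt_const (0 : ℝ) (0 : ℝ))
  linarith

theorem kolm_nonneg_of_isLocalMin {φ : E n × E n → ℝ} (hφ : ContDiff ℝ 2 φ)
    {p : E n × E n} (hmin : IsLocalMin φ p) : 0 ≤ kolm φ p := by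
  have h0 : ∀ j, pd φ j p = 0 := fun j => by simp [pd, hmin.fderiv_eq_zero]
  have h2 : ∀ i, 0 ≤ pd (pd φ (Sum.inr i)) (Sum.inr i) p := by
    intro i
    refine nonneg_of_isLocalMin (hasDerivAt_line (differentiable_of_contDiff_two hφ) p
      (stdBasis n (Sum.inr i))) (d := pd (pd φ (Sum.inr i)) (Sum.inr i) p) ?_ ?_
    · have := hasDerivAt_line_fderiv hφ p (stdBasis n (Sum.inr i)) 0
      rw [zero_smul, add_zero] at this
      exact this
    · have hc : ContinuousAt (fun s : ℝ => p + s • stdBasis n (Sum.inr i)) 0 := by fun_prop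
      have hmin' : ∀ᶠ z in nhds (p + (0 : ℝ) • stdBasis n (Sum.inr i)), φ p ≤ φ z := by
        simpa [IsLocalMin, IsMinFilter] using hmin
      filter_upwards [hc.eventually hmin'] with s hs
      simpa using hs
  simp only [kolm, lapV, h0, mul_zero, Finset.sum_const_zero, sub_zero]
  exact Finset.sum_nonneg fun i _ => h2 i

end Calculus

section MinimumPrinciple

variable {n : ℕ}

theorem lapV_const_mul {φ : E n × E n → ℝ} (hφ : ContDiff ℝ 2 φ) (c : ℝ) (p : E n × E n) :
    lapV (fun z => c * φ z) p = c * lapV φ p := by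
  have h1 : ∀ j, pd (fun z => c * φ z) j = fun z => c * pd φ j z := fun j => by
    funext z
    simp [pd, fderiv_const_mul (differentiable_of_contDiff_two hφ z)]
  simp only [lapV, h1, Finset.mul_sum]
  refine Finset.sum_congr rfl fun i _ => ?_
  rw [pd, fderiv_const_mul (differentiable_pd hφ _ p)]
  rfl

theorem pd_const_mul {φ : E n × E n → ℝ} {p : E n × E n} (hφ : DifferentiableAt ℝ φ p) (c : ℝ)
    (j : Fin n ⊕ Fin n) : pd (fun z => c * φ z) j p = c * pd φ j p := by
  simp [pd, fderiv_const_mul hφ]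

theorem kolm_const_mul {φ : E n × E n → ℝ} (hφ : ContDiff ℝ 2 φ) (c : ℝ) (p : E n × E n) :
    kolm (fun z => c * φ z) p = c * kolm φ p := by
  simp only [kolm, lapV_const_mul hφ, pd_const_mul (differentiable_of_contDiff_two hφ p),
    mul_sub, Finset.mul_sum]
  congr 1
  exact Finset.sum_congr rfl fun i _ => by ring

theorem pd_add {φ ψ : E n × E n → ℝ} {p : E n × E n} (hφ : DifferentiableAt ℝ φ p)
    (hψ : DifferentiableAt ℝ ψ p) (j : Fin n ⊕ Fin n) :
    pd (fun z => φ z + ψ z) j p = pd φ j p + pd ψ j p := by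
  simp [pd, fderiv_fun_add hφ hψ]

theorem lapV_add {φ ψ : E n × E n → ℝ} (hφ : ContDiff ℝ 2 φ) (hψ : ContDiff ℝ 2 ψ)
    (p : E n × E n) : lapV (fun z => φ z + ψ z) p = lapV φ p + lapV ψ p := by
  have h1 : ∀ j, pd (fun z => φ z + ψ z) j = fun z => pd φ j z + pd ψ j z := fun j =>
    funext fun z => pd_add (differentiable_of_contDiff_two hφ z)
      (differentiable_of_contDiff_two hψ z) j
  simp only [lapV, h1, ← Finset.sum_add_distrib]
  exact Finset.sum_congr rfl fun i _ =>
    pd_add (differentiable_pd hφ _ p) (differentiable_pd hψ _ p) _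

theorem kolm_add {φ ψ : E n × E n → ℝ} (hφ : ContDiff ℝ 2 φ) (hψ : ContDiff ℝ 2 ψ)
    (p : E n × E n) : kolm (fun z => φ z + ψ z) p = kolm φ p + kolm ψ p := by
  simp only [kolm, lapV_add hφ hψ, pd_add (differentiable_of_contDiff_two hφ p)
    (differentiable_of_contDiff_two hψ p), mul_add, Finset.sum_add_distrib]
  ring

@[simp] theorem kolm_const (c : ℝ) (p : E n × E n) : kolm (fun _ : E n × E n => c) p = 0 := by
  have : ∀ (d : ℝ) (j : Fin n ⊕ Fin n), pd (fun _ : E n × E n => d) j = fun _ => 0 :=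
    fun d j => by funext z; simp [pd]
  simp [kolm, lapV, this]

theorem deriv_nonpos_of_forall_le_left {g : ℝ → ℝ} {d a b : ℝ} (hab : a < b)
    (hg : HasDerivAt g d b) (h : ∀ t ∈ Icc a b, g b ≤ g t) : d ≤ 0 := by
  have hmin : IsLocalMinOn g (Icc a b) b := by
    filter_upwards [self_mem_nhdsWithin] with t ht using h t ht
  have hy : a - b ∈ posTangentConeAt (Icc a b) b :=
    sub_mem_posTangentConeAt_of_segment_subset
      ((convex_Icc a b).segment_subset (right_mem_Icc.2 hab.le) (left_mem_Icc.2 hab.le))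
  have := hmin.hasFDerivWithinAt_nonneg hg.hasFDerivAt.hasFDerivWithinAt hy
  simp at this
  nlinarith

/-- Weak minimum principle for supersolutions of `∂ₜu = kolm u + C u` which are nonnegative
outside a compact set. -/
theorem minimum_principle {u : ℝ → E n × E n → ℝ} {t₀ t₁ C : ℝ} {S : Set (E n × E n)}
    (hS : IsCompact S)
    (hcont : ContinuousOn (fun q : ℝ × (E n × E n) => u q.1 q.2) (Icc t₀ t₁ ×ˢ univ))
    (hC2 : ∀ t ∈ Ioc t₀ t₁, ContDiff ℝ 2 (u t))
    (hineq : ∀ t ∈ Ioc t₀ t₁, ∀ z, u t z < 0 →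
      ∃ u', HasDerivAt (fun τ => u τ z) u' t ∧ kolm (u t) z + C * u t z ≤ u')
    (h0 : ∀ z, 0 ≤ u t₀ z) (hout : ∀ t ∈ Icc t₀ t₁, ∀ z, z ∉ S → 0 ≤ u t z) :
    ∀ t ∈ Icc t₀ t₁, ∀ z, 0 ≤ u t z := by
  intro t ht z
  by_contra hneg
  push Not at hneg
  set w : ℝ × (E n × E n) → ℝ := fun q => Real.exp (-(C + 1) * q.1) * u q.1 q.2 with hw
  have hwc : ContinuousOn w (Icc t₀ t₁ ×ˢ S) := by
    refine ContinuousOn.mul (by fun_prop) (hcont.mono ?_)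
    exact prod_mono le_rfl (subset_univ _)
  have hzS : z ∈ S := by
    by_contra h
    exact absurd (hout t ht z h) (not_le.2 hneg)
  obtain ⟨⟨s, y⟩, ⟨hs, hy⟩, hmin⟩ :=
    (isCompact_Icc.prod hS).exists_isMinOn ⟨(t, z), ht, hzS⟩ hwc
  have hwneg : w (s, y) < 0 :=
    (hmin (show (t, z) ∈ Icc t₀ t₁ ×ˢ S from ⟨ht, hzS⟩)).trans_lt
      (mul_neg_of_pos_of_neg (Real.exp_pos _) hneg)
  have hglob : ∀ s' ∈ Icc t₀ t₁, ∀ y', w (s, y) ≤ w (s', y') := by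
    intro s' hs' y'
    by_cases h : y' ∈ S
    · exact hmin (show (s', y') ∈ Icc t₀ t₁ ×ˢ S from ⟨hs', h⟩)
    · exact hwneg.le.trans (mul_nonneg (Real.exp_pos _).le (hout s' hs' y' h))
  have huneg : u s y < 0 := by
    by_contra h
    push Not at h
    exact absurd (mul_nonneg (Real.exp_pos (-(C + 1) * s)).le h) (not_le.2 hwneg)
  have hs0 : t₀ < s := by
    rcases hs.1.lt_or_eq with h | h
    · exact h
    · exact absurd (h0 y) (not_le.2 (by rw [h]; exact huneg))
  obtain ⟨u', hu', hle⟩ := hineq s ⟨hs0, hs.2⟩ y huneg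
  have hk : 0 ≤ kolm (u s) y := by
    refine kolm_nonneg_of_isLocalMin (hC2 s ⟨hs0, hs.2⟩) (Filter.Eventually.of_forall ?_)
    intro y'
    exact le_of_mul_le_mul_left (hglob s hs y') (Real.exp_pos _)
  have hd : HasDerivAt (fun τ => w (τ, y))
      (Real.exp (-(C + 1) * s) * (u' - (C + 1) * u s y)) s := by
    have h1 : HasDerivAt (fun τ : ℝ => Real.exp (-(C + 1) * τ))
        (Real.exp (-(C + 1) * s) * (-(C + 1))) s := by
      simpa using ((hasDerivAt_id s).const_mul (-(C + 1))).exp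
    exact (h1.mul hu').congr_deriv (by ring)
  have := deriv_nonpos_of_forall_le_left hs0 hd
    fun τ hτ => hglob τ ⟨hτ.1, hτ.2.trans hs.2⟩ y
  have h2 : 0 < u' - (C + 1) * u s y := by nlinarith
  have := mul_pos (Real.exp_pos (-(C + 1) * s)) h2
  linarith

end MinimumPrinciple

section Galilei

variable {n : ℕ}

theorem pd_mul {φ ψ : E n × E n → ℝ} {p : E n × E n} (hφ : DifferentiableAt ℝ φ p)
    (hψ : DifferentiableAt ℝ ψ p) (j : Fin n ⊕ Fin n) :
    pd (fun z => φ z * ψ z) j p = φ p * pd ψ j p + ψ p * pd φ j p := by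
  simp [pd, fderiv_fun_mul hφ hψ]

theorem pd_exp {g : E n × E n → ℝ} {p : E n × E n} (hg : DifferentiableAt ℝ g p)
    (j : Fin n ⊕ Fin n) :
    pd (fun z => Real.exp (g z)) j p = Real.exp (g p) * pd g j p := by
  simp [pd, fderiv_exp hg]

theorem lapV_mul {φ ψ : E n × E n → ℝ} (hφ : ContDiff ℝ 2 φ) (hψ : ContDiff ℝ 2 ψ)
    (p : E n × E n) : lapV (fun z => φ z * ψ z) p = φ p * lapV ψ p + ψ p * lapV φ p
      + 2 * ∑ i, pd φ (Sum.inr i) p * pd ψ (Sum.inr i) p := by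
  have dφ := differentiable_of_contDiff_two hφ
  have dψ := differentiable_of_contDiff_two hψ
  have h1 : ∀ j, pd (fun z => φ z * ψ z) j = fun z => φ z * pd ψ j z + ψ z * pd φ j z :=
    fun j => funext fun z => pd_mul (dφ z) (dψ z) j
  simp only [lapV, h1, Finset.mul_sum, ← Finset.sum_add_distrib]
  refine Finset.sum_congr rfl fun i _ => ?_
  rw [pd_add ((dφ p).fun_mul (differentiable_pd hψ _ p))
      ((dψ p).fun_mul (differentiable_pd hφ _ p)),
    pd_mul (dφ p) (differentiable_pd hψ _ p), pd_mul (dψ p) (differentiable_pd hφ _ p)]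
  ring

theorem kolm_mul {φ ψ : E n × E n → ℝ} (hφ : ContDiff ℝ 2 φ) (hψ : ContDiff ℝ 2 ψ)
    (p : E n × E n) : kolm (fun z => φ z * ψ z) p = φ p * kolm ψ p + ψ p * kolm φ p
      + 2 * ∑ i, pd φ (Sum.inr i) p * pd ψ (Sum.inr i) p := by
  have h : ∑ i : Fin n, p.2 i * (φ p * pd ψ (Sum.inl i) p + ψ p * pd φ (Sum.inl i) p)
      = φ p * ∑ i : Fin n, p.2 i * pd ψ (Sum.inl i) p
        + ψ p * ∑ i : Fin n, p.2 i * pd φ (Sum.inl i) p := by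
    simp only [Finset.mul_sum, ← Finset.sum_add_distrib]
    exact Finset.sum_congr rfl fun i _ => by ring
  simp only [kolm, lapV_mul hφ hψ, pd_mul (differentiable_of_contDiff_two hφ p)
    (differentiable_of_contDiff_two hψ p), h]
  ring

theorem kolm_exp {g : E n × E n → ℝ} (hg : ContDiff ℝ 2 g) (p : E n × E n) :
    kolm (fun z => Real.exp (g z)) p
      = Real.exp (g p) * (kolm g p + ∑ i, pd g (Sum.inr i) p ^ 2) := by
  have dg := differentiable_of_contDiff_two hg
  have h1 : ∀ j, pd (fun z => Real.exp (g z)) j = fun z => Real.exp (g z) * pd g j z :=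
    fun j => funext fun z => pd_exp (dg z) j
  have hl : lapV (fun z => Real.exp (g z)) p
      = Real.exp (g p) * (lapV g p + ∑ i, pd g (Sum.inr i) p ^ 2) := by
    simp only [lapV, h1, ← Finset.sum_add_distrib, Finset.mul_sum]
    refine Finset.sum_congr rfl fun i _ => ?_
    rw [pd_mul (dg p).exp (differentiable_pd hg _ p), pd_exp (dg p)]
    ring
  have hx : ∑ i : Fin n, p.2 i * (Real.exp (g p) * pd g (Sum.inl i) p)
      = Real.exp (g p) * ∑ i : Fin n, p.2 i * pd g (Sum.inl i) p := by
    rw [Finset.mul_sum]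
    exact Finset.sum_congr rfl fun i _ => by ring
  simp only [kolm, hl, h1, hx]
  ring

theorem pd_comp_sub (φ : E n × E n → ℝ) (a : E n × E n) (j : Fin n ⊕ Fin n) :
    pd (fun z => φ (z - a)) j = fun z => pd φ j (z - a) := by
  funext z
  simp [pd, fderiv_comp_sub]

theorem kolm_comp_sub (φ : E n × E n → ℝ) (a p : E n × E n) :
    kolm (fun z => φ (z - a)) p
      = kolm φ (p - a) - ∑ i, a.2 i * pd φ (Sum.inl i) (p - a) := by
  simp only [kolm, lapV, pd_comp_sub]
  simp only [Prod.snd_sub, PiLp.sub_apply, sub_mul, Finset.sum_sub_distrib]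
  ring

/-- The affine function `⟨p, v⟩ + ⟨r, x⟩ + c`. -/
def affine (p r : E n) (c : ℝ) (z : E n × E n) : ℝ := inner ℝ p z.2 + inner ℝ r z.1 + c

theorem contDiff_affine {m : WithTop ℕ∞} (p r : E n) (c : ℝ) :
    ContDiff ℝ m (affine p r c) := by
  exact ((contDiff_const.inner ℝ contDiff_snd).add (contDiff_const.inner ℝ contDiff_fst)).add
    contDiff_const

theorem pd_affine_inl (p r : E n) (c : ℝ) (i : Fin n) :
    pd (affine p r c) (Sum.inl i) = fun _ => r i := by
  funext z
  have h := hasDerivAt_line ((contDiff_affine (m := 1) p r c).differentiable (by norm_num)) z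
    (stdBasis n (Sum.inl i)) 0
  have h2 : HasDerivAt (fun s : ℝ => affine p r c (z + s • stdBasis n (Sum.inl i))) (r i) 0 := by
    have : (fun s : ℝ => affine p r c (z + s • stdBasis n (Sum.inl i)))
        = fun s => s * r i + affine p r c z := by
      funext s
      simp [affine, _root_.stdBasis, inner_add_right, inner_smul_right,
        EuclideanSpace.inner_single_right]
      ring
    rw [this]
    simpa using ((hasDerivAt_id (0 : ℝ)).mul_const (r i)).add_const (affine p r c z)
  simpa [pd] using h.unique h2

theorem pd_affine_inr (p r : E n) (c : ℝ) (i : Fin n) :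
    pd (affine p r c) (Sum.inr i) = fun _ => p i := by
  funext z
  have h := hasDerivAt_line ((contDiff_affine (m := 1) p r c).differentiable (by norm_num)) z
    (stdBasis n (Sum.inr i)) 0
  have h2 : HasDerivAt (fun s : ℝ => affine p r c (z + s • stdBasis n (Sum.inr i))) (p i) 0 := by
    have : (fun s : ℝ => affine p r c (z + s • stdBasis n (Sum.inr i)))
        = fun s => s * p i + affine p r c z := by
      funext s
      simp [affine, _root_.stdBasis, inner_add_right, inner_smul_right,
        EuclideanSpace.inner_single_right]
      ring
    rw [this]
    simpa using ((hasDerivAt_id (0 : ℝ)).mul_const (p i)).add_const (affine p r c z)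
  simpa [pd] using h.unique h2

theorem sum_mul_eq_inner (a b : E n) : ∑ i, a i * b i = inner ℝ a b := by
  simp [PiLp.inner_apply, mul_comm]

theorem kolm_affine (p r : E n) (c : ℝ) (z : E n × E n) :
    kolm (affine p r c) z = -inner ℝ r z.2 := by
  have h0 : ∀ (d : ℝ) (j : Fin n ⊕ Fin n), pd (fun _ : E n × E n => d) j z = 0 :=
    fun d j => by simp [pd]
  simp only [kolm, lapV, pd_affine_inr, pd_affine_inl, h0, sum_mul_eq_inner,
    Finset.sum_const_zero, zero_sub, real_inner_comm]

theorem kolm_exp_affine (p r : E n) (c : ℝ) (z : E n × E n) :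
    kolm (fun z => Real.exp (affine p r c z)) z
      = Real.exp (affine p r c z) * (‖p‖ ^ 2 - inner ℝ r z.2) := by
  rw [kolm_exp (contDiff_affine p r c), kolm_affine]
  simp only [pd_affine_inr, EuclideanSpace.norm_sq_eq, Real.norm_eq_abs, sq_abs]
  ring

/-- The Galilean transform of `k`: translation by `(X, V)` followed by multiplication with the
exponential of an affine function. -/
def galilei (p r X V : E n) (q : ℝ) (k : E n × E n → ℝ) (z : E n × E n) : ℝ :=
  Real.exp (inner ℝ p (z.2 - V) + inner ℝ r (z.1 - X) + q) * k (z - (X, V))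

theorem contDiff_galilei {p r X V : E n} {q : ℝ} {k : E n × E n → ℝ} (hk : ContDiff ℝ 2 k) :
    ContDiff ℝ 2 (galilei p r X V q k) := by
  have h1 : ContDiff ℝ 2 fun z : E n × E n => inner ℝ p (z.2 - V) :=
    contDiff_const.inner ℝ (contDiff_snd.sub contDiff_const)
  have h2 : ContDiff ℝ 2 fun z : E n × E n => inner ℝ r (z.1 - X) :=
    contDiff_const.inner ℝ (contDiff_fst.sub contDiff_const)
  exact ((h1.add h2).add contDiff_const).exp.mul (hk.comp (contDiff_id.sub contDiff_const))

theorem kolm_galilei (p r X V : E n) (q : ℝ) {k : E n × E n → ℝ} (hk : ContDiff ℝ 2 k)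
    (z : E n × E n) :
    kolm (galilei p r X V q k) z
      = Real.exp (inner ℝ p (z.2 - V) + inner ℝ r (z.1 - X) + q) *
        ((‖p‖ ^ 2 - inner ℝ r z.2) * k (z - (X, V)) + kolm k (z - (X, V))
          - ∑ i, V i * pd k (Sum.inl i) (z - (X, V))
          + 2 * ∑ i, p i * pd k (Sum.inr i) (z - (X, V))) := by
  have e : galilei p r X V q k = fun z => Real.exp (affine p r (q - inner ℝ p V - inner ℝ r X) z)
      * (fun z => k (z - (X, V))) z := by
    funext z
    simp only [galilei, affine, inner_sub_right]
    ring_nf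
  have e2 : affine p r (q - inner ℝ p V - inner ℝ r X) z
      = inner ℝ p (z.2 - V) + inner ℝ r (z.1 - X) + q := by
    simp only [affine, inner_sub_right]
    ring
  have hs : ContDiff ℝ 2 fun z => k (z - (X, V)) := by fun_prop
  rw [e, kolm_mul (contDiff_affine p r _).exp hs, kolm_comp_sub, kolm_exp_affine]
  simp only [pd_exp ((contDiff_affine (m := 1) p r _).differentiable (by norm_num) z),
    pd_affine_inr, pd_comp_sub, e2, mul_assoc, ← Finset.mul_sum]
  ring

theorem hasDerivAt_galilei {p r X V : ℝ → E n} {q : ℝ → ℝ} {k : ℝ → E n × E n → ℝ} {t : ℝ}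
    {p' r' : E n} {q' : ℝ} {z : E n × E n} (hp : HasDerivAt p p' t) (hr : HasDerivAt r r' t)
    (hX : HasDerivAt X (V t) t) (hV : HasDerivAt V ((-2 : ℝ) • p t) t)
    (hq : HasDerivAt q q' t) (hk2 : ContDiff ℝ 2 (k t))
    (hk : DifferentiableAt ℝ (fun q : ℝ × (E n × E n) => k q.1 q.2) (t, z - (X t, V t)))
    (hkt : HasDerivAt (fun τ => k τ (z - (X t, V t))) (kolm (k t) (z - (X t, V t))) t) :
    HasDerivAt (fun τ => galilei (p τ) (r τ) (X τ) (V τ) (q τ) (k τ) z)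
      (kolm (galilei (p t) (r t) (X t) (V t) (q t) (k t)) z
        + (inner ℝ (p' + r t) (z.2 - V t) + inner ℝ r' (z.1 - X t) + q' + ‖p t‖ ^ 2)
          * galilei (p t) (r t) (X t) (V t) (q t) (k t) z) t := by
  set ζ := z - (X t, V t) with hζ
  have hexp := ((hp.inner ℝ (hV.const_sub z.2)).add (hr.inner ℝ (hX.const_sub z.1))).add hq
  have hpath : HasDerivAt (fun τ => (τ, z - (X τ, V τ)))
      ((1 : ℝ), -(V t, (-2 : ℝ) • p t)) t :=
    (hasDerivAt_id t).prodMk ((hX.prodMk hV).const_sub z)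
  have hkc := hk.hasFDerivAt.comp_hasDerivAt t hpath
  have hkζ : fderiv ℝ (k t) ζ = (fderiv ℝ (fun q : ℝ × (E n × E n) => k q.1 q.2) (t, ζ)).comp
      (ContinuousLinearMap.inr ℝ ℝ (E n × E n)) := by
    have := hk.hasFDerivAt.comp ζ (hasFDerivAt_prodMk_right t ζ)
    exact this.fderiv
  have hkτ : fderiv ℝ (fun q : ℝ × (E n × E n) => k q.1 q.2) (t, ζ) (1, 0) = kolm (k t) ζ := by
    have := hk.hasFDerivAt.comp_hasDerivAt t
      ((hasDerivAt_id t).prodMk (hasDerivAt_const t ζ))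
    exact this.unique hkt
  have hval : fderiv ℝ (fun q : ℝ × (E n × E n) => k q.1 q.2) (t, ζ)
      ((1 : ℝ), -(V t, (-2 : ℝ) • p t))
      = kolm (k t) ζ - ∑ i, V t i * pd (k t) (Sum.inl i) ζ
        + 2 * ∑ i, p t i * pd (k t) (Sum.inr i) ζ := by
    have h1 : ((1 : ℝ), -(V t, (-2 : ℝ) • p t))
        = ((1 : ℝ), (0 : E n × E n)) + ContinuousLinearMap.inr ℝ ℝ (E n × E n)
          (-(V t), (2 : ℝ) • p t) := by
      ext <;> simp
    rw [h1, map_add, hkτ, ← ContinuousLinearMap.comp_apply, ← hkζ, fderiv_prod_apply_eq_sum]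
    simp only [PiLp.neg_apply, PiLp.smul_apply, smul_eq_mul, neg_mul, Finset.sum_neg_distrib,
      mul_assoc, ← Finset.mul_sum]
    ring
  have h := hexp.exp.mul hkc
  refine h.congr_deriv ?_
  rw [hval, kolm_galilei _ _ _ _ _ hk2, ← hζ]
  simp only [Function.comp, galilei, ← hζ, Pi.add_apply, inner_neg_right, inner_smul_right,
    real_inner_self_eq_norm_sq, inner_add_left, inner_sub_right]
  ring

end Galilei

section Kernel

variable {n : ℕ}

/-- The quadratic form `a‖x‖² + b⟨x, v⟩ + c‖v‖²`. -/
def quad (a b c : ℝ) (z : E n × E n) : ℝ :=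
  a * ‖z.1‖ ^ 2 + b * inner ℝ z.1 z.2 + c * ‖z.2‖ ^ 2

theorem contDiff_quad {m : WithTop ℕ∞} (a b c : ℝ) :
    ContDiff ℝ m (quad a b c : E n × E n → ℝ) :=
  ((contDiff_const.mul (contDiff_fst.norm_sq ℝ)).add
    (contDiff_const.mul (contDiff_fst.inner ℝ contDiff_snd))).add
    (contDiff_const.mul (contDiff_snd.norm_sq ℝ))

theorem pd_eq_of_line {φ : E n × E n → ℝ} (hφ : Differentiable ℝ φ) {j : Fin n ⊕ Fin n}
    {z : E n × E n} {d e : ℝ}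
    (h : ∀ s : ℝ, φ (z + s • stdBasis n j) = φ z + s * d + s ^ 2 * e) : pd φ j z = d := by
  have h1 := hasDerivAt_line hφ z (stdBasis n j) 0
  have h2 : HasDerivAt (fun s : ℝ => φ (z + s • stdBasis n j)) d 0 := by
    simp only [h]
    have := (((hasDerivAt_id (0 : ℝ)).mul_const d).const_add (φ z)).add
      (((hasDerivAt_id (0 : ℝ)).pow 2).mul_const e)
    exact this.congr_deriv (by simp)
  simpa [pd] using h1.unique h2

theorem pd_quad_inl (a b c : ℝ) (i : Fin n) :
    pd (quad a b c) (Sum.inl i) = fun z : E n × E n => 2 * a * z.1 i + b * z.2 i := by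
  funext z
  refine pd_eq_of_line ((contDiff_quad a b c (m := 1)).differentiable (by norm_num)) (e := a) ?_
  intro s
  simp only [quad, _root_.stdBasis, Prod.smul_mk, Prod.fst_add, Prod.snd_add, smul_zero, add_zero,
    inner_add_left, norm_add_sq_real, inner_smul_right, inner_smul_left, norm_smul,
    EuclideanSpace.inner_single_right, EuclideanSpace.inner_single_left, PiLp.norm_single]
  simp
  ring

theorem pd_quad_inr (a b c : ℝ) (i : Fin n) :
    pd (quad a b c) (Sum.inr i) = fun z : E n × E n => b * z.1 i + 2 * c * z.2 i := by
  funext z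
  refine pd_eq_of_line ((contDiff_quad a b c (m := 1)).differentiable (by norm_num)) (e := c) ?_
  intro s
  simp only [quad, _root_.stdBasis, Prod.smul_mk, Prod.fst_add, Prod.snd_add, smul_zero, add_zero,
    inner_add_right, norm_add_sq_real, inner_smul_right, norm_smul,
    EuclideanSpace.inner_single_right, PiLp.norm_single]
  simp
  ring

theorem pd_pd_quad_inr (a b c : ℝ) (i : Fin n) (z : E n × E n) :
    pd (pd (quad a b c) (Sum.inr i)) (Sum.inr i) z = 2 * c := by
  refine pd_eq_of_line (differentiable_pd (contDiff_quad a b c) _) (e := 0) ?_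
  intro s
  simp [pd_quad_inr, _root_.stdBasis]
  ring

theorem kolm_exp_quad (a b c : ℝ) (z : E n × E n) :
    kolm (fun z => Real.exp (quad a b c z)) z
      = Real.exp (quad a b c z) *
        (2 * n * c + quad (b ^ 2) (4 * b * c - 2 * a) (4 * c ^ 2 - b) z) := by
  have h1 : ∑ i : Fin n, z.2 i * (2 * a * z.1 i + b * z.2 i)
      = 2 * a * inner ℝ z.1 z.2 + b * ‖z.2‖ ^ 2 := by
    rw [← sum_mul_eq_inner, ← real_inner_self_eq_norm_sq, ← sum_mul_eq_inner, Finset.mul_sum,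
      Finset.mul_sum, ← Finset.sum_add_distrib]
    exact Finset.sum_congr rfl fun i _ => by ring
  have h2 : ∑ i : Fin n, (b * z.1 i + 2 * c * z.2 i) ^ 2
      = b ^ 2 * ‖z.1‖ ^ 2 + 4 * b * c * inner ℝ z.1 z.2 + 4 * c ^ 2 * ‖z.2‖ ^ 2 := by
    rw [← sum_mul_eq_inner, ← real_inner_self_eq_norm_sq, ← real_inner_self_eq_norm_sq,
      ← sum_mul_eq_inner, ← sum_mul_eq_inner, Finset.mul_sum, Finset.mul_sum, Finset.mul_sum,
      ← Finset.sum_add_distrib, ← Finset.sum_add_distrib]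
    exact Finset.sum_congr rfl fun i _ => by ring
  rw [kolm_exp (contDiff_quad a b c)]
  simp only [kolm, lapV, pd_pd_quad_inr]
  simp only [pd_quad_inr, pd_quad_inl, h1, h2, quad]
  simp
  ring

/-- The fundamental solution of the Kolmogorov equation, up to a constant factor. -/
def kernel (t : ℝ) (z : E n × E n) : ℝ :=
  (t ^ (2 * n))⁻¹ * Real.exp (quad (-(3 / t ^ 3)) (3 / t ^ 2) (-(1 / t)) z)

theorem contDiff_kernel {m : WithTop ℕ∞} (t : ℝ) : ContDiff ℝ m (kernel t : E n × E n → ℝ) :=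
  contDiff_const.mul (contDiff_quad _ _ _).exp

theorem differentiableAt_kernel {t : ℝ} (ht : t ≠ 0) (z : E n × E n) :
    DifferentiableAt ℝ (fun q : ℝ × (E n × E n) => kernel q.1 q.2) (t, z) := by
  have hd : DifferentiableAt ℝ (fun q : ℝ × (E n × E n) => q.1) (t, z) := differentiableAt_fst
  have h1 : DifferentiableAt ℝ (fun q : ℝ × (E n × E n) => ‖q.2.1‖ ^ 2) (t, z) :=
    differentiableAt_snd.fst.norm_sq ℝ
  have h2 : DifferentiableAt ℝ (fun q : ℝ × (E n × E n) => ‖q.2.2‖ ^ 2) (t, z) :=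
    differentiableAt_snd.snd.norm_sq ℝ
  have h3 : DifferentiableAt ℝ (fun q : ℝ × (E n × E n) => inner ℝ q.2.1 q.2.2) (t, z) :=
    differentiableAt_snd.fst.inner ℝ differentiableAt_snd.snd
  unfold kernel quad
  simp only [div_eq_mul_inv]
  have hp : ∀ k : ℕ, DifferentiableAt ℝ (fun q : ℝ × (E n × E n) => (q.1 ^ k)⁻¹) (t, z) :=
    fun k => (hd.fun_pow k).fun_inv (pow_ne_zero k ht)
  have hp1 : DifferentiableAt ℝ (fun q : ℝ × (E n × E n) => q.1⁻¹) (t, z) := hd.fun_inv ht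
  exact (hp _).fun_mul ((((((hp 3).const_mul 3).fun_neg.fun_mul h1).fun_add
    (((hp 2).const_mul 3).fun_mul h3)).fun_add ((hp1.const_mul 1).fun_neg.fun_mul h2)).exp)

theorem hasDerivAt_kernel {t : ℝ} (ht : t ≠ 0) (z : E n × E n) :
    HasDerivAt (fun τ => kernel τ z) (kolm (kernel t) z) t := by
  have hk : kolm (kernel t) z = (t ^ (2 * n))⁻¹ *
      kolm (fun z => Real.exp (quad (-(3 / t ^ 3)) (3 / t ^ 2) (-(1 / t)) z)) z :=
    kolm_const_mul (contDiff_quad _ _ _).exp _ _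
  have hp : ∀ k : ℕ, HasDerivAt (fun τ : ℝ => (τ ^ k)⁻¹) (-(k / t) * (t ^ k)⁻¹) t := by
    intro k
    refine ((hasDerivAt_pow k t).fun_inv (pow_ne_zero k ht)).congr_deriv ?_
    rcases k with _ | k
    · simp
    · simp only [Nat.add_sub_cancel]
      field_simp
      ring
  have h1 : HasDerivAt (fun τ : ℝ => -(3 / τ ^ 3)) (9 / t ^ 4) t := by
    simp only [div_eq_mul_inv]
    refine ((hp 3).const_mul 3).fun_neg.congr_deriv ?_
    push_cast
    field_simp
    ring
  have h2 : HasDerivAt (fun τ : ℝ => 3 / τ ^ 2) (-(6 / t ^ 3)) t := by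
    simp only [div_eq_mul_inv]
    refine ((hp 2).const_mul 3).congr_deriv ?_
    push_cast
    field_simp
    ring
  have h3 : HasDerivAt (fun τ : ℝ => -(1 / τ)) (1 / t ^ 2) t := by
    have := (hp 1).fun_neg
    simp only [pow_one] at this
    simp only [one_div]
    refine this.congr_deriv ?_
    push_cast
    field_simp
  have h := (hp (2 * n)).mul ((((h1.mul_const (‖z.1‖ ^ 2)).fun_add
    (h2.mul_const (inner ℝ z.1 z.2))).fun_add (h3.mul_const (‖z.2‖ ^ 2))).exp)
  refine h.congr_deriv ?_
  rw [hk, kolm_exp_quad]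
  simp only [quad]
  push_cast
  field_simp
  ring

theorem quad_kernel_le {t : ℝ} (ht : 0 < t) (z : E n × E n) :
    quad (-(3 / t ^ 3)) (3 / t ^ 2) (-(1 / t)) z
      ≤ -(1 / (8 * t) * (‖z.1‖ ^ 2 / t ^ 2 + ‖z.2‖ ^ 2)) := by
  have h1 := real_inner_le_norm z.1 z.2
  set X := ‖z.1‖
  set V := ‖z.2‖
  have key : 0 ≤ 23 / 8 * (X / t) ^ 2 - 3 * (X / t) * V + 7 / 8 * V ^ 2 := by
    nlinarith [sq_nonneg (23 * (X / t) - 12 * V), sq_nonneg V]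
  have h2 : 3 / t ^ 2 * inner ℝ z.1 z.2 ≤ 3 / t ^ 2 * (X * V) :=
    mul_le_mul_of_nonneg_left h1 (by positivity)
  have h3 : 0 ≤ (1 / t) * (23 / 8 * (X / t) ^ 2 - 3 * (X / t) * V + 7 / 8 * V ^ 2) :=
    mul_nonneg (by positivity) key
  have h4 : (1 / t) * (23 / 8 * (X / t) ^ 2 - 3 * (X / t) * V + 7 / 8 * V ^ 2)
      = 3 / t ^ 3 * X ^ 2 - 3 / t ^ 2 * (X * V) + 1 / t * V ^ 2
        - 1 / (8 * t) * (X ^ 2 / t ^ 2 + V ^ 2) := by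
    field_simp
    ring
  simp only [quad]
  linarith

theorem kernel_le {t : ℝ} (ht : 0 < t) (z : E n × E n) :
    kernel t z ≤ (t ^ (2 * n))⁻¹
      * Real.exp (-(1 / (8 * t) * (‖z.1‖ ^ 2 / t ^ 2 + ‖z.2‖ ^ 2))) :=
  mul_le_mul_of_nonneg_left (Real.exp_le_exp.2 (quad_kernel_le ht z)) (by positivity)

/-- A supersolution of the Kolmogorov equation with Gaussian growth, for short times. -/
def barrier (α β s t : ℝ) (z : E n × E n) : ℝ :=
  Real.exp (α * (1 + β * (t - s)) * (1 + ‖z.1‖ ^ 2 + ‖z.2‖ ^ 2))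

theorem contDiff_barrier {m : WithTop ℕ∞} (α β s t : ℝ) :
    ContDiff ℝ m (barrier α β s t : E n × E n → ℝ) :=
  (contDiff_const.mul ((contDiff_const.add (contDiff_fst.norm_sq ℝ)).add
    (contDiff_snd.norm_sq ℝ))).exp

theorem hasDerivAt_barrier (α β s t : ℝ) (z : E n × E n) :
    HasDerivAt (fun τ => barrier α β s τ z)
      (α * β * (1 + ‖z.1‖ ^ 2 + ‖z.2‖ ^ 2) * barrier α β s t z) t := by
  have h := (((((((hasDerivAt_id t).sub_const s).const_mul β).const_add 1).const_mul α).mul_const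
    (1 + ‖z.1‖ ^ 2 + ‖z.2‖ ^ 2)).exp)
  refine h.congr_deriv ?_
  simp only [barrier, id]
  ring

theorem kolm_barrier_le {α β s t : ℝ} (hα : 0 < α) (hβ : β = 4 * n + 16 * α + 2)
    (hst : s ≤ t) (ht : t ≤ s + 1 / β) (z : E n × E n) :
    kolm (barrier α β s t) z
      ≤ α * β * (1 + ‖z.1‖ ^ 2 + ‖z.2‖ ^ 2) * barrier α β s t z := by
  have hβ0 : 0 < β := by rw [hβ]; positivity
  obtain ⟨κ, hκ⟩ : ∃ κ, κ = α * (1 + β * (t - s)) := ⟨_, rfl⟩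
  have hk0 : 0 ≤ κ := by
    rw [hκ]
    have : 0 ≤ β * (t - s) := mul_nonneg hβ0.le (by linarith)
    positivity
  have hk2 : κ ≤ 2 * α := by
    have : β * (t - s) ≤ β * (1 / β) := mul_le_mul_of_nonneg_left (by linarith) hβ0.le
    rw [mul_one_div_cancel hβ0.ne'] at this
    rw [hκ]
    nlinarith
  have e : (barrier α β s t : E n × E n → ℝ)
      = fun z => Real.exp κ * Real.exp (quad κ 0 κ z) := by
    funext z
    rw [← Real.exp_add]
    simp only [barrier, quad, hκ]
    ring_nf
  have e2 : barrier α β s t z = Real.exp κ * Real.exp (quad κ 0 κ z) := by rw [e]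
  rw [e2, e, kolm_const_mul (contDiff_quad _ _ _).exp, kolm_exp_quad, ← mul_assoc,
    mul_comm (α * β * _)]
  refine mul_le_mul_of_nonneg_left ?_ (by positivity)
  simp only [quad]
  have h1 : |inner ℝ z.1 z.2| ≤ ‖z.1‖ * ‖z.2‖ := abs_real_inner_le_norm _ _
  have h2 := (abs_le.1 h1).1
  have h3 : -(2 * inner ℝ z.1 z.2) ≤ ‖z.1‖ ^ 2 + ‖z.2‖ ^ 2 := by
    nlinarith [sq_nonneg (‖z.1‖ - ‖z.2‖)]
  have h4 : κ * (-(2 * inner ℝ z.1 z.2)) ≤ κ * (‖z.1‖ ^ 2 + ‖z.2‖ ^ 2) :=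
    mul_le_mul_of_nonneg_left h3 hk0
  have h5 : κ * (2 * n + 1 + 4 * κ) ≤ α * β := by
    rw [hβ]
    have : κ * (2 * n + 1 + 4 * κ) ≤ (2 * α) * (2 * n + 1 + 4 * (2 * α)) := by
      gcongr
    linarith
  have h6 : κ * (2 * n + 1 + 4 * κ) * (1 + ‖z.1‖ ^ 2 + ‖z.2‖ ^ 2)
      ≤ α * β * (1 + ‖z.1‖ ^ 2 + ‖z.2‖ ^ 2) := by
    gcongr
  have h7 : 0 ≤ κ * (2 * n) * (‖z.1‖ ^ 2 + ‖z.2‖ ^ 2) + κ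
      + 4 * κ ^ 2 * (1 + ‖z.1‖ ^ 2) := by positivity
  nlinarith

end Kernel

section KernelComparison

variable {n : ℕ}

theorem exists_kernel_le {τ T δ : ℝ} (hτ : 0 < τ) (hδ : 0 < δ) :
    ∃ R, ∀ t ∈ Icc τ T, ∀ ζ : E n × E n, R ≤ ‖ζ‖ → kernel t ζ ≤ δ := by
  by_cases hT : τ ≤ T
  swap
  · exact ⟨0, fun t ht => absurd (ht.1.trans ht.2) hT⟩
  have hT0 : 0 < T := hτ.trans_le hT
  obtain ⟨c, hc⟩ : ∃ c, c = 1 / (8 * T) * (1 / (1 + T ^ 2)) := ⟨_, rfl⟩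
  have hc0 : 0 < c := by rw [hc]; positivity
  have hd : 0 < δ * τ ^ (2 * n) := by positivity
  refine ⟨max 1 (|Real.log (δ * τ ^ (2 * n))| / c), fun t ht ζ hR => ?_⟩
  have ht0 : 0 < t := hτ.trans_le ht.1
  have hz1 : 1 ≤ ‖ζ‖ := (le_max_left _ _).trans hR
  have hz2 : |Real.log (δ * τ ^ (2 * n))| ≤ c * ‖ζ‖ ^ 2 := by
    have := (div_le_iff₀ hc0).1 ((le_max_right _ _).trans hR)
    nlinarith [mul_le_mul_of_nonneg_left hz1 (mul_nonneg hc0.le (norm_nonneg ζ))]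
  have hz3 : ‖ζ‖ ^ 2 / (1 + T ^ 2) ≤ ‖ζ.1‖ ^ 2 / t ^ 2 + ‖ζ.2‖ ^ 2 := by
    have ht2 : t ^ 2 ≤ 1 + T ^ 2 := by nlinarith [ht.2]
    have e1 : ‖ζ.1‖ ^ 2 / (1 + T ^ 2) ≤ ‖ζ.1‖ ^ 2 / t ^ 2 := by gcongr
    have e2 : ‖ζ.2‖ ^ 2 / (1 + T ^ 2) ≤ ‖ζ.2‖ ^ 2 := div_le_self (by positivity) (by nlinarith)
    rcases max_choice ‖ζ.1‖ ‖ζ.2‖ with h | h <;> rw [Prod.norm_def, h]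
    · have : 0 ≤ ‖ζ.2‖ ^ 2 := by positivity
      linarith
    · have : 0 ≤ ‖ζ.1‖ ^ 2 / t ^ 2 := by positivity
      linarith
  have hz4 : c * ‖ζ‖ ^ 2 ≤ 1 / (8 * t) * (‖ζ.1‖ ^ 2 / t ^ 2 + ‖ζ.2‖ ^ 2) := by
    have : c * ‖ζ‖ ^ 2 = 1 / (8 * T) * (‖ζ‖ ^ 2 / (1 + T ^ 2)) := by rw [hc]; ring
    rw [this]
    have := ht.2
    gcongr
  calc kernel t ζ ≤ _ := kernel_le ht0 ζ
    _ ≤ (τ ^ (2 * n))⁻¹ * Real.exp (Real.log (δ * τ ^ (2 * n))) := by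
      have h1 := ht.1
      have h2 := neg_abs_le (Real.log (δ * τ ^ (2 * n)))
      gcongr
      linarith
    _ = δ := by
      rw [Real.exp_log hd]
      field_simp

theorem continuousOn_kernel :
    ContinuousOn (fun q : ℝ × (E n × E n) => kernel q.1 q.2) (Ioi 0 ×ˢ univ) :=
  fun q hq => (differentiableAt_kernel (ne_of_gt hq.1) q.2).continuousAt.continuousWithinAt

/-- A positive solution of `∂ₜP = KP + H P` dominates Galilean transforms of the truncated
fundamental solution as soon as it does so initially. -/
theorem galilei_kernel_le {p p' r r' X V : ℝ → E n} {q q' : ℝ → ℝ} {P : ℝ → E n × E n → ℝ}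
    {H : E n × E n → ℝ} {τ L δ κ : ℝ} (hτ : 0 < τ) (hδ : 0 < δ) (hκ : 0 ≤ κ)
    (hp : ∀ t, HasDerivAt p (p' t) t) (hr : ∀ t, HasDerivAt r (r' t) t)
    (hX : ∀ t, HasDerivAt X (V t) t) (hV : ∀ t, HasDerivAt V ((-2 : ℝ) • p t) t)
    (hq : ∀ t, HasDerivAt q (q' t) t)
    (hp' : Continuous p') (hr' : Continuous r') (hq' : Continuous q')
    (hpot : ∀ t z, inner ℝ (p' t + r t) (z.2 - V t) + inner ℝ (r' t) (z.1 - X t) + q' t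
      + ‖p t‖ ^ 2 ≤ H z)
    (hPc : Continuous fun q : ℝ × (E n × E n) => P q.1 q.2)
    (hP2 : ∀ t, ContDiff ℝ 2 (P t)) (hPpos : ∀ t z, 0 < P t z)
    (hPt : ∀ t z, HasDerivAt (fun τ => P τ z) (kolm (P t) z + H z * P t z) t)
    (h0 : ∀ z, δ ≤ kernel τ (z - (X 0, V 0)) →
      κ * galilei (p 0) (r 0) (X 0) (V 0) (q 0) (fun z => kernel τ z - δ) z ≤ P 0 z) :
    ∀ t ∈ Icc 0 L, ∀ z,
      κ * galilei (p t) (r t) (X t) (V t) (q t) (fun z => kernel (τ + t) z - δ) z ≤ P t z := by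
  have cont : ∀ {F : Type} [NormedAddCommGroup F] [NormedSpace ℝ F] {f f' : ℝ → F},
      (∀ t, HasDerivAt f (f' t) t) → Continuous f := fun h =>
    continuous_iff_continuousAt.2 fun t => (h t).continuousAt
  have cp := cont hp
  have cr := cont hr
  have cX := cont hX
  have cV := cont hV
  have cq := cont hq
  obtain ⟨R₁, hR₁⟩ := exists_kernel_le (n := n) (T := τ + L) hτ hδ
  obtain ⟨R₂, hR₂⟩ := (isCompact_Icc (a := (0 : ℝ)) (b := L)).exists_bound_of_continuousOn
    (cX.prodMk cV).continuousOn
  have hout : ∀ t ∈ Icc 0 L, ∀ z, z ∉ Metric.closedBall (0 : E n × E n) (R₁ + R₂) →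
      kernel (τ + t) (z - (X t, V t)) ≤ δ := by
    intro t ht z hz
    refine hR₁ _ ⟨by linarith [ht.1], by linarith [ht.2]⟩ _ ?_
    simp only [Metric.mem_closedBall, dist_zero_right, not_le] at hz
    have := norm_sub_norm_le z (X t, V t)
    have := hR₂ t ht
    linarith
  have cpot : Continuous fun y : ℝ × (E n × E n) =>
      inner ℝ (p' y.1 + r y.1) (y.2.2 - V y.1) + inner ℝ (r' y.1) (y.2.1 - X y.1) + q' y.1
        + ‖p y.1‖ ^ 2 := by
    refine ((Continuous.inner ?_ ?_).add (Continuous.inner ?_ ?_)).add ?_ |>.add ?_ <;> fun_prop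
  obtain ⟨C, hC⟩ := ((isCompact_Icc (a := (0 : ℝ)) (b := L)).prod
    (isCompact_closedBall (0 : E n × E n) (R₁ + R₂))).exists_bound_of_continuousOn
    cpot.continuousOn
  have hgneg : ∀ t z, kernel (τ + t) (z - (X t, V t)) ≤ δ → 0 ≤ P t z -
      κ * galilei (p t) (r t) (X t) (V t) (q t) (fun z => kernel (τ + t) z - δ) z := by
    intro t z h
    have : galilei (p t) (r t) (X t) (V t) (q t) (fun z => kernel (τ + t) z - δ) z ≤ 0 :=
      mul_nonpos_of_nonneg_of_nonpos (Real.exp_pos _).le (by linarith)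
    nlinarith [hPpos t z]
  have hk2 : ∀ t, ContDiff ℝ 2 fun z : E n × E n => kernel (τ + t) z - δ :=
    fun t => (contDiff_kernel _).sub contDiff_const
  have hG2 := fun t => contDiff_galilei (p := p t) (r := r t) (X := X t) (V := V t) (q := q t)
    (hk2 t)
  have hmain := minimum_principle (C := C)
    (u := fun t z => P t z -
      κ * galilei (p t) (r t) (X t) (V t) (q t) (fun z => kernel (τ + t) z - δ) z)
    (t₀ := 0) (t₁ := L) (isCompact_closedBall (0 : E n × E n) (R₁ + R₂)) ?_ ?_ ?_ ?_ ?_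
  · exact fun t ht z => sub_nonneg.1 (hmain t ht z)
  · have ck : ContinuousOn (fun y : ℝ × (E n × E n) =>
        kernel (τ + y.1) (y.2 - (X y.1, V y.1))) (Icc 0 L ×ˢ univ) := by
      refine (continuousOn_kernel (n := n)).comp (f := fun y : ℝ × (E n × E n) =>
        (τ + y.1, y.2 - (X y.1, V y.1))) (by fun_prop) fun y hy => ⟨?_, mem_univ _⟩
      have := hy.1.1
      simp only [mem_Ioi]
      linarith
    have ce : Continuous fun y : ℝ × (E n × E n) =>
        Real.exp (inner ℝ (p y.1) (y.2.2 - V y.1) + inner ℝ (r y.1) (y.2.1 - X y.1) + q y.1) := by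
      refine Real.continuous_exp.comp
        (((Continuous.inner ?_ ?_).add (Continuous.inner ?_ ?_)).add ?_) <;> fun_prop
    exact hPc.continuousOn.sub
      (continuousOn_const.mul (ce.continuousOn.mul (ck.sub continuousOn_const)))
  · exact fun t _ => (hP2 t).sub (contDiff_const.mul (hG2 t))
  · intro t ht z hneg
    have ht' : t ∈ Icc 0 L := ⟨ht.1.le, ht.2⟩
    have hτt : τ + t ≠ 0 := by linarith [ht.1]
    have hz : z ∈ Metric.closedBall (0 : E n × E n) (R₁ + R₂) := by
      by_contra hz
      exact absurd (hgneg t z (hout t ht' z hz)) (not_le.2 hneg)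
    have hGt := hasDerivAt_galilei (k := fun t z => kernel (τ + t) z - δ) (z := z)
      (hp t) (hr t) (hX t) (hV t) (hq t) (hk2 t) ?_ ?_
    · refine ⟨_, (hPt t z).fun_sub (hGt.const_mul κ), ?_⟩
      simp only [sub_eq_add_neg (P t _), ← neg_mul] at hneg ⊢
      rw [kolm_add (hP2 t) (contDiff_const.mul (hG2 t)), kolm_const_mul (hG2 t)]
      have h1 := hpot t z
      have h2 := (le_abs_self _).trans (hC (t, z) ⟨ht', hz⟩)
      simp only at h2
      generalize inner ℝ (p' t + r t) (z.2 - V t) + inner ℝ (r' t) (z.1 - X t) + q' t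
        + ‖p t‖ ^ 2 = pot at *
      generalize galilei (p t) (r t) (X t) (V t) (q t) (fun z => kernel (τ + t) z - δ) z = G at *
      have h3 := hPpos t z
      nlinarith
    · have hd : DifferentiableAt ℝ (fun q : ℝ × (E n × E n) => (τ + q.1, q.2))
          (t, z - (X t, V t)) := by fun_prop
      exact ((differentiableAt_kernel (t := τ + t) hτt (z - (X t, V t))).comp
        (t, z - (X t, V t)) hd).sub_const δ
    · have h1 := ((hasDerivAt_kernel hτt (z - (X t, V t))).comp_const_add τ t).sub_const δ
      refine h1.congr_deriv ?_
      simp only [sub_eq_add_neg]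
      rw [kolm_add (contDiff_kernel _) contDiff_const, kolm_const, add_zero]
  · intro z
    rcases le_total δ (kernel τ (z - (X 0, V 0))) with h | h
    · simpa using h0 z h
    · exact hgneg 0 z (by simpa using h)
  · exact fun t ht z hz => hgneg t z (hout t ht z hz)

theorem kolm_exp_neg_half {U : E n × E n → ℝ} (hU : ContDiff ℝ 2 U) (z : E n × E n) :
    kolm (fun z => Real.exp (-(1 / 2) * U z)) z
      = -(hfun U z * Real.exp (-(1 / 2) * U z)) := by
  rw [kolm_exp (contDiff_const.mul hU), kolm_const_mul hU]
  simp only [pd_const_mul (differentiable_of_contDiff_two hU z), mul_pow, ← Finset.mul_sum, hfun,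
    kolm]
  ring

end KernelComparison

section LinearPotential

variable {n : ℕ}

theorem norm_le_one_of_le_kernel {τ : ℝ} (hτ : 0 < τ) (hτ1 : τ ≤ 1) {s : ℝ} (hs : 0 ≤ s)
    {ζ : E n × E n}
    (h : (τ ^ (2 * n))⁻¹ * Real.exp (-(s ^ 2 / (8 * τ))) ≤ kernel τ ζ) : ‖ζ‖ ≤ s := by
  by_contra hζ
  push Not at hζ
  refine absurd (h.trans (kernel_le hτ ζ)) (not_le.2 ?_)
  have h1 : ‖ζ‖ ^ 2 ≤ ‖ζ.1‖ ^ 2 / τ ^ 2 + ‖ζ.2‖ ^ 2 := by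
    have e1 : ‖ζ.1‖ ^ 2 ≤ ‖ζ.1‖ ^ 2 / τ ^ 2 :=
      le_div_self (by positivity) (by positivity) (by nlinarith)
    rcases max_choice ‖ζ.1‖ ‖ζ.2‖ with h | h <;> rw [Prod.norm_def, h]
    · nlinarith [sq_nonneg ‖ζ.2‖]
    · nlinarith [sq_nonneg ‖ζ.1‖]
  have h2 : s ^ 2 / (8 * τ) < 1 / (8 * τ) * (‖ζ.1‖ ^ 2 / τ ^ 2 + ‖ζ.2‖ ^ 2) := by
    rw [div_eq_mul_one_div, mul_comm]
    have : s ^ 2 < ‖ζ‖ ^ 2 := by gcongr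
    have : s ^ 2 < ‖ζ.1‖ ^ 2 / τ ^ 2 + ‖ζ.2‖ ^ 2 := this.trans_le h1
    gcongr
  gcongr

theorem kernel_le_inv {τ : ℝ} (hτ : 0 < τ) (ζ : E n × E n) : kernel τ ζ ≤ (τ ^ (2 * n))⁻¹ := by
  refine (kernel_le hτ ζ).trans (mul_le_of_le_one_right (by positivity) ?_)
  rw [Real.exp_le_one_iff, neg_nonpos]
  positivity

theorem kernel_zero (t : ℝ) : kernel t (0 : E n × E n) = (t ^ (2 * n))⁻¹ := by
  simp [kernel, quad]

theorem not_le_of_growing_path {p p' r r' X V : ℝ → E n} {q q' : ℝ → ℝ}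
    {U : E n × E n → ℝ} (hU : ContDiff ℝ 2 U) {N η : ℝ} (hη : 0 < η)
    (hp : ∀ t, HasDerivAt p (p' t) t) (hr : ∀ t, HasDerivAt r (r' t) t)
    (hX : ∀ t, HasDerivAt X (V t) t) (hV : ∀ t, HasDerivAt V ((-2 : ℝ) • p t) t)
    (hq : ∀ t, HasDerivAt q (q' t) t)
    (hp' : Continuous p') (hr' : Continuous r') (hq' : Continuous q')
    (hpot : ∀ t z, inner ℝ (p' t + r t) (z.2 - V t) + inner ℝ (r' t) (z.1 - X t) + q' t
      + ‖p t‖ ^ 2 ≤ hfun U z)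
    (hpN : ‖p 0‖ ≤ N) (hrN : ‖r 0‖ ≤ N) (hXN : ∀ t, ‖X t‖ ≤ N) (hVN : ∀ t, ‖V t‖ ≤ N)
    (hq0 : q 0 = 0) (hqN : ∀ t, η * t - N ≤ q t) : False := by
  have hN : 0 ≤ N := (norm_nonneg _).trans hpN
  set W : E n × E n → ℝ := fun z => Real.exp (-(1 / 2) * U z) with hW
  have hW2 : ContDiff ℝ 2 W := (contDiff_const.mul hU).exp
  have hWpos : ∀ z, 0 < W z := fun z => Real.exp_pos _
  obtain ⟨zm, hzm, hm⟩ := (isCompact_closedBall (0 : E n × E n) (N + 1)).exists_isMinOn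
    ⟨0, by simp; linarith⟩ hW2.continuous.continuousOn
  obtain ⟨zM, hzM, hM⟩ := (isCompact_closedBall (0 : E n × E n) (N + 1)).exists_isMaxOn
    ⟨0, by simp; linarith⟩ hW2.continuous.continuousOn
  set m := W zm
  set M := W zM
  have hmpos : 0 < m := hWpos zm
  have hMpos : 0 < M := hWpos zM
  have hball : ∀ t (ζ : E n × E n), ‖ζ‖ ≤ 1 → (X t, V t) + ζ ∈ Metric.closedBall 0 (N + 1) := by
    intro t ζ hζ
    rw [mem_closedBall_zero_iff]
    exact (norm_add_le _ _).trans (add_le_add (max_le (hXN t) (hVN t)) hζ)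
  have hmain : ∀ L : ℝ, 1 ≤ L →
      0 ≤ ((2 * L) ^ (2 * n))⁻¹ - L ^ (2 * n) * Real.exp (-(L / 8)) → m * Real.exp (-(3 * N)) * Real.exp (η * L) * (L ^ (2 * n))⁻¹ *
      (((2 * L) ^ (2 * n))⁻¹ - L ^ (2 * n) * Real.exp (-(L / 8))) ≤ M := by
    intro L hL h0
    have hL0 : 0 < L := by linarith
    set τ : ℝ := L⁻¹ with hτ
    have hτ0 : 0 < τ := inv_pos.2 hL0
    have hτ1 : τ ≤ 1 := inv_le_one_of_one_le₀ hL
    set δ : ℝ := (τ ^ (2 * n))⁻¹ * Real.exp (-(1 ^ 2 / (8 * τ))) with hδ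
    have hδ0 : 0 < δ := by positivity
    set κ : ℝ := m * Real.exp (-(2 * N)) * τ ^ (2 * n) with hκ
    have hκ0 : 0 < κ := by positivity
    have h := galilei_kernel_le (P := fun _ => W) (H := hfun U) (L := L) hτ0 hδ0 hκ0.le hp hr hX hV
      hq hp' hr' hq' hpot (hW2.continuous.comp continuous_snd) (fun _ => hW2) (fun _ => hWpos)
      (fun t z => (hasDerivAt_const t (W z)).congr_deriv (by rw [kolm_exp_neg_half hU]; ring)) ?_
      L ⟨hL0.le, le_rfl⟩ (X L, V L)
    · have hWM : W (X L, V L) ≤ M := by simpa using hM (hball L 0 (by simp))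
      refine le_trans ?_ (h.trans hWM)
      simp only [galilei, sub_self, inner_zero_right, zero_add, kernel_zero]
      have hδ' : δ = L ^ (2 * n) * Real.exp (-(L / 8)) := by
        rw [hδ, hτ]
        congr 1
        · simp
        · congr 1
          field_simp
      have hκ' : κ = m * Real.exp (-(2 * N)) * (L ^ (2 * n))⁻¹ := by rw [hκ, hτ, inv_pow]
      rw [hδ', hκ']
      have h1 : ((2 * L) ^ (2 * n))⁻¹ ≤ ((τ + L) ^ (2 * n))⁻¹ := by
        gcongr
        linarith
      have h2 : Real.exp (-(3 * N)) * Real.exp (η * L) ≤ Real.exp (-(2 * N)) * Real.exp (q L) := by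
        rw [← Real.exp_add, ← Real.exp_add]
        exact Real.exp_le_exp.2 (by linarith [hqN L])
      calc _ = m * (Real.exp (-(3 * N)) * Real.exp (η * L)) * (L ^ (2 * n))⁻¹ *
            (((2 * L) ^ (2 * n))⁻¹ - L ^ (2 * n) * Real.exp (-(L / 8))) := by ring
        _ ≤ m * (Real.exp (-(2 * N)) * Real.exp (q L)) * (L ^ (2 * n))⁻¹ *
            (((τ + L) ^ (2 * n))⁻¹ - L ^ (2 * n) * Real.exp (-(L / 8))) := by gcongr
        _ = _ := by ring
    · intro z hz
      have hζ := norm_le_one_of_le_kernel hτ0 hτ1 zero_le_one hz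
      have hWm : m ≤ W z := by simpa using hm (hball 0 _ hζ)
      refine le_trans ?_ hWm
      have h1 : inner ℝ (p 0) (z.2 - V 0) ≤ N := by
        have := (real_inner_le_norm (p 0) (z.2 - V 0)).trans
          (mul_le_mul hpN ((le_max_right _ _).trans hζ) (norm_nonneg _) hN)
        linarith
      have h2 : inner ℝ (r 0) (z.1 - X 0) ≤ N := by
        have := (real_inner_le_norm (r 0) (z.1 - X 0)).trans
          (mul_le_mul hrN ((le_max_left _ _).trans hζ) (norm_nonneg _) hN)
        linarith
      have h3 : kernel τ (z - (X 0, V 0)) - δ ≤ (τ ^ (2 * n))⁻¹ := by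
        linarith [kernel_le_inv hτ0 (z - (X 0, V 0))]
      calc _ ≤ κ * (Real.exp (2 * N) * (τ ^ (2 * n))⁻¹) := by
            simp only [galilei, hq0]
            gcongr
            linarith
        _ = m := by
          rw [hκ, Real.exp_neg]
          field_simp
  have o1 := (isLittleO_pow_exp_pos_mul_atTop (4 * n) (show (0 : ℝ) < 1 / 8 by norm_num)).def
    (show (0 : ℝ) < 1 / (2 * 2 ^ (2 * n)) by positivity)
  have o2 := (isLittleO_pow_exp_pos_mul_atTop (4 * n) hη).def
    (show (0 : ℝ) < m * Real.exp (-(3 * N)) / (4 * 2 ^ (2 * n) * M) by positivity)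
  obtain ⟨L, h1, h2, hL⟩ := (o1.and (o2.and (Filter.eventually_ge_atTop 1))).exists
  have hL0 : 0 < L := by linarith
  rw [Real.norm_of_nonneg (by positivity), Real.norm_of_nonneg (by positivity)] at h1 h2
  have e4 : L ^ (4 * n) = L ^ (2 * n) * L ^ (2 * n) := by rw [← pow_add]; ring_nf
  rw [e4] at h1 h2
  have e3 : Real.exp (-(L / 8)) = (Real.exp (1 / 8 * L))⁻¹ := by rw [← Real.exp_neg]; ring_nf
  have h3 : L ^ (2 * n) * Real.exp (-(L / 8)) ≤ ((2 * L) ^ (2 * n))⁻¹ / 2 := by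
    rw [e3, mul_pow, ← div_eq_mul_inv, div_le_iff₀ (by positivity)]
    rw [← div_le_iff₀ (by positivity)] at h1
    rw [← mul_le_mul_iff_of_pos_left (show 0 < L ^ (2 * n) by positivity)]
    calc _ ≤ 1 / (2 * 2 ^ (2 * n)) * Real.exp (1 / 8 * L) := by
          rw [div_le_iff₀ (by positivity)] at h1
          linarith
      _ = _ := by field_simp
  have h4 : 2 * M ≤ m * Real.exp (-(3 * N)) * Real.exp (η * L) * (L ^ (2 * n))⁻¹ *
      (((2 * L) ^ (2 * n))⁻¹ / 2) := by
    have : 2 * M * (L ^ (2 * n) * L ^ (2 * n)) ≤ 2 * M * (m * Real.exp (-(3 * N)) /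
        (4 * 2 ^ (2 * n) * M) * Real.exp (η * L)) := by gcongr
    rw [mul_pow]
    field_simp
    field_simp at this
    nlinarith
  have h5 : m * Real.exp (-(3 * N)) * Real.exp (η * L) * (L ^ (2 * n))⁻¹ *
      (((2 * L) ^ (2 * n))⁻¹ / 2) ≤ M := by
    refine le_trans ?_ (hmain L hL ?_)
    swap
    · have : 0 ≤ ((2 * L) ^ (2 * n))⁻¹ := by positivity
      linarith
    gcongr
    linarith
  linarith

end LinearPotential

section Rigidity

variable {n : ℕ}

/-- The path `sin (ω t) A + cos (ω t) B`. -/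
def trigPath (ω : ℝ) (A B : E n) (t : ℝ) : E n := Real.sin (ω * t) • A + Real.cos (ω * t) • B

theorem hasDerivAt_trigPath (ω : ℝ) (A B : E n) (t : ℝ) :
    HasDerivAt (trigPath ω A B) (trigPath ω (-(ω • B)) (ω • A) t) t := by
  have h1 : HasDerivAt (fun t : ℝ => ω * t) ω t := by
    simpa using (hasDerivAt_id t).const_mul ω
  refine ((h1.sin.smul_const A).add (h1.cos.smul_const B)).congr_deriv ?_
  simp only [trigPath]
  module

theorem norm_trigPath_le (ω : ℝ) (A B : E n) (t : ℝ) : ‖trigPath ω A B t‖ ≤ ‖A‖ + ‖B‖ := by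
  refine (norm_add_le _ _).trans (add_le_add ?_ ?_) <;> rw [norm_smul]
  · exact mul_le_of_le_one_left (norm_nonneg _) (Real.abs_sin_le_one _)
  · exact mul_le_of_le_one_left (norm_nonneg _) (Real.abs_cos_le_one _)

theorem continuous_trigPath (ω : ℝ) (A B : E n) : Continuous (trigPath ω A B) :=
  continuous_iff_continuousAt.2 fun t => (hasDerivAt_trigPath ω A B t).continuousAt

theorem not_abs_linear_sub_le_hfun {U : E n × E n → ℝ} (hU : ContDiff ℝ 2 U) {lx lv : E n}
    {C ω : ℝ} (hω : 0 < ω) (hη : 0 < ‖lx‖ ^ 2 / ω ^ 4 / 2 + ‖lv‖ ^ 2 / ω ^ 2 / 2 - C)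
    (h : ∀ z : E n × E n, |inner ℝ lx z.1 + inner ℝ lv z.2| - C ≤ hfun U z) : False := by
  have hω0 := hω.ne'
  set p := trigPath ω (ω⁻¹ • lv) ((ω ^ 2)⁻¹ • lx) with hpdef
  set r := trigPath ω (ω⁻¹ • lx) 0 with hrdef
  set X := trigPath ω ((2 / ω ^ 3) • lv) ((2 / ω ^ 4) • lx) with hXdef
  set V := trigPath ω (-((2 / ω ^ 3) • lx)) ((2 / ω ^ 2) • lv) with hVdef
  set A := ‖lx‖ ^ 2 / ω ^ 4 with hA
  set B := ‖lv‖ ^ 2 / ω ^ 2 with hB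
  set D := 2 * inner ℝ lv lx / ω ^ 3 with hD
  set η := A / 2 + B / 2 - C with hηdef
  set q : ℝ → ℝ := fun t => η * t + (A / (2 * ω) + 3 * B / (2 * ω)) *
    (Real.sin (ω * t) * Real.cos (ω * t)) - D / (2 * ω) * Real.sin (ω * t) ^ 2 with hqdef
  set q' : ℝ → ℝ := fun t => Real.cos (ω * t) * (inner ℝ lx (X t) + inner ℝ lv (V t)) - C
    - ‖p t‖ ^ 2 with hq'def
  have cX : Continuous X := continuous_trigPath _ _ _
  have cV : Continuous V := continuous_trigPath _ _ _
  have cp : Continuous p := continuous_trigPath _ _ _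
  have hq : ∀ t, HasDerivAt q (q' t) t := by
    intro t
    have h1 : HasDerivAt (fun t : ℝ => ω * t) ω t := by
      simpa using (hasDerivAt_id t).const_mul ω
    have h2 := ((((hasDerivAt_id t).const_mul η).fun_add ((h1.sin.fun_mul h1.cos).const_mul
      (A / (2 * ω) + 3 * B / (2 * ω)))).fun_sub ((h1.sin.fun_pow 2).const_mul (D / (2 * ω))))
    refine h2.congr_deriv ?_
    have h3 := Real.sin_sq_add_cos_sq (ω * t)
    simp only [hq'def, hpdef, hXdef, hVdef, trigPath, inner_add_right, inner_smul_right,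
      inner_neg_right, norm_add_sq_real, inner_smul_left, norm_smul, smul_neg, Real.norm_eq_abs,
      mul_pow, sq_abs, real_inner_self_eq_norm_sq, hηdef, hA, hB, hD, real_inner_comm lv lx]
    simp
    field_simp
    have h4 : Real.cos (ω * t) ^ 2 = 1 - Real.sin (ω * t) ^ 2 := by linarith
    ring_nf
    ring_nf at h4
    simp only [h4]
    ring
  set N := max (max (‖ω⁻¹ • lv‖ + ‖(ω ^ 2)⁻¹ • lx‖) (‖ω⁻¹ • lx‖ + ‖(0 : E n)‖))
    (max (max (‖(2 / ω ^ 3) • lv‖ + ‖(2 / ω ^ 4) • lx‖) (‖-((2 / ω ^ 3) • lx)‖ + ‖(2 / ω ^ 2) • lv‖))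
      (|A / (2 * ω) + 3 * B / (2 * ω)| + |D / (2 * ω)|)) with hNdef
  refine not_le_of_growing_path (p := p) (r := r) (X := X) (V := V) (q := q) (q' := q') (N := N)
    hU hη (hasDerivAt_trigPath _ _ _) (hasDerivAt_trigPath _ _ _) (fun t => ?_) (fun t => ?_) hq
    (continuous_trigPath _ _ _) (continuous_trigPath _ _ _) ?_ (fun t z => ?_)
    ((norm_trigPath_le _ _ _ _).trans ?_) ((norm_trigPath_le _ _ _ _).trans ?_)
    (fun t => (norm_trigPath_le _ _ _ _).trans ?_) (fun t => (norm_trigPath_le _ _ _ _).trans ?_)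
    (by simp [hqdef]) (fun t => ?_)
  · refine (hasDerivAt_trigPath _ _ _ t).congr_deriv ?_
    rw [hVdef]
    congr 1 <;> rw [smul_smul] <;> congr 1 <;> field_simp
  · refine (hasDerivAt_trigPath _ _ _ t).congr_deriv ?_
    simp only [hpdef, trigPath, smul_neg, smul_smul]
    rw [show ω * (2 / ω ^ 2) = 2 * ω⁻¹ by field_simp,
      show ω * (2 / ω ^ 3) = 2 * (ω ^ 2)⁻¹ by field_simp]
    module
  · refine Continuous.sub (Continuous.sub (Continuous.mul (by fun_prop) (Continuous.add
      (Continuous.inner ?_ ?_) (Continuous.inner ?_ ?_))) continuous_const) ?_ <;> fun_prop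
  · have e1 : trigPath ω (-(ω • (ω ^ 2)⁻¹ • lx)) (ω • ω⁻¹ • lv) t + r t
        = Real.cos (ω * t) • lv := by
      simp only [hrdef, trigPath, smul_neg, smul_smul, smul_zero]
      rw [mul_inv_cancel₀ hω0, show ω * (ω ^ 2)⁻¹ = ω⁻¹ by field_simp]
      module
    have e2 : trigPath ω (-(ω • (0 : E n))) (ω • ω⁻¹ • lx) t = Real.cos (ω * t) • lx := by
      simp [trigPath, smul_smul, mul_inv_cancel₀ hω0]
    rw [e1, e2]
    refine le_trans ?_ (h z)
    have h1 : |Real.cos (ω * t) * (inner ℝ lx z.1 + inner ℝ lv z.2)|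
        ≤ |inner ℝ lx z.1 + inner ℝ lv z.2| := by
      rw [abs_mul]
      exact mul_le_of_le_one_left (abs_nonneg _) (Real.abs_cos_le_one _)
    have h2 := (le_abs_self _).trans h1
    simp only [hq'def, inner_smul_left, inner_sub_right, conj_trivial]
    linarith
  · exact (le_max_left _ _).trans (le_max_left _ _)
  · exact (le_max_right _ _).trans (le_max_left _ _)
  · exact (le_max_left _ _).trans ((le_max_left _ _).trans (le_max_right _ _))
  · exact (le_max_right _ _).trans ((le_max_left _ _).trans (le_max_right _ _))
  · have h1 : |A / (2 * ω) + 3 * B / (2 * ω)| + |D / (2 * ω)| ≤ N :=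
      (le_max_right _ _).trans (le_max_right _ _)
    have h2 : |(A / (2 * ω) + 3 * B / (2 * ω)) * (Real.sin (ω * t) * Real.cos (ω * t))|
        ≤ |A / (2 * ω) + 3 * B / (2 * ω)| := by
      rw [abs_mul, abs_mul]
      exact mul_le_of_le_one_right (abs_nonneg _) (mul_le_one₀ (Real.abs_sin_le_one _)
        (abs_nonneg _) (Real.abs_cos_le_one _))
    have h3 : |D / (2 * ω) * Real.sin (ω * t) ^ 2| ≤ |D / (2 * ω)| := by
      rw [abs_mul]
      exact mul_le_of_le_one_right (abs_nonneg _)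
        (by rw [abs_of_nonneg (sq_nonneg _)]; exact Real.sin_sq_le_one _)
    have h4 := (abs_le.1 h2).1
    have h5 := (abs_le.1 h3).2
    simp only [hqdef]
    linarith

theorem eq_zero_of_abs_linear_sub_le_hfun {U : E n × E n → ℝ} (hU : ContDiff ℝ 2 U)
    {lx lv : E n} {C : ℝ}
    (h : ∀ z : E n × E n, |inner ℝ lx z.1 + inner ℝ lv z.2| - C ≤ hfun U z) :
    (lx = 0 ∧ lv = 0) ∧ 0 ≤ C := by
  by_contra hne
  suffices hω : ∃ ω : ℝ, 0 < ω ∧ 0 < ‖lx‖ ^ 2 / ω ^ 4 / 2 + ‖lv‖ ^ 2 / ω ^ 2 / 2 - C by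
    obtain ⟨ω, hω, hη⟩ := hω
    exact not_abs_linear_sub_le_hfun hU hω hη h
  have key : ∀ a : ℝ, 0 < a → ∃ ω : ℝ, 0 < ω ∧ ω ≤ 1 ∧ C < a / ω ^ 2 / 2 := by
    intro a ha
    refine ⟨min 1 (a / (2 * (|C| + 1))), by positivity, min_le_left _ _, ?_⟩
    set ω := min 1 (a / (2 * (|C| + 1))) with hωd
    have h0 : 0 < ω := by positivity
    have h1 : ω ≤ 1 := min_le_left _ _
    have h2 : ω ≤ a / (2 * (|C| + 1)) := min_le_right _ _
    rw [le_div_iff₀ (by positivity)] at h2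
    have h3 := le_abs_self C
    rw [div_div, lt_div_iff₀ (by positivity)]
    have h4 : C * (ω ^ 2 * 2) ≤ |C| * (ω ^ 2 * 2) := by gcongr
    have h5 : ω ^ 2 ≤ ω := by nlinarith
    have h6 : |C| * (ω ^ 2 * 2) ≤ |C| * (ω * 2) := by gcongr
    nlinarith
  have h4 : ∀ ω : ℝ, 0 ≤ ‖lx‖ ^ 2 / ω ^ 4 / 2 := fun ω => by positivity
  have h2 : ∀ ω : ℝ, 0 ≤ ‖lv‖ ^ 2 / ω ^ 2 / 2 := fun ω => by positivity
  by_cases hx : lx = 0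
  · by_cases hv : lv = 0
    · exact ⟨1, one_pos, by simp_all⟩
    · obtain ⟨ω, h0, -, hω⟩ := key (‖lv‖ ^ 2) (by positivity)
      exact ⟨ω, h0, by linarith [h4 ω]⟩
  · obtain ⟨ω, h0, h1, hω⟩ := key (‖lx‖ ^ 2) (by positivity)
    refine ⟨ω, h0, ?_⟩
    have : ‖lx‖ ^ 2 / ω ^ 2 / 2 ≤ ‖lx‖ ^ 2 / ω ^ 4 / 2 := by
      gcongr ?_ / 2
      exact div_le_div_of_nonneg_left (by positivity) (by positivity)
        (pow_le_pow_of_le_one h0.le h1 (by norm_num))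
    linarith [h2 ω]

end Rigidity

section Affine

variable {n : ℕ}

theorem fderiv_apply_eq_inner (φ : E n × E n → ℝ) (p y : E n × E n) :
    fderiv ℝ φ p y = inner ℝ (WithLp.toLp 2 fun i => pd φ (Sum.inl i) p : E n) y.1
      + inner ℝ (WithLp.toLp 2 fun i => pd φ (Sum.inr i) p : E n) y.2 := by
  conv_lhs => rw [← Prod.mk.eta (p := y), fderiv_prod_apply_eq_sum]
  rw [← sum_mul_eq_inner, ← sum_mul_eq_inner]
  simp [mul_comm]

theorem contDiff_hfun {U : E n × E n → ℝ} (hU : ContDiff ℝ (⊤ : ℕ∞) U) :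
    ContDiff ℝ (⊤ : ℕ∞) (hfun U) := by
  have h1 : ∀ j, ContDiff ℝ (⊤ : ℕ∞) (pd U j) := contDiff_pd hU (by simp)
  have h2 : ∀ j, ContDiff ℝ (⊤ : ℕ∞) (pd (pd U j) j) := fun j => contDiff_pd (h1 j) (by simp) j
  unfold hfun lapV
  refine ContDiff.sub (ContDiff.add (contDiff_const.mul (ContDiff.sum fun i _ =>
    ContDiff.mul ?_ (h1 _))) (contDiff_const.mul (ContDiff.sum fun i _ => h2 _)))
    (contDiff_const.mul (ContDiff.sum fun i _ => (h1 _).pow 2))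
  fun_prop

/-- The symmetrization of `φ` about the point `b`. -/
def symmAt (φ : E n × E n → ℝ) (b z : E n × E n) : ℝ := (1 / 2) * (φ (b + z) + φ (b - z))

theorem contDiff_symmAt {φ : E n × E n → ℝ} {k : WithTop ℕ∞} (hφ : ContDiff ℝ k φ)
    (b : E n × E n) : ContDiff ℝ k (symmAt φ b) :=
  contDiff_const.mul ((hφ.comp (contDiff_const.add contDiff_id)).add
    (hφ.comp (contDiff_const.sub contDiff_id)))

theorem pd_comp_const_add (φ : E n × E n → ℝ) (b : E n × E n) (j : Fin n ⊕ Fin n) :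
    pd (fun z => φ (b + z)) j = fun z => pd φ j (b + z) := by
  funext z
  simp [pd, fderiv_comp_add_left]

theorem pd_comp_const_sub {φ : E n × E n → ℝ} (hφ : Differentiable ℝ φ) (b : E n × E n)
    (j : Fin n ⊕ Fin n) : pd (fun z => φ (b - z)) j = fun z => -1 * pd φ j (b - z) := by
  funext z
  have := (hφ (b - z)).hasFDerivAt.comp z ((hasFDerivAt_id z).const_sub b)
  simp only [pd]
  rw [HasFDerivAt.fderiv (f := fun z => φ (b - z)) this]
  simp

theorem pd_symmAt {φ : E n × E n → ℝ} (hφ : Differentiable ℝ φ) (b : E n × E n)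
    (j : Fin n ⊕ Fin n) :
    pd (symmAt φ b) j = fun z => (1 / 2) * (pd φ j (b + z) + -1 * pd φ j (b - z)) := by
  funext z
  have h1 : Differentiable ℝ fun z => φ (b + z) := hφ.comp (by fun_prop)
  have h2 : Differentiable ℝ fun z => φ (b - z) := hφ.comp (by fun_prop)
  unfold symmAt
  rw [pd_const_mul (φ := fun z => φ (b + z) + φ (b - z)) ((h1 z).add (h2 z)), pd_add (h1 z) (h2 z),
    pd_comp_const_add, pd_comp_const_sub hφ]

theorem pd_pd_symmAt {φ : E n × E n → ℝ} (hφ : ContDiff ℝ 2 φ) (b z : E n × E n)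
    (j : Fin n ⊕ Fin n) :
    pd (pd (symmAt φ b) j) j z
      = (1 / 2) * (pd (pd φ j) j (b + z) + pd (pd φ j) j (b - z)) := by
  have hd := differentiable_pd hφ j
  have h1 : Differentiable ℝ fun z => pd φ j (b + z) := hd.comp (by fun_prop)
  have h2 : Differentiable ℝ fun z => pd φ j (b - z) := hd.comp (by fun_prop)
  rw [pd_symmAt (differentiable_of_contDiff_two hφ),
    pd_const_mul (φ := fun z => pd φ j (b + z) + -1 * pd φ j (b - z))
      ((h1 z).add ((h2 z).const_mul _)), pd_add (h1 z) ((h2 z).const_mul _), pd_const_mul (h2 z),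
    pd_comp_const_add, pd_comp_const_sub hd]
  ring

theorem symmAt_hfun_le {U : E n × E n → ℝ} (hU : ContDiff ℝ 2 U) (a : E n) (z : E n × E n) :
    symmAt (hfun U) (a, 0) z ≤ hfun (symmAt U (a, 0)) z := by
  rw [symmAt]
  simp only [hfun, lapV, pd_pd_symmAt hU]
  simp only [pd_symmAt (differentiable_of_contDiff_two hU), Prod.snd_add,
    Prod.snd_sub, zero_add, zero_sub, PiLp.neg_apply]
  generalize ((a, 0) : E n × E n) + z = y₁
  generalize ((a, 0) : E n × E n) - z = y₂
  simp only [Finset.mul_sum, ← Finset.sum_add_distrib, ← Finset.sum_sub_distrib]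
  refine Finset.sum_le_sum fun i _ => ?_
  nlinarith [sq_nonneg (pd U (Sum.inr i) y₁ + pd U (Sum.inr i) y₂),
    sq_nonneg (pd U (Sum.inr i) y₁), sq_nonneg (pd U (Sum.inr i) y₂)]

theorem tangent_le {φ : E n × E n → ℝ} (hφ : ContDiff ℝ 2 φ) (h : ∀ p, (Hess φ p).PosSemidef)
    (p q : E n × E n) : φ p + fderiv ℝ φ p (q - p) ≤ φ q := by
  have := taylor_lower_bound_secondDeriv hφ p (q - p) (c := 0)
    fun s _ => by simpa using secondDeriv_nonneg hφ (h _) _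
  simpa using this

/-- If `hfun U` is convex, it is an affine function of the velocity alone. -/
theorem exists_hfun_eq {U : E n × E n → ℝ} (hU : ContDiff ℝ (⊤ : ℕ∞) U)
    (hh : ∀ p, (Hess (hfun U) p).PosSemidef) :
    ∃ (d : ℝ) (c : E n), ∀ z, hfun U z = d + inner ℝ c z.2 := by
  have hU2 : ContDiff ℝ 2 U := contDiff_infty.1 hU 2
  have hh2 : ContDiff ℝ 2 (hfun U) := contDiff_infty.1 (contDiff_hfun hU) 2
  have tangent := tangent_le hh2 hh
  set h := hfun U with hdef
  have key : ∀ (a : E n) (z₀ : E n × E n),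
      (∀ y, fderiv ℝ h ((a, 0) + z₀) y = fderiv ℝ h ((a, 0) - z₀) y) ∧
        symmAt h (a, 0) z₀ ≤ 0 := by
    intro a z₀
    obtain ⟨b, hb⟩ : ∃ b : E n × E n, b = (a, 0) := ⟨_, rfl⟩
    have hsymm : ∀ z, symmAt h b z ≤ hfun (symmAt U b) z := hb ▸ symmAt_hfun_le hU2 a
    rw [← hb]
    set lx : E n := WithLp.toLp 2 fun i => (1 / 2) * (pd h (Sum.inl i) (b + z₀)
      - pd h (Sum.inl i) (b - z₀)) with hlx
    set lv : E n := WithLp.toLp 2 fun i => (1 / 2) * (pd h (Sum.inr i) (b + z₀)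
      - pd h (Sum.inr i) (b - z₀)) with hlv
    have hl : ∀ y : E n × E n, (1 / 2) * (fderiv ℝ h (b + z₀) y - fderiv ℝ h (b - z₀) y)
        = inner ℝ lx y.1 + inner ℝ lv y.2 := by
      intro y
      simp only [fderiv_apply_eq_inner, ← sum_mul_eq_inner, hlx, hlv, Finset.mul_sum,
        ← Finset.sum_add_distrib, ← Finset.sum_sub_distrib]
      exact Finset.sum_congr rfl fun i _ => by ring
    have h1 : ∀ z, symmAt h b z₀ + (inner ℝ lx z.1 + inner ℝ lv z.2)
        - (inner ℝ lx z₀.1 + inner ℝ lv z₀.2) ≤ symmAt h b z := by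
      intro z
      have e1 := tangent (b + z₀) (b + z)
      have e2 := tangent (b - z₀) (b - z)
      rw [← hl z, ← hl z₀]
      simp only [add_sub_add_left_eq_sub, sub_sub_sub_cancel_left, map_sub] at e1 e2
      simp only [symmAt]
      linarith
    have hneg : ∀ z, symmAt h b (-z) = symmAt h b z := fun z => by
      simp only [symmAt, sub_neg_eq_add, ← sub_eq_add_neg]
      ring
    have h2 : ∀ z : E n × E n, |inner ℝ lx z.1 + inner ℝ lv z.2|
        - (inner ℝ lx z₀.1 + inner ℝ lv z₀.2 - symmAt h b z₀) ≤ hfun (symmAt U b) z := by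
      intro z
      refine le_trans ?_ (hsymm z)
      have e1 := h1 z
      have e2 := h1 (-z)
      rw [hneg] at e2
      simp only [Prod.fst_neg, Prod.snd_neg, inner_neg_right] at e2
      rcases abs_cases (inner ℝ lx z.1 + inner ℝ lv z.2) with ⟨h, -⟩ | ⟨h, -⟩ <;> rw [h] <;> linarith
    obtain ⟨⟨h3, h4⟩, h5⟩ := eq_zero_of_abs_linear_sub_le_hfun (contDiff_symmAt hU2 b) h2
    rw [h3, h4] at h5 hl
    simp only [inner_zero_left, add_zero, zero_sub, Left.nonneg_neg_iff] at h5 hl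
    exact ⟨fun y => by linarith [hl y], h5⟩
  have haff : ∀ z, h z = h 0 + fderiv ℝ h 0 z := by
    intro z
    have e := (key 0 z).1 z
    simp only [Prod.mk_zero_zero, zero_add, zero_sub] at e
    have t1 := tangent z (-z)
    have t2 := tangent (-z) z
    have t3 := tangent z 0
    have t4 := tangent 0 z
    have t5 := tangent 0 (-z)
    simp only [sub_neg_eq_add, sub_zero, zero_sub, map_add, map_neg, map_sub] at t1 t2 t3 t4 t5
    linarith
  have hx : ∀ a : E n, fderiv ℝ h 0 (a, 0) = 0 := by
    intro a
    have hs : ∀ s : ℝ, h 0 + s * fderiv ℝ h 0 (a, 0) ≤ 0 := by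
      intro s
      have e := (key (s • a) 0).2
      have e2 : ((s • a, 0) : E n × E n) = s • (a, 0) := by simp
      simp only [symmAt, add_zero, sub_zero, haff (s • a, 0)] at e
      rw [e2, map_smul, smul_eq_mul] at e
      linarith
    by_contra hne
    have := hs ((1 - h 0) / fderiv ℝ h 0 (a, 0))
    rw [div_mul_cancel₀ _ hne] at this
    linarith
  refine ⟨h 0, WithLp.toLp 2 fun i => pd h (Sum.inr i) 0, fun z => ?_⟩
  rw [haff z]
  congr 1
  have e : z = (z.1, 0) + (0, z.2) := by simp
  conv_lhs => rw [e, map_add, hx, zero_add, fderiv_apply_eq_inner]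
  simp

end Affine

section GaussianBound

variable {n : ℕ}

theorem exists_ball_of_secondDeriv_ge {g : E n × E n → ℝ} (hg : ContDiff ℝ 2 g) (z : E n × E n)
    {r K : ℝ} (hr : 0 < r) (hr1 : r ≤ 1) (hK : 0 ≤ K) (hKr : K * r ^ 2 * 2 ≤ 1)
    (h : ∀ p y, ‖p - z‖ ≤ 2 → -(K * ‖y‖ ^ 2) ≤ secondDeriv g p y) :
    ∃ y₀, ‖y₀ - z‖ ≤ 1 ∧ ∀ y, ‖y - y₀‖ ≤ r / 2 → g z - 1 ≤ g y := by
  obtain ⟨e, he1, he2⟩ : ∃ e : E n × E n, ‖e‖ ≤ 1 ∧ ‖fderiv ℝ g z‖ / 2 ≤ fderiv ℝ g z e := by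
    rcases eq_or_lt_of_le (norm_nonneg (fderiv ℝ g z)) with h0 | h0
    · exact ⟨0, by simp, by simp [← h0]⟩
    · obtain ⟨x, hx1, hx2⟩ := (fderiv ℝ g z).exists_lt_apply_of_lt_opNorm (half_lt_self h0)
      rcases abs_cases (fderiv ℝ g z x) with ⟨hx, -⟩ | ⟨hx, -⟩ <;>
        rw [Real.norm_eq_abs, hx] at hx2
      · exact ⟨x, hx1.le, hx2.le⟩
      · exact ⟨-x, by simpa using hx1.le, by simpa using hx2.le⟩
  have hre : ‖r • e‖ ≤ r := by
    rw [norm_smul, Real.norm_of_nonneg hr.le]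
    nlinarith
  refine ⟨z + r • e, by simpa using hre.trans hr1, fun y hy => ?_⟩
  obtain ⟨ξ, hξ⟩ : ∃ ξ, ξ = y - (z + r • e) := ⟨_, rfl⟩
  rw [← hξ] at hy
  have hy2 : ‖r • e + ξ‖ ≤ 3 / 2 * r := (norm_add_le _ _).trans (by linarith)
  have hyz : y = z + (r • e + ξ) := by rw [hξ]; abel
  have ht := taylor_lower_bound_secondDeriv hg z (r • e + ξ) (c := K * ‖r • e + ξ‖ ^ 2)
    fun s hs => h _ _ (by
      rw [add_sub_cancel_left, norm_smul, Real.norm_of_nonneg hs.1]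
      nlinarith [hs.2, norm_nonneg (r • e + ξ), hs.1])
  rw [← hyz, map_add, map_smul, smul_eq_mul] at ht
  have h1 : ‖fderiv ℝ g z ξ‖ ≤ ‖fderiv ℝ g z‖ * (r / 2) :=
    ((fderiv ℝ g z).le_opNorm ξ).trans (mul_le_mul_of_nonneg_left hy (norm_nonneg _))
  have h2 := (abs_le.1 h1).1
  have h3 : r * (‖fderiv ℝ g z‖ / 2) ≤ r * fderiv ℝ g z e := mul_le_mul_of_nonneg_left he2 hr.le
  have h4 : K * ‖r • e + ξ‖ ^ 2 ≤ K * (3 / 2 * r) ^ 2 := by gcongr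
  nlinarith

theorem le_kernel {t : ℝ} (ht : 1 ≤ t) (ht2 : t ≤ 2) (z : E n × E n) :
    (2 ^ (2 * n))⁻¹ * Real.exp (-(5 * (‖z.1‖ ^ 2 + ‖z.2‖ ^ 2))) ≤ kernel t z := by
  have h0 : 0 < t := by linarith
  have h1 : 3 / t ^ 3 ≤ 3 := div_le_self (by norm_num) (one_le_pow₀ ht)
  have h2 : 3 / t ^ 2 ≤ 3 := div_le_self (by norm_num) (one_le_pow₀ ht)
  have h3 : 1 / t ≤ 1 := div_le_self (by norm_num) ht
  have h4 : 0 ≤ 3 / t ^ 2 := by positivity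
  have h5 := (abs_le.1 (abs_real_inner_le_norm z.1 z.2)).1
  have h6 : 3 / t ^ 2 * -inner ℝ z.1 z.2 ≤ 3 / t ^ 2 * (‖z.1‖ * ‖z.2‖) :=
    mul_le_mul_of_nonneg_left (by linarith) h4
  have h7 : 3 / t ^ 2 * (‖z.1‖ * ‖z.2‖) ≤ 3 * (‖z.1‖ * ‖z.2‖) := by gcongr
  have h8 : 3 / t ^ 3 * ‖z.1‖ ^ 2 ≤ 3 * ‖z.1‖ ^ 2 := by gcongr
  have h9 : 1 / t * ‖z.2‖ ^ 2 ≤ 1 * ‖z.2‖ ^ 2 := by gcongr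
  unfold kernel
  gcongr
  simp only [quad]
  nlinarith [sq_nonneg (‖z.1‖ - ‖z.2‖), sq_nonneg ‖z.1‖, sq_nonneg ‖z.2‖]

theorem exp_neg_le_pow_mul {n : ℕ} {β L : ℝ} (hL : 1 ≤ L) :
    Real.exp (-((2 * n + 50 + 4 * n * β) * L)) ≤ (Real.exp (-(β * L / 2)) ^ 4) ^ (2 * n) *
      ((2 ^ (2 * n))⁻¹ * Real.exp (-(50 * L))) := by
  have e1 : (Real.exp (-(β * L / 2)) ^ 4) ^ (2 * n) = Real.exp (-(4 * n * β * L)) := by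
    rw [← Real.exp_nat_mul, ← Real.exp_nat_mul]
    push_cast
    ring_nf
  have e2 : (2 : ℝ) ^ (2 * n) ≤ Real.exp (2 * n * L) := by
    calc (2 : ℝ) ^ (2 * n) ≤ Real.exp 1 ^ (2 * n) :=
          pow_le_pow_left₀ (by norm_num) (by linarith [Real.add_one_le_exp 1]) _
      _ = Real.exp (2 * n) := by
          rw [← Real.exp_nat_mul]
          push_cast
          ring_nf
      _ ≤ _ := Real.exp_le_exp.2 (le_mul_of_one_le_right (by positivity) hL)
  calc Real.exp (-((2 * n + 50 + 4 * n * β) * L))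
      = Real.exp (-(4 * n * β * L)) * ((Real.exp (2 * n * L))⁻¹ * Real.exp (-(50 * L))) := by
        rw [← Real.exp_neg, ← Real.exp_add, ← Real.exp_add]
        ring_nf
    _ ≤ _ := by
        rw [e1]
        gcongr

theorem exp_neg_sq_div_le {n : ℕ} {β L : ℝ} (hL : 1 ≤ L) (hβ : 64 * (6 * n + 51) ≤ β) :
    Real.exp (-((Real.exp (-(β * L / 2)) / 2) ^ 2 / (8 * Real.exp (-(β * L / 2)) ^ 4)))
      ≤ Real.exp (-((2 * n + 50 + 4 * n * β) * L)) / 2 := by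
  have hn : (0 : ℝ) ≤ n := Nat.cast_nonneg n
  have hβ1 : 1 ≤ β := by linarith
  have hβL : 0 ≤ β * L := mul_nonneg (by linarith) (by linarith)
  have e1 : (Real.exp (-(β * L / 2)) / 2) ^ 2 / (8 * Real.exp (-(β * L / 2)) ^ 4)
      = Real.exp (β * L) / 32 := by
    have h1 : Real.exp (β * L) = (Real.exp (-(β * L / 2)) ^ 2)⁻¹ := by
      rw [← Real.exp_nat_mul, ← Real.exp_neg]
      push_cast
      ring_nf
    rw [h1]
    have := Real.exp_ne_zero (-(β * L / 2))
    field_simp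
    norm_num
  have e2 : (β * L) ^ 2 / 2 ≤ Real.exp (β * L) := by
    linarith [Real.quadratic_le_exp_of_nonneg hβL]
  have e3 : 64 * (51 + 2 * n + 4 * n * β) ≤ β ^ 2 := by
    have h1 : 64 * (6 * n + 51) * β ≤ β * β := mul_le_mul_of_nonneg_right hβ (by linarith)
    nlinarith
  have e4 : (51 + 2 * n + 4 * n * β) * L ≤ Real.exp (β * L) / 32 := by
    have h1 : 64 * (51 + 2 * n + 4 * n * β) * L ≤ β ^ 2 * L :=
      mul_le_mul_of_nonneg_right e3 (by linarith)
    have h2 : β ^ 2 * L ≤ (β * L) ^ 2 := by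
      rw [mul_pow]
      exact mul_le_mul_of_nonneg_left (by nlinarith) (sq_nonneg β)
    linarith
  have h2 : 2 ≤ Real.exp L := by linarith [Real.add_one_le_exp L]
  have h3 : Real.exp (-L) ≤ 1 / 2 := by
    rw [Real.exp_neg, one_div]
    exact inv_anti₀ two_pos h2
  calc _ ≤ Real.exp (-L) * Real.exp (-((2 * n + 50 + 4 * n * β) * L)) := by
        rw [e1, ← Real.exp_add]
        exact Real.exp_le_exp.2 (by linarith)
    _ ≤ 1 / 2 * Real.exp (-((2 * n + 50 + 4 * n * β) * L)) :=
        mul_le_mul_of_nonneg_right h3 (Real.exp_pos _).le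
    _ = _ := by ring

theorem kernel_sub_le_exp_neg_half {U : E n × E n → ℝ} (hU : ContDiff ℝ 2 U) {d w r : ℝ}
    (hd : ∀ z, hfun U z = d) (hw : 0 < w) (hr0 : 0 < r) (hr1 : r ≤ 1) (y₀ : E n × E n)
    (hball : ∀ y, ‖y - y₀‖ ≤ r / 2 → w ≤ Real.exp (-(1 / 2) * U y)) :
    w * ((r ^ 4) ^ (2 * n) * kernel (r ^ 4 + 1) (-(y₀.1 + y₀.2), -y₀.2)
        - Real.exp (-((r / 2) ^ 2 / (8 * r ^ 4))))
      ≤ Real.exp (-d) * Real.exp (-(1 / 2) * U 0) := by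
  set W : E n × E n → ℝ := fun z => Real.exp (-(1 / 2) * U z) with hW
  have hW2 : ContDiff ℝ 2 W := (contDiff_const.mul hU).exp
  have hWpos : ∀ z, 0 < W z := fun z => Real.exp_pos _
  set τ := r ^ 4 with hτ
  have hτ0 : 0 < τ := by positivity
  have hτ1 : τ ≤ 1 := pow_le_one₀ hr0.le hr1
  set δ := (τ ^ (2 * n))⁻¹ * Real.exp (-((r / 2) ^ 2 / (8 * τ))) with hδ
  have hδ0 : 0 < δ := by positivity
  set κ := w * τ ^ (2 * n) with hκ
  have hκ0 : 0 < κ := by positivity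
  have hcomp := galilei_kernel_le (p := fun _ => 0) (p' := fun _ => 0) (r := fun _ => 0)
    (r' := fun _ => 0) (q := fun _ => 0) (q' := fun _ => 0) (V := fun _ => y₀.2)
    (X := fun t => y₀.1 + t • y₀.2) (P := fun t z => Real.exp (-d * t) * W z) (H := fun _ => 0)
    (L := 1) hτ0 hδ0 hκ0.le (fun t => hasDerivAt_const t _) (fun t => hasDerivAt_const t _)
    (fun t => by simpa using ((hasDerivAt_id t).smul_const y₀.2).const_add y₀.1)
    (fun t => by simpa using hasDerivAt_const t y₀.2) (fun t => hasDerivAt_const t _)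
    continuous_const continuous_const continuous_const (fun t z => by simp)
    (by have := hW2.continuous; fun_prop) (fun t => contDiff_const.mul hW2)
    (fun t z => mul_pos (Real.exp_pos _) (hWpos z))
    (fun t z => by
      have h1 := (((hasDerivAt_id t).const_mul (-d)).exp).mul_const (W z)
      refine h1.congr_deriv ?_
      rw [kolm_const_mul hW2, kolm_exp_neg_half hU, hd]
      simp only [hW, id]
      ring)
    (fun y hy => by
      simp only [zero_smul, add_zero, Prod.mk.eta] at hy ⊢
      have h1 := hball y (norm_le_one_of_le_kernel hτ0 hτ1 (by positivity) hy)
      have h3 : kernel τ (y - y₀) - δ ≤ (τ ^ (2 * n))⁻¹ := by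
        linarith [kernel_le_inv hτ0 (y - y₀)]
      calc _ = κ * (kernel τ (y - y₀) - δ) := by
            simp only [galilei, Prod.mk.eta]
            simp
        _ ≤ κ * (τ ^ (2 * n))⁻¹ := mul_le_mul_of_nonneg_left h3 hκ0.le
        _ = w := by
            rw [hκ]
            field_simp
        _ ≤ _ := by simpa [hW] using h1)
    1 ⟨zero_le_one, le_rfl⟩ 0
  simp only [galilei, inner_zero_left, add_zero, Real.exp_zero, one_mul, mul_one, one_smul] at hcomp
  have e0 : (0 : E n × E n) - (y₀.1 + y₀.2, y₀.2) = (-(y₀.1 + y₀.2), -y₀.2) := by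
    rw [zero_sub, Prod.neg_mk]
  rw [e0] at hcomp
  refine le_trans (le_of_eq ?_) hcomp
  rw [hκ, hδ]
  field_simp

theorem exists_exp_neg_half_le {U : E n × E n → ℝ} (hU : ContDiff ℝ 2 U) {a₀ a₁ d : ℝ}
    (ha₀ : 0 < a₀) (ha₁ : 0 < a₁)
    (hgrow : ∀ p y : E n × E n, secondDeriv U p y
      ≤ a₀ * Real.exp (a₁ * (‖p.1‖ ^ 2 + ‖p.2‖ ^ 2)) * (‖y.1‖ ^ 2 + ‖y.2‖ ^ 2))
    (hd : ∀ z, hfun U z = d) :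
    ∃ M C : ℝ, 0 < M ∧ 0 < C ∧
      ∀ z, Real.exp (-(1 / 2) * U z) ≤ M * Real.exp (C * (1 + ‖z‖ ^ 2)) := by
  set β : ℝ := 16 * a₁ + 2 * a₀ + 64 * (6 * n + 51) with hβ
  have hβ0 : 0 < β := by positivity
  refine ⟨2 * Real.exp (1 - d) * Real.exp (-(1 / 2) * U 0), 2 * n + 50 + 4 * n * β,
    by positivity, by positivity, fun z => ?_⟩
  obtain ⟨L, hL⟩ : ∃ L, L = 1 + ‖z‖ ^ 2 := ⟨_, rfl⟩
  have hL1 : 1 ≤ L := by rw [hL]; nlinarith [sq_nonneg ‖z‖]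
  rw [← hL]
  set r := Real.exp (-(β * L / 2)) with hr
  have hr0 : 0 < r := Real.exp_pos _
  have hr1 : r ≤ 1 := by
    rw [hr, Real.exp_le_one_iff, neg_nonpos]
    positivity
  have hr2 : r ^ 2 = Real.exp (-(β * L)) := by
    rw [hr, ← Real.exp_nat_mul]
    push_cast
    ring_nf
  obtain ⟨y₀, hy₀, hball⟩ := exists_ball_of_secondDeriv_ge (g := fun z => -(1 / 2) * U z)
    (contDiff_const.mul hU) z (K := a₀ * Real.exp (16 * a₁ * L)) hr0 hr1 (by positivity) (by
      rw [hr2, mul_assoc a₀, ← Real.exp_add]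
      have h1 : 2 * a₀ ≤ Real.exp (2 * a₀) := by linarith [Real.add_one_le_exp (2 * a₀)]
      have h2 : Real.exp (16 * a₁ * L + -(β * L)) ≤ Real.exp (-(2 * a₀)) := by
        rw [Real.exp_le_exp, hβ]
        have : (0 : ℝ) ≤ 64 * (6 * n + 51) * L := by positivity
        nlinarith
      calc a₀ * Real.exp (16 * a₁ * L + -(β * L)) * 2
          = 2 * a₀ * Real.exp (16 * a₁ * L + -(β * L)) := by ring
        _ ≤ Real.exp (2 * a₀) * Real.exp (-(2 * a₀)) := by gcongr
        _ = 1 := by rw [← Real.exp_add]; simp)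
    (fun p y hp => by
      have hpz : ‖p‖ ≤ ‖z‖ + 2 := by linarith [norm_sub_norm_le p z]
      have hp1 := norm_fst_le p
      have hp2 := norm_snd_le p
      have hy1 := norm_fst_le y
      have hy2 := norm_snd_le y
      have h1 : ‖p.1‖ ^ 2 + ‖p.2‖ ^ 2 ≤ 16 * L := by
        have : ‖p.1‖ ^ 2 ≤ ‖p‖ ^ 2 := by gcongr
        have : ‖p.2‖ ^ 2 ≤ ‖p‖ ^ 2 := by gcongr
        have : ‖p‖ ^ 2 ≤ (‖z‖ + 2) ^ 2 := by gcongr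
        rw [hL]
        nlinarith [sq_nonneg (‖z‖ - 2)]
      have h2 : ‖y.1‖ ^ 2 + ‖y.2‖ ^ 2 ≤ 2 * ‖y‖ ^ 2 := by
        have : ‖y.1‖ ^ 2 ≤ ‖y‖ ^ 2 := by gcongr
        have : ‖y.2‖ ^ 2 ≤ ‖y‖ ^ 2 := by gcongr
        linarith
      have h3 : secondDeriv U p y ≤ a₀ * Real.exp (a₁ * (16 * L)) * (2 * ‖y‖ ^ 2) := by
        refine (hgrow p y).trans ?_
        gcongr
      rw [secondDeriv_const_mul hU, show 16 * a₁ * L = a₁ * (16 * L) by ring]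
      linarith)
  have hcomp := kernel_sub_le_exp_neg_half hU hd (w := Real.exp (-1) * Real.exp (-(1 / 2) * U z))
    (by positivity) hr0 hr1 y₀ (fun y hy => by
      rw [← Real.exp_add]
      exact Real.exp_le_exp.2 (by linarith [hball y hy]))
  have hker := le_kernel (n := n) (t := r ^ 4 + 1) (by linarith [pow_pos hr0 4])
    (by linarith [pow_le_one₀ hr0.le hr1 (n := 4)]) (-(y₀.1 + y₀.2), -y₀.2)
  have hζ : ‖-(y₀.1 + y₀.2)‖ ^ 2 + ‖-y₀.2‖ ^ 2 ≤ 10 * L := by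
    rw [norm_neg, norm_neg]
    have e1 : ‖y₀‖ ≤ ‖z‖ + 1 := by linarith [norm_sub_norm_le y₀ z]
    have e2 : ‖y₀.1 + y₀.2‖ ≤ 2 * (‖z‖ + 1) :=
      (norm_add_le _ _).trans (by linarith [norm_fst_le y₀, norm_snd_le y₀])
    have e3 : ‖y₀.2‖ ≤ ‖z‖ + 1 := (norm_snd_le y₀).trans e1
    have e4 : ‖y₀.1 + y₀.2‖ ^ 2 ≤ (2 * (‖z‖ + 1)) ^ 2 := by gcongr
    have e5 : ‖y₀.2‖ ^ 2 ≤ (‖z‖ + 1) ^ 2 := by gcongr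
    rw [hL]
    nlinarith [sq_nonneg (‖z‖ - 1)]
  set A := Real.exp (-((2 * n + 50 + 4 * n * β) * L)) with hA
  have hA0 : 0 < A := Real.exp_pos _
  have hker' : (2 ^ (2 * n))⁻¹ * Real.exp (-(50 * L))
      ≤ kernel (r ^ 4 + 1) (-(y₀.1 + y₀.2), -y₀.2) :=
    le_trans (mul_le_mul_of_nonneg_left (Real.exp_le_exp.2 (by linarith)) (by positivity)) hker
  have hτA : A ≤ (r ^ 4) ^ (2 * n) * kernel (r ^ 4 + 1) (-(y₀.1 + y₀.2), -y₀.2) :=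
    (exp_neg_le_pow_mul hL1).trans (mul_le_mul_of_nonneg_left hker' (by positivity))
  have hδA := exp_neg_sq_div_le (n := n) hL1 (show 64 * (6 * n + 51) ≤ β by rw [hβ]; linarith)
  have hfin : Real.exp (-1) * Real.exp (-(1 / 2) * U z) * (A / 2)
      ≤ Real.exp (-d) * Real.exp (-(1 / 2) * U 0) :=
    le_trans (mul_le_mul_of_nonneg_left (by linarith) (by positivity)) hcomp
  have hAinv : Real.exp ((2 * n + 50 + 4 * n * β) * L) = A⁻¹ := by
    rw [hA, ← Real.exp_neg, neg_neg]
  rw [hAinv, sub_eq_add_neg, Real.exp_add, ← div_eq_mul_inv, le_div_iff₀ hA0]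
  rw [Real.exp_neg 1, mul_assoc, inv_mul_le_iff₀ (Real.exp_pos _)] at hfin
  linarith

end GaussianBound

section Comparison

variable {n : ℕ}

theorem norm_sq_le_add (z : E n × E n) : ‖z‖ ^ 2 ≤ ‖z.1‖ ^ 2 + ‖z.2‖ ^ 2 := by
  rcases le_total ‖z.1‖ ‖z.2‖ with h | h
  · rw [Prod.norm_def, max_eq_right h]
    exact le_add_of_nonneg_left (sq_nonneg _)
  · rw [Prod.norm_def, max_eq_left h]
    exact le_add_of_nonneg_right (sq_nonneg _)

theorem nonneg_on_window {u : ℝ → E n × E n → ℝ} {t₀ t₁ α β M : ℝ} (hα : 0 < α)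
    (hβ : β = 4 * n + 16 * (α + 1) + 2) (ht : t₁ ≤ t₀ + 1 / β)
    (hcont : ContinuousOn (fun q : ℝ × (E n × E n) => u q.1 q.2) (Icc t₀ t₁ ×ˢ univ))
    (hC2 : ∀ t ∈ Icc t₀ t₁, ContDiff ℝ 2 (u t))
    (hK : ∀ t ∈ Icc t₀ t₁, ∀ z, HasDerivAt (fun τ => u τ z) (kolm (u t) z) t)
    (hgrow : ∀ t ∈ Icc t₀ t₁, ∀ z,
      -(M * Real.exp (α * (1 + ‖z.1‖ ^ 2 + ‖z.2‖ ^ 2))) ≤ u t z)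
    (h0 : ∀ z, 0 ≤ u t₀ z) : ∀ t ∈ Icc t₀ t₁, ∀ z, 0 ≤ u t z := by
  have hβ0 : 0 < β := by
    rw [hβ]
    positivity
  intro t ht' z
  refine le_of_forall_pos_le_add fun η hη => ?_
  have hB : 0 < barrier (α + 1) β t₀ t z := Real.exp_pos _
  set ε := η / barrier (α + 1) β t₀ t z with hε
  have hε0 : 0 < ε := div_pos hη hB
  have key := minimum_principle (C := 0) (t₀ := t₀) (t₁ := t₁)
    (u := fun t z => u t z + ε * barrier (α + 1) β t₀ t z)
    (isCompact_closedBall (0 : E n × E n) (Real.sqrt (|M| / ε))) ?_ ?_ ?_ ?_ ?_ t ht' z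
  · rwa [hε, div_mul_cancel₀ _ hB.ne'] at key
  · refine hcont.add (Continuous.continuousOn ?_)
    simp only [barrier]
    fun_prop
  · intro t ht
    exact (hC2 t (Ioc_subset_Icc_self ht)).add (contDiff_const.mul (contDiff_barrier _ _ _ _))
  · intro t ht₂ z _
    have ht₃ := Ioc_subset_Icc_self ht₂
    refine ⟨_, (hK t ht₃ z).fun_add ((hasDerivAt_barrier _ _ _ _ _).const_mul ε), ?_⟩
    rw [kolm_add (hC2 t ht₃) (contDiff_const.mul (contDiff_barrier _ _ _ _)),
      kolm_const_mul (contDiff_barrier _ _ _ _), zero_mul, add_zero]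
    have := kolm_barrier_le (n := n) (by linarith : 0 < α + 1) hβ ht₃.1
      (ht₃.2.trans ht) z
    gcongr
  · intro z
    have : 0 < barrier (α + 1) β t₀ t₀ z := Real.exp_pos _
    have := h0 z
    positivity
  · intro t ht₂ z hz
    simp only [Metric.mem_closedBall, dist_zero_right, not_le] at hz
    set Y := 1 + ‖z.1‖ ^ 2 + ‖z.2‖ ^ 2 with hY
    have hzY : ‖z‖ ^ 2 ≤ Y := by linarith [norm_sq_le_add z]
    have hY0 : 0 < Y := by positivity
    have h1 : |M| / ε ≤ Real.exp Y := by
      have h2 := Real.lt_sq_of_sqrt_lt hz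
      linarith [Real.add_one_le_exp Y]
    have h2 : M ≤ ε * Real.exp Y := by
      rw [div_le_iff₀ hε0] at h1
      linarith [le_abs_self M]
    have h3 : Real.exp Y * Real.exp (α * Y) ≤ barrier (α + 1) β t₀ t z := by
      rw [← Real.exp_add, barrier, ← hY]
      refine Real.exp_le_exp.2 ?_
      have h5 : 0 ≤ β * (t - t₀) := mul_nonneg hβ0.le (by linarith [ht₂.1])
      have h4 : 0 ≤ (α + 1) * (β * (t - t₀)) * Y :=
        mul_nonneg (mul_nonneg (by linarith) h5) hY0.le
      linarith
    have h4 : M * Real.exp (α * Y) ≤ ε * barrier (α + 1) β t₀ t z :=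
      calc M * Real.exp (α * Y) ≤ ε * Real.exp Y * Real.exp (α * Y) := by gcongr
        _ = ε * (Real.exp Y * Real.exp (α * Y)) := by ring
        _ ≤ _ := by gcongr
    linarith [hgrow t ht₂ z]

theorem nonneg_of_growth {u : ℝ → E n × E n → ℝ} {t₀ t₁ α M : ℝ} (hα : 0 < α)
    (hcont : ContinuousOn (fun q : ℝ × (E n × E n) => u q.1 q.2) (Icc t₀ t₁ ×ˢ univ))
    (hC2 : ∀ t ∈ Icc t₀ t₁, ContDiff ℝ 2 (u t))
    (hK : ∀ t ∈ Icc t₀ t₁, ∀ z, HasDerivAt (fun τ => u τ z) (kolm (u t) z) t)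
    (hgrow : ∀ t ∈ Icc t₀ t₁, ∀ z,
      -(M * Real.exp (α * (1 + ‖z.1‖ ^ 2 + ‖z.2‖ ^ 2))) ≤ u t z)
    (h0 : ∀ z, 0 ≤ u t₀ z) : ∀ t ∈ Icc t₀ t₁, ∀ z, 0 ≤ u t z := by
  obtain ⟨β, hβ⟩ : ∃ β : ℝ, β = 4 * n + 16 * (α + 1) + 2 := ⟨_, rfl⟩
  have hβ0 : 0 < β := by
    rw [hβ]
    positivity
  have key : ∀ k : ℕ, ∀ t ∈ Icc t₀ t₁, t ≤ t₀ + k * (1 / β) → ∀ z, 0 ≤ u t z := by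
    intro k
    induction k with
    | zero =>
      intro t ht hk z
      have : t = t₀ := le_antisymm (by simpa using hk) ht.1
      rw [this]
      exact h0 z
    | succ k ih =>
      intro t ht hk z
      push_cast at hk
      rcases le_total t (t₀ + k * (1 / β)) with h | h
      · exact ih t ht h z
      · have hs : t₀ ≤ t₀ + k * (1 / β) := by
          have : 0 ≤ k * (1 / β) := by positivity
          linarith
        have hsub : Icc (t₀ + k * (1 / β)) t ⊆ Icc t₀ t₁ := Icc_subset_Icc hs ht.2
        exact nonneg_on_window hα hβ (by linarith)
          (hcont.mono (prod_mono hsub subset_rfl)) (fun t ht => hC2 t (hsub ht))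
          (fun t ht => hK t (hsub ht)) (fun t ht => hgrow t (hsub ht))
          (ih _ ⟨hs, h.trans ht.2⟩ le_rfl) t ⟨h, le_rfl⟩ z
  intro t ht z
  obtain ⟨k, hk⟩ := exists_nat_ge ((t - t₀) * β)
  refine key k t ht ?_ z
  rw [mul_one_div, ← sub_le_iff_le_add', le_div_iff₀ hβ0]
  exact hk

end Comparison

section Midpoint

variable {n : ℕ}

/-- Spatial displacement at time `σ` along the drift path with initial control `p` and slope `r`. -/
def driftX (p r : E n) (σ : ℝ) : E n := (σ ^ 3 / 3) • r - σ ^ 2 • p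

/-- Velocity displacement along the same drift path. -/
def driftV (p r : E n) (σ : ℝ) : E n := σ ^ 2 • r - (2 * σ) • p

/-- Accumulated cost `∫₀^σ |p - s r|² ds` of the drift path. -/
def driftCost (p r : E n) (σ : ℝ) : ℝ :=
  ‖p‖ ^ 2 * σ - inner ℝ p r * σ ^ 2 + ‖r‖ ^ 2 * σ ^ 3 / 3

@[fun_prop]
theorem continuous_driftX (p r : E n) : Continuous (driftX p r) := by
  unfold driftX
  fun_prop

@[fun_prop]
theorem continuous_driftV (p r : E n) : Continuous (driftV p r) := by
  unfold driftV
  fun_prop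

@[fun_prop]
theorem continuous_driftCost (p r : E n) : Continuous (driftCost p r) := by
  unfold driftCost
  fun_prop

theorem hasDerivAt_driftX (p r : E n) (t₀ t : ℝ) :
    HasDerivAt (fun t => driftX p r (t - t₀)) (driftV p r (t - t₀)) t := by
  have h := (hasDerivAt_id t).sub_const t₀
  refine ((((h.fun_pow 3).div_const 3).smul_const r).fun_sub
    ((h.fun_pow 2).smul_const p)).congr_deriv ?_
  simp only [driftV, id]
  congr 2 <;> push_cast <;> ring

theorem hasDerivAt_driftV (p r : E n) (t₀ t : ℝ) :
    HasDerivAt (fun t => driftV p r (t - t₀)) ((-2 : ℝ) • (p - (t - t₀) • r)) t := by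
  have h := (hasDerivAt_id t).sub_const t₀
  refine (((h.fun_pow 2).smul_const r).fun_sub ((h.const_mul 2).smul_const p)).congr_deriv ?_
  simp only [id]
  push_cast
  module

theorem hasDerivAt_driftCost (p r : E n) (t₀ t : ℝ) :
    HasDerivAt (fun t => driftCost p r (t - t₀)) (‖p - (t - t₀) • r‖ ^ 2) t := by
  have h := (hasDerivAt_id t).sub_const t₀
  refine (((h.const_mul (‖p‖ ^ 2)).fun_sub ((h.fun_pow 2).const_mul (inner ℝ p r))).fun_add
    (((h.fun_pow 3).const_mul (‖r‖ ^ 2)).div_const 3)).congr_deriv ?_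
  rw [norm_sub_sq_real, inner_smul_right, norm_smul, mul_pow, Real.norm_eq_abs, sq_abs]
  simp only [id]
  push_cast
  ring

/-- The image of a solution of the Kolmogorov equation under the Galilean symmetry generated by
the drift path started at time `t₀`. -/
def boost (p r : E n) (t₀ : ℝ) (f : ℝ → E n × E n → ℝ) (t : ℝ) : E n × E n → ℝ :=
  galilei (p - (t - t₀) • r) r (driftX p r (t - t₀)) (driftV p r (t - t₀))
    (-driftCost p r (t - t₀)) (f t)

variable {f : ℝ → E n × E n → ℝ} {t₀ t₁ : ℝ}

theorem continuousOn_boost (p r : E n)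
    (hf : ∀ t ∈ Icc t₀ t₁, ∀ z, DifferentiableAt ℝ (fun q : ℝ × (E n × E n) => f q.1 q.2) (t, z)) :
    ContinuousOn (fun q : ℝ × (E n × E n) => boost p r t₀ f q.1 q.2) (Icc t₀ t₁ ×ˢ univ) := by
  refine ContinuousOn.mul (Continuous.continuousOn ?_) ?_
  · refine Real.continuous_exp.comp
      (((Continuous.inner ?_ ?_).add (Continuous.inner ?_ ?_)).add ?_) <;> fun_prop
  · have hc : ContinuousOn (fun q : ℝ × (E n × E n) => f q.1 q.2) (Icc t₀ t₁ ×ˢ univ) :=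
      fun q hq => (hf q.1 hq.1 q.2).continuousAt.continuousWithinAt
    exact hc.comp (f := fun q : ℝ × (E n × E n) =>
      (q.1, q.2 - (driftX p r (q.1 - t₀), driftV p r (q.1 - t₀)))) (by fun_prop)
      fun q hq => ⟨hq.1, mem_univ _⟩

theorem hasDerivAt_boost (p r : E n) {t : ℝ} (hf2 : ContDiff ℝ 2 (f t))
    (hf : ∀ z, DifferentiableAt ℝ (fun q : ℝ × (E n × E n) => f q.1 q.2) (t, z))
    (hft : ∀ z, HasDerivAt (fun τ => f τ z) (kolm (f t) z) t) (z : E n × E n) :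
    HasDerivAt (fun τ => boost p r t₀ f τ z) (kolm (boost p r t₀ f t) z) t := by
  have hp : HasDerivAt (fun t => p - (t - t₀) • r) (-r) t := by
    simpa using (((hasDerivAt_id t).sub_const t₀).smul_const r).const_sub p
  refine (hasDerivAt_galilei hp (hasDerivAt_const t r) (hasDerivAt_driftX p r t₀ t)
    (hasDerivAt_driftV p r t₀ t) (hasDerivAt_driftCost p r t₀ t).fun_neg hf2 (hf _)
    (hft _)).congr_deriv ?_
  simp [boost]

theorem two_mul_le_boost_add (p r : E n) {α M : ℝ} (hα : 0 < α)
    (hf : ∀ t ∈ Icc t₀ t₁, ∀ z, DifferentiableAt ℝ (fun q : ℝ × (E n × E n) => f q.1 q.2) (t, z))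
    (hf2 : ∀ t ∈ Icc t₀ t₁, ContDiff ℝ 2 (f t))
    (hft : ∀ t ∈ Icc t₀ t₁, ∀ z, HasDerivAt (fun τ => f τ z) (kolm (f t) z) t)
    (hpos : ∀ t ∈ Icc t₀ t₁, ∀ z, 0 < f t z)
    (hgrow : ∀ t ∈ Icc t₀ t₁, ∀ z, f t z ≤ M * Real.exp (α * (1 + ‖z.1‖ ^ 2 + ‖z.2‖ ^ 2)))
    (a : ℝ) : ∀ t ∈ Icc t₀ t₁, ∀ z, 2 * f t z ≤
      Real.exp a * boost p r t₀ f t z + Real.exp (-a) * boost (-p) (-r) t₀ f t z := by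
  have hb2 : ∀ t ∈ Icc t₀ t₁, ∀ p r, ContDiff ℝ 2 (boost p r t₀ f t) :=
    fun t ht p r => contDiff_galilei (hf2 t ht)
  have hbpos : ∀ t ∈ Icc t₀ t₁, ∀ p r z, 0 < boost p r t₀ f t z :=
    fun t ht p r z => mul_pos (Real.exp_pos _) (hpos t ht _)
  intro t ht z
  have ht₀ : t₀ ∈ Icc t₀ t₁ := ⟨le_rfl, ht.1.trans ht.2⟩
  have key := nonneg_of_growth (u := fun t z => Real.exp a * boost p r t₀ f t z
      + Real.exp (-a) * boost (-p) (-r) t₀ f t z + (-2) * f t z) (M := 2 * M) (t₀ := t₀) (t₁ := t₁)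
    hα ?_ ?_ ?_ ?_ ?_ t ht z
  · linarith
  · refine ((continuousOn_const.mul (continuousOn_boost p r hf)).add
      (continuousOn_const.mul (continuousOn_boost _ _ hf))).add (continuousOn_const.mul ?_)
    exact fun q hq => (hf q.1 hq.1 q.2).continuousAt.continuousWithinAt
  · exact fun t ht => ((contDiff_const.mul (hb2 t ht _ _)).add
      (contDiff_const.mul (hb2 t ht _ _))).add (contDiff_const.mul (hf2 t ht))
  · intro t ht z
    have hb := fun p r => hasDerivAt_boost (t₀ := t₀) p r (hf2 t ht) (hf t ht) (hft t ht) z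
    refine ((((hb p r).const_mul _).fun_add ((hb (-p) (-r)).const_mul _)).fun_add
      ((hft t ht z).const_mul _)).congr_deriv ?_
    rw [kolm_add ((contDiff_const.mul (hb2 t ht _ _)).add (contDiff_const.mul (hb2 t ht _ _)))
      (contDiff_const.mul (hf2 t ht)), kolm_add (contDiff_const.mul (hb2 t ht _ _))
      (contDiff_const.mul (hb2 t ht _ _)), kolm_const_mul (hb2 t ht _ _),
      kolm_const_mul (hb2 t ht _ _), kolm_const_mul (hf2 t ht)]
  · intro t ht z
    have h1 := mul_pos (Real.exp_pos a) (hbpos t ht p r z)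
    have h2 := mul_pos (Real.exp_pos (-a)) (hbpos t ht (-p) (-r) z)
    have h3 := hgrow t ht z
    linarith
  · intro z
    have e : ∀ p r : E n, boost p r t₀ f t₀ z = Real.exp (inner ℝ p z.2 + inner ℝ r z.1) * f t₀ z :=
      fun p r => by simp [boost, galilei, driftX, driftV, driftCost, Prod.mk_zero_zero]
    simp only [e, inner_neg_left]
    have h1 := hpos t₀ ht₀ z
    set b := a + (inner ℝ p z.2 + inner ℝ r z.1) with hb
    have h2 : Real.exp a * (Real.exp (inner ℝ p z.2 + inner ℝ r z.1) * f t₀ z)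
        = Real.exp b * f t₀ z := by
      rw [← mul_assoc, ← Real.exp_add]
    have h3 : Real.exp (-a) * (Real.exp (-inner ℝ p z.2 + -inner ℝ r z.1) * f t₀ z)
        = Real.exp (-b) * f t₀ z := by
      rw [← mul_assoc, ← Real.exp_add, hb]
      ring_nf
    have h4 := Real.one_le_cosh b
    rw [Real.cosh_eq] at h4
    rw [h2, h3]
    nlinarith

theorem log_add_log_sub_le (p r : E n) {α M : ℝ} (hα : 0 < α) (ht : t₀ ≤ t₁)
    (hf : ∀ t ∈ Icc t₀ t₁, ∀ z, DifferentiableAt ℝ (fun q : ℝ × (E n × E n) => f q.1 q.2) (t, z))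
    (hf2 : ∀ t ∈ Icc t₀ t₁, ContDiff ℝ 2 (f t))
    (hft : ∀ t ∈ Icc t₀ t₁, ∀ z, HasDerivAt (fun τ => f τ z) (kolm (f t) z) t)
    (hpos : ∀ t ∈ Icc t₀ t₁, ∀ z, 0 < f t z)
    (hgrow : ∀ t ∈ Icc t₀ t₁, ∀ z, f t z ≤ M * Real.exp (α * (1 + ‖z.1‖ ^ 2 + ‖z.2‖ ^ 2)))
    (z : E n × E n) :
    2 * Real.log (f t₁ z) ≤
      Real.log (f t₁ (z + (driftX p r (t₁ - t₀), driftV p r (t₁ - t₀))))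
        + Real.log (f t₁ (z - (driftX p r (t₁ - t₀), driftV p r (t₁ - t₀))))
        + 2 * driftCost p r (t₁ - t₀) := by
  have ht₁ : t₁ ∈ Icc t₀ t₁ := ⟨ht, le_rfl⟩
  have key := fun a => two_mul_le_boost_add p r hα hf hf2 hft hpos hgrow a t₁ ht₁ z
  set σ := t₁ - t₀ with hσ
  have hp := hpos t₁ ht₁ (z - (driftX p r σ, driftV p r σ))
  have hm := hpos t₁ ht₁ (z + (driftX p r σ, driftV p r σ))
  have hc := hpos t₁ ht₁ z
  have eX : driftX (-p) (-r) σ = -driftX p r σ := by simp only [driftX]; module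
  have eV : driftV (-p) (-r) σ = -driftV p r σ := by simp only [driftV]; module
  have eP : -p - σ • -r = -(p - σ • r) := by module
  have eC : driftCost (-p) (-r) σ = driftCost p r σ := by simp [driftCost]
  have ez : z - (-driftX p r σ, -driftV p r σ) = z + (driftX p r σ, driftV p r σ) := by
    rw [← Prod.neg_mk, sub_neg_eq_add]
  have eI : inner ℝ (p - σ • r) (driftV p r σ) + inner ℝ r (driftX p r σ)
      = -2 * driftCost p r σ := by
    simp only [driftV, driftX, driftCost, inner_sub_left, inner_sub_right, inner_smul_left,
      inner_smul_right, real_inner_self_eq_norm_sq, real_inner_comm p r, conj_trivial]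
    ring
  simp only [boost, galilei, ← hσ, eX, eV, eP, eC, ez] at key
  set E₁ := inner ℝ (p - σ • r) (z.2 - driftV p r σ) + inner ℝ r (z.1 - driftX p r σ)
    + -driftCost p r σ with hE₁
  set E₂ := inner ℝ (-(p - σ • r)) (z.2 - -driftV p r σ) + inner ℝ (-r) (z.1 - -driftX p r σ)
    + -driftCost p r σ with hE₂
  have hE : E₁ + E₂ = 2 * driftCost p r σ := by
    simp only [hE₁, hE₂, inner_neg_left, inner_sub_right, inner_neg_right]
    linarith
  rw [← Real.exp_log hp, ← Real.exp_log hm, ← Real.exp_log hc] at key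
  set l₁ := Real.log (f t₁ (z - (driftX p r σ, driftV p r σ)))
  set l₂ := Real.log (f t₁ (z + (driftX p r σ, driftV p r σ)))
  set l := Real.log (f t₁ z)
  have k := key ((E₂ + l₂ - E₁ - l₁) / 2)
  simp only [← Real.exp_add] at k
  rw [show (E₂ + l₂ - E₁ - l₁) / 2 + (E₁ + l₁) = (E₁ + E₂ + l₁ + l₂) / 2 by ring,
    show -((E₂ + l₂ - E₁ - l₁) / 2) + (E₂ + l₂) = (E₁ + E₂ + l₁ + l₂) / 2 by ring,
    ← two_mul] at k
  have k2 := Real.exp_le_exp.1 (le_of_mul_le_mul_left k two_pos)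
  linarith

end Midpoint

section Hessian

variable {n : ℕ}

theorem secondDeriv_neg (φ : E n × E n → ℝ) (p y : E n × E n) :
    secondDeriv φ p (-y) = secondDeriv φ p y := by
  simp only [secondDeriv, map_neg, fderiv_fun_neg, _root_.neg_apply, neg_neg]

theorem secondDeriv_ge_of_midpoint {φ : E n × E n → ℝ} (hφ : ContDiff ℝ 2 φ) {z y : E n × E n}
    {Q : ℝ} (h : ∀ s : ℝ, 2 * φ z ≤ φ (z + s • y) + φ (z - s • y) + 2 * (s ^ 2 * Q)) :
    -(2 * Q) ≤ secondDeriv φ z y := by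
  have hd := differentiable_of_contDiff_two hφ
  have h₁ : ∀ s : ℝ, HasDerivAt
      (fun s : ℝ => φ (z + s • y) + φ (z + s • -y) + 2 * (s ^ 2 * Q))
      (fderiv ℝ φ (z + s • y) y + fderiv ℝ φ (z + s • -y) (-y) + 4 * Q * s) s := fun s => by
    refine (((hasDerivAt_line hd z y s).fun_add (hasDerivAt_line hd z (-y) s)).fun_add
      ((((hasDerivAt_id s).fun_pow 2).mul_const Q).const_mul 2)).congr_deriv ?_
    simp only [id]
    push_cast
    ring
  have h₂ := ((hasDerivAt_line_fderiv hφ z y 0).fun_add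
    (hasDerivAt_line_fderiv hφ z (-y) 0)).fun_add ((hasDerivAt_id (0 : ℝ)).const_mul (4 * Q))
  have := nonneg_of_isLocalMin h₁ h₂ (Filter.Eventually.of_forall fun s => by
    have := h s
    simp only [smul_neg, ← sub_eq_add_neg, zero_smul, sub_zero, add_zero]
    linarith)
  simp only [zero_smul, add_zero, secondDeriv_neg] at this
  linarith

variable {f : ℝ → E n × E n → ℝ}

theorem secondDeriv_log_ge {t₀ t₁ α M : ℝ} (hα : 0 < α) (ht : t₀ < t₁)
    (hf : ∀ t ∈ Icc t₀ t₁, ∀ z, DifferentiableAt ℝ (fun q : ℝ × (E n × E n) => f q.1 q.2) (t, z))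
    (hf2 : ∀ t ∈ Icc t₀ t₁, ContDiff ℝ 2 (f t))
    (hft : ∀ t ∈ Icc t₀ t₁, ∀ z, HasDerivAt (fun τ => f τ z) (kolm (f t) z) t)
    (hpos : ∀ t ∈ Icc t₀ t₁, ∀ z, 0 < f t z)
    (hgrow : ∀ t ∈ Icc t₀ t₁, ∀ z, f t z ≤ M * Real.exp (α * (1 + ‖z.1‖ ^ 2 + ‖z.2‖ ^ 2)))
    (z y : E n × E n) :
    -(6 / (t₁ - t₀) ^ 3 * ‖y.1‖ ^ 2 - 6 / (t₁ - t₀) ^ 2 * inner ℝ y.1 y.2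
        + 2 / (t₁ - t₀) * ‖y.2‖ ^ 2) ≤ secondDeriv (fun z => Real.log (f t₁ z)) z y := by
  have ht₁ : t₁ ∈ Icc t₀ t₁ := ⟨ht.le, le_rfl⟩
  have hσ : 0 < t₁ - t₀ := sub_pos.2 ht
  have key := fun p r => log_add_log_sub_le p r hα ht.le hf hf2 hft hpos hgrow z
  set σ := t₁ - t₀
  set p : E n := (1 / σ) • y.2 - (3 / σ ^ 2) • y.1 with hp
  set r : E n := (3 / σ ^ 2) • y.2 - (6 / σ ^ 3) • y.1 with hr
  have hX : driftX p r σ = y.1 := by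
    rw [driftX, hp, hr]
    match_scalars <;> field_simp <;> ring
  have hV : driftV p r σ = y.2 := by
    rw [driftV, hp, hr]
    match_scalars <;> field_simp <;> ring
  have hQ : 2 * driftCost p r σ = 6 / σ ^ 3 * ‖y.1‖ ^ 2 - 6 / σ ^ 2 * inner ℝ y.1 y.2
      + 2 / σ * ‖y.2‖ ^ 2 := by
    simp only [driftCost, hp, hr, norm_sub_sq_real, inner_sub_left, inner_sub_right, norm_smul,
      inner_smul_left, inner_smul_right, mul_pow, Real.norm_eq_abs, sq_abs, conj_trivial,
      real_inner_self_eq_norm_sq, real_inner_comm y.1 y.2]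
    field_simp
    ring
  rw [← hQ]
  refine secondDeriv_ge_of_midpoint ((hf2 t₁ ht₁).log fun z => (hpos t₁ ht₁ z).ne') fun s => ?_
  have eX : driftX (s • p) (s • r) σ = s • y.1 := by rw [← hX, driftX, driftX]; module
  have eV : driftV (s • p) (s • r) σ = s • y.2 := by rw [← hV, driftV, driftV]; module
  have eQ : driftCost (s • p) (s • r) σ = s ^ 2 * driftCost p r σ := by
    simp only [driftCost, norm_smul, inner_smul_left, inner_smul_right, mul_pow, Real.norm_eq_abs,
      sq_abs, conj_trivial]
    ring
  have := key (s • p) (s • r)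
  rwa [eX, eV, eQ, ← Prod.smul_mk, Prod.mk.eta] at this

theorem secondDeriv_log_ge_of_solution {T : ℝ}
    (hf : ∀ t ∈ Ioo 0 T, ∀ z, DifferentiableAt ℝ (fun q : ℝ × (E n × E n) => f q.1 q.2) (t, z))
    (hf2 : ∀ t ∈ Ioo 0 T, ContDiff ℝ 2 (f t))
    (hft : ∀ t ∈ Ioo 0 T, ∀ z, HasDerivAt (fun τ => f τ z) (kolm (f t) z) t)
    (hpos : ∀ t ∈ Ioo 0 T, ∀ z, 0 < f t z)
    (hgrow : ∀ t₀ t₁, 0 < t₀ → t₁ < T → ∃ α M : ℝ, 0 < α ∧ ∀ t ∈ Icc t₀ t₁, ∀ z,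
      f t z ≤ M * Real.exp (α * (1 + ‖z.1‖ ^ 2 + ‖z.2‖ ^ 2)))
    {t : ℝ} (ht : t ∈ Ioo 0 T) (z y : E n × E n) :
    -(6 / t ^ 3 * ‖y.1‖ ^ 2 - 6 / t ^ 2 * inner ℝ y.1 y.2 + 2 / t * ‖y.2‖ ^ 2)
      ≤ secondDeriv (fun z => Real.log (f t z)) z y := by
  have ht0 : t ≠ 0 := ht.1.ne'
  have hc : ContinuousAt (fun σ : ℝ =>
      -(6 / σ ^ 3 * ‖y.1‖ ^ 2 - 6 / σ ^ 2 * inner ℝ y.1 y.2 + 2 / σ * ‖y.2‖ ^ 2)) t := by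
    fun_prop (disch := simp [ht0])
  refine le_of_tendsto (hc.tendsto.mono_left (nhdsWithin_le_nhds (s := Iio t))) ?_
  filter_upwards [Ioo_mem_nhdsLT ht.1] with σ hσ
  have h0 : 0 < t - σ := sub_pos.2 hσ.2
  have hsub : Icc (t - σ) t ⊆ Ioo 0 T := fun s hs => ⟨h0.trans_le hs.1, hs.2.trans_lt ht.2⟩
  obtain ⟨α, M, hα, hM⟩ := hgrow (t - σ) t h0 ht.2
  have := secondDeriv_log_ge hα (sub_lt_self t hσ.1) (fun s hs => hf s (hsub hs))
    (fun s hs => hf2 s (hsub hs)) (fun s hs => hft s (hsub hs)) (fun s hs => hpos s (hsub hs))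
    hM z y
  rwa [sub_sub_cancel] at this

theorem isHermitian_fromBlocks_smul_one (a b c : ℝ) :
    (fromBlocks (a • 1) (b • 1) (b • 1) (c • 1) :
      Matrix (Fin n ⊕ Fin n) (Fin n ⊕ Fin n) ℝ).IsHermitian := by
  refine IsHermitian.fromBlocks ?_ ?_ ?_ <;> simp [IsHermitian]

theorem coords_dotProduct_fromBlocks (a b c : ℝ) (y : E n × E n) :
    coords y ⬝ᵥ ((fromBlocks (a • 1) (b • 1) (b • 1) (c • 1) :
      Matrix (Fin n ⊕ Fin n) (Fin n ⊕ Fin n) ℝ) *ᵥ coords y)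
      = a * ‖y.1‖ ^ 2 + 2 * b * inner ℝ y.1 y.2 + c * ‖y.2‖ ^ 2 := by
  rw [EuclideanSpace.norm_sq_eq, EuclideanSpace.norm_sq_eq, ← sum_mul_eq_inner, fromBlocks_mulVec]
  simp only [dotProduct, coords, Fintype.sum_sum_type, smul_mulVec, one_mulVec, Sum.elim_inl,
    Sum.elim_inr, Pi.add_apply, Pi.smul_apply, smul_eq_mul, Function.comp, Real.norm_eq_abs,
    sq_abs, Finset.mul_sum, ← Finset.sum_add_distrib]
  exact Finset.sum_congr rfl fun i _ => by ring

end Hessian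

section Growth

variable {n : ℕ}

theorem norm_fderiv_le_sqrt_gradNormSq (φ : E n × E n → ℝ) (p : E n × E n) :
    ‖fderiv ℝ φ p‖ ≤ 2 * Real.sqrt (gradNormSq φ p) := by
  refine ContinuousLinearMap.opNorm_le_bound _ (by positivity) fun y => ?_
  have hy : ∑ j, coords y j ^ 2 ≤ (2 * ‖y‖) ^ 2 := by
    have h := coords_dotProduct_coords y
    simp only [dotProduct, ← sq] at h
    have h1 : ‖y.1‖ ^ 2 ≤ ‖y‖ ^ 2 := pow_le_pow_left₀ (norm_nonneg _) (norm_fst_le y) 2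
    have h2 : ‖y.2‖ ^ 2 ≤ ‖y‖ ^ 2 := pow_le_pow_left₀ (norm_nonneg _) (norm_snd_le y) 2
    nlinarith [sq_nonneg ‖y‖]
  have hg : 0 ≤ gradNormSq φ p := Finset.sum_nonneg fun j _ => sq_nonneg _
  have hcs := Finset.sum_mul_sq_le_sq_mul_sq Finset.univ (coords y) fun j => pd φ j p
  rw [fderiv_apply_eq_sum, Real.norm_eq_abs]
  refine abs_le_of_sq_le_sq (hcs.trans ?_) (by positivity)
  calc _ ≤ (2 * ‖y‖) ^ 2 * gradNormSq φ p := mul_le_mul_of_nonneg_right hy hg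
    _ = _ := by
      rw [mul_right_comm, mul_pow (2 * ‖y‖), Real.sq_sqrt hg]

theorem le_add_of_norm_fderiv_le {φ : E n × E n → ℝ} (hφ : Differentiable ℝ φ) {B C : ℝ}
    (hB : 0 ≤ B) (hC : 0 ≤ C)
    (h : ∀ z, ‖fderiv ℝ φ z‖ ≤ B * Real.exp (C * (1 + ‖z‖ ^ 2))) (z : E n × E n) :
    φ z ≤ φ 0 + B * Real.exp ((C + 1) * (1 + ‖z‖ ^ 2)) := by
  have h1 := (convex_closedBall (0 : E n × E n) ‖z‖).norm_image_sub_le_of_norm_fderiv_le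
    (f := φ) (C := B * Real.exp (C * (1 + ‖z‖ ^ 2))) (𝕜 := ℝ) (fun x _ => hφ x)
    (fun x hx => (h x).trans (by
      have : ‖x‖ ≤ ‖z‖ := by simpa using hx
      gcongr))
    (x := 0) (y := z) (by simp) (by simp)
  rw [sub_zero] at h1
  have h2 : ‖z‖ ≤ Real.exp (1 + ‖z‖ ^ 2) := by
    nlinarith [Real.add_one_le_exp (1 + ‖z‖ ^ 2), sq_nonneg (‖z‖ - 1)]
  have h3 : B * Real.exp (C * (1 + ‖z‖ ^ 2)) * ‖z‖
      ≤ B * Real.exp (C * (1 + ‖z‖ ^ 2)) * Real.exp (1 + ‖z‖ ^ 2) := by gcongr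
  have h4 : B * Real.exp (C * (1 + ‖z‖ ^ 2)) * Real.exp (1 + ‖z‖ ^ 2)
      = B * Real.exp ((C + 1) * (1 + ‖z‖ ^ 2)) := by
    rw [mul_assoc, ← Real.exp_add]
    ring_nf
  have h5 := le_abs_self (φ z - φ 0)
  rw [Real.norm_eq_abs] at h1
  linarith

end Growth

section Reduction

variable {n : ℕ}

/-- The potential `U + 2⟨c, x⟩`. -/
def tilt (U : E n × E n → ℝ) (c : E n) (z : E n × E n) : ℝ := U z + affine 0 ((2 : ℝ) • c) 0 z

theorem contDiff_tilt {U : E n × E n → ℝ} {k : WithTop ℕ∞} (hU : ContDiff ℝ k U) (c : E n) :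
    ContDiff ℝ k (tilt U c) :=
  hU.add (contDiff_affine _ _ _)

theorem pd_tilt_inl {U : E n × E n → ℝ} (hU : ContDiff ℝ 2 U) (c : E n) (i : Fin n)
    (z : E n × E n) : pd (tilt U c) (Sum.inl i) z = pd U (Sum.inl i) z + 2 * c i := by
  have := pd_add (differentiable_of_contDiff_two hU z)
    (differentiable_of_contDiff_two (contDiff_affine 0 ((2 : ℝ) • c) 0) z) (Sum.inl i)
  rw [pd_affine_inl] at this
  exact this.trans (by simp)

theorem pd_tilt_inr {U : E n × E n → ℝ} (hU : ContDiff ℝ 2 U) (c : E n) (i : Fin n) :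
    pd (tilt U c) (Sum.inr i) = pd U (Sum.inr i) := by
  funext z
  have := pd_add (differentiable_of_contDiff_two hU z)
    (differentiable_of_contDiff_two (contDiff_affine 0 ((2 : ℝ) • c) 0) z) (Sum.inr i)
  rw [pd_affine_inr] at this
  exact this.trans (by simp)

theorem hfun_tilt {U : E n × E n → ℝ} (hU : ContDiff ℝ 2 U) (c : E n) (z : E n × E n) :
    hfun (tilt U c) z = hfun U z - inner ℝ c z.2 := by
  have h1 : ∑ i, z.2 i * pd (tilt U c) (Sum.inl i) z
      = (∑ i, z.2 i * pd U (Sum.inl i) z) + 2 * inner ℝ c z.2 := by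
    rw [← sum_mul_eq_inner, Finset.mul_sum, ← Finset.sum_add_distrib]
    exact Finset.sum_congr rfl fun i _ => by rw [pd_tilt_inl hU]; ring
  simp only [hfun, lapV, h1, pd_tilt_inr hU]
  ring

theorem secondDeriv_affine (p r : E n) (c : ℝ) (z y : E n × E n) :
    secondDeriv (affine p r c) z y = 0 := by
  have h1 : (fun q => fderiv ℝ (affine p r c) q y)
      = fun _ => ∑ i, y.1 i * r i + ∑ i, y.2 i * p i := by
    funext q
    rw [← Prod.mk.eta (p := y), fderiv_prod_apply_eq_sum]
    simp only [pd_affine_inl, pd_affine_inr]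
  simp [secondDeriv, h1]

theorem secondDeriv_tilt {U : E n × E n → ℝ} (hU : ContDiff ℝ 2 U) (c : E n)
    (z y : E n × E n) : secondDeriv (tilt U c) z y = secondDeriv U z y := by
  have := secondDeriv_add hU (contDiff_affine 0 ((2 : ℝ) • c) 0) z y
  rwa [secondDeriv_affine, add_zero] at this

/-- The transform of `ρ` that solves the Kolmogorov equation with constant diffusion. -/
def groundState (U : E n × E n → ℝ) (d : ℝ) (ρ : ℝ → E n × E n → ℝ) (t : ℝ) (z : E n × E n) : ℝ :=
  Real.exp (-d * t) * (Real.exp (-(1 / 2) * U z) * ρ t z)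

theorem hasDerivAt_groundState {U : E n × E n → ℝ} (hU : ContDiff ℝ 2 U) {d : ℝ}
    (hd : ∀ z, hfun U z = d) {ρ : ℝ → E n × E n → ℝ} {t ρ' : ℝ} {z : E n × E n}
    (hρ2 : ContDiff ℝ 2 (ρ t)) (hρt : HasDerivAt (fun τ => ρ τ z) ρ' t)
    (hpde : ρ' = kolm (ρ t) z - ∑ i, pd U (Sum.inr i) z * pd (ρ t) (Sum.inr i) z) :
    HasDerivAt (fun τ => groundState U d ρ τ z) (kolm (groundState U d ρ t) z) t := by
  have hV2 : ContDiff ℝ 2 fun z => -(1 / 2) * U z := contDiff_const.mul hU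
  have hW2 : ContDiff ℝ 2 fun z => Real.exp (-(1 / 2) * U z) := hV2.exp
  have hpd : ∀ i, pd (fun z => Real.exp (-(1 / 2) * U z)) (Sum.inr i) z
      = Real.exp (-(1 / 2) * U z) * (-(1 / 2) * pd U (Sum.inr i) z) := fun i => by
    rw [pd_exp (differentiable_of_contDiff_two hV2 z),
      pd_const_mul (differentiable_of_contDiff_two hU z)]
  refine ((((hasDerivAt_id t).const_mul (-d)).exp).fun_mul
    (hρt.const_mul (Real.exp (-(1 / 2) * U z)))).congr_deriv ?_
  have hsum : ∑ i, Real.exp (-(1 / 2) * U z) * (-(1 / 2) * pd U (Sum.inr i) z)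
      * pd (ρ t) (Sum.inr i) z = -(1 / 2) * Real.exp (-(1 / 2) * U z)
        * ∑ i, pd U (Sum.inr i) z * pd (ρ t) (Sum.inr i) z := by
    rw [Finset.mul_sum]
    exact Finset.sum_congr rfl fun i _ => by ring
  unfold groundState
  rw [kolm_const_mul (hW2.mul hρ2), kolm_mul hW2 hρ2, kolm_exp_neg_half hU, hd, hpde]
  simp only [hpd, hsum, id]
  ring

theorem log_groundState {U : E n × E n → ℝ} {d : ℝ} {ρ : ℝ → E n × E n → ℝ} {t : ℝ}
    (z : E n × E n) (hpos : 0 < ρ t z) : Real.log (groundState U d ρ t z)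
      = Real.log (ρ t z) + -(1 / 2) * U z + -d * t := by
  rw [groundState, Real.log_mul (Real.exp_ne_zero _) (by positivity),
    Real.log_mul (Real.exp_ne_zero _) hpos.ne', Real.log_exp, Real.log_exp]
  ring

theorem secondDeriv_log_groundState {U : E n × E n → ℝ} (hU : ContDiff ℝ 2 U) {d : ℝ}
    {ρ : ℝ → E n × E n → ℝ} {t : ℝ} (hρ2 : ContDiff ℝ 2 (ρ t)) (hpos : ∀ z, 0 < ρ t z)
    (z y : E n × E n) : secondDeriv (fun z => Real.log (groundState U d ρ t z)) z y
      = secondDeriv (fun z => Real.log (ρ t z)) z y - 1 / 2 * secondDeriv U z y := by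
  have hl : ContDiff ℝ 2 fun z => Real.log (ρ t z) := hρ2.log fun z => (hpos z).ne'
  simp only [log_groundState _ (hpos _)]
  rw [secondDeriv_add (hl.add (contDiff_const.mul hU)) contDiff_const,
    secondDeriv_add hl (contDiff_const.mul hU), secondDeriv_const_mul hU]
  simp [secondDeriv]
  ring

theorem exists_groundState_le {U : E n × E n → ℝ} {c : E n} {M C d T a₀ : ℝ} (ha₀ : 0 < a₀)
    (hM : 0 < M) (hC : 0 < C)
    (hW : ∀ z, Real.exp (-(1 / 2) * tilt U c z) ≤ M * Real.exp (C * (1 + ‖z‖ ^ 2)))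
    {ρ : ℝ → E n × E n → ℝ} (hρc : ∀ t ∈ Ioo 0 T, ContinuousAt (fun τ => ρ τ 0) t)
    (hρd : ∀ t ∈ Ioo 0 T, Differentiable ℝ (ρ t))
    (hgrow : ∀ t ∈ Ioo 0 T, ∀ p : E n × E n,
      Real.sqrt (gradNormSq (ρ t) p) ≤ a₀ * Real.exp (-U p / 2) * (‖p.1‖ + ‖p.2‖))
    {t₀ t₁ : ℝ} (h0 : 0 < t₀) (h1 : t₁ < T) :
    ∃ α K : ℝ, 0 < α ∧ ∀ t ∈ Icc t₀ t₁, ∀ z,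
      groundState (tilt U c) d ρ t z ≤ K * Real.exp (α * (1 + ‖z.1‖ ^ 2 + ‖z.2‖ ^ 2)) := by
  have hsub : Icc t₀ t₁ ⊆ Ioo 0 T := fun s hs => ⟨h0.trans_le hs.1, hs.2.trans_lt h1⟩
  obtain ⟨R, hR⟩ := (isCompact_Icc (a := t₀) (b := t₁)).exists_bound_of_continuousOn
    (f := fun τ => ρ τ 0) fun t ht => (hρc t (hsub ht)).continuousWithinAt
  obtain ⟨D, hD⟩ := (isCompact_Icc (a := t₀) (b := t₁)).exists_bound_of_continuousOn
    (f := fun τ => Real.exp (-d * τ)) (by fun_prop)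
  set B := 4 * a₀ * M with hB
  set C' := C + ‖c‖ + 1 with hC'
  have hfd : ∀ t ∈ Ioo 0 T, ∀ z, ‖fderiv ℝ (ρ t) z‖ ≤ B * Real.exp (C' * (1 + ‖z‖ ^ 2)) := by
    intro t ht z
    have e1 : Real.exp (-U z / 2) = Real.exp (-(1 / 2) * tilt U c z) * Real.exp (inner ℝ c z.1) := by
      rw [← Real.exp_add]
      congr 1
      simp only [tilt, affine, inner_zero_left, real_inner_smul_left]
      ring
    have e2 : inner ℝ c z.1 ≤ ‖c‖ * (1 + ‖z‖ ^ 2) := by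
      refine (real_inner_le_norm c z.1).trans (mul_le_mul_of_nonneg_left ?_ (norm_nonneg _))
      nlinarith [norm_fst_le z, sq_nonneg (‖z‖ - 1)]
    have e3 : ‖z.1‖ + ‖z.2‖ ≤ 2 * Real.exp (1 + ‖z‖ ^ 2) := by
      nlinarith [norm_fst_le z, norm_snd_le z, Real.add_one_le_exp (1 + ‖z‖ ^ 2),
        sq_nonneg (‖z‖ - 1)]
    calc ‖fderiv ℝ (ρ t) z‖ ≤ 2 * Real.sqrt (gradNormSq (ρ t) z) :=
          norm_fderiv_le_sqrt_gradNormSq _ _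
      _ ≤ 2 * (a₀ * (Real.exp (-(1 / 2) * tilt U c z) * Real.exp (inner ℝ c z.1))
          * (‖z.1‖ + ‖z.2‖)) := by
          rw [← e1]
          exact mul_le_mul_of_nonneg_left (hgrow t ht z) two_pos.le
      _ ≤ 2 * (a₀ * (M * Real.exp (C * (1 + ‖z‖ ^ 2)) * Real.exp (‖c‖ * (1 + ‖z‖ ^ 2)))
          * (2 * Real.exp (1 + ‖z‖ ^ 2))) := by
          have := hW z
          gcongr
      _ = B * (Real.exp (C * (1 + ‖z‖ ^ 2)) * Real.exp (‖c‖ * (1 + ‖z‖ ^ 2))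
          * Real.exp (1 + ‖z‖ ^ 2)) := by
          rw [hB]
          ring
      _ = _ := by
          rw [← Real.exp_add, ← Real.exp_add, hC']
          ring_nf
  refine ⟨C + (C' + 1), D * (M * (|R| + B)), by positivity, fun t ht z => ?_⟩
  have hρ := le_add_of_norm_fderiv_le (hρd t (hsub ht)) (by positivity) (by positivity)
    (hfd t (hsub ht)) z
  have hz := norm_sq_le_add z
  have hDt : Real.exp (-d * t) ≤ D := (le_abs_self _).trans (hD t ht)
  have hD0 : 0 ≤ D := (Real.exp_pos _).le.trans hDt
  have hY : 1 + ‖z‖ ^ 2 ≤ 1 + ‖z.1‖ ^ 2 + ‖z.2‖ ^ 2 := by linarith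
  set Y := 1 + ‖z.1‖ ^ 2 + ‖z.2‖ ^ 2
  have hY0 : 0 ≤ 1 + ‖z‖ ^ 2 := by positivity
  have hρ' : ρ t z ≤ (|R| + B) * Real.exp ((C' + 1) * Y) := by
    have h2 : ρ t 0 ≤ |R| := ((le_abs_self _).trans (hR t ht)).trans (le_abs_self R)
    have h3 : 1 ≤ Real.exp ((C' + 1) * Y) :=
      Real.one_le_exp (mul_nonneg (by positivity) (hY0.trans hY))
    have h4 : B * Real.exp ((C' + 1) * (1 + ‖z‖ ^ 2)) ≤ B * Real.exp ((C' + 1) * Y) := by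
      gcongr
    nlinarith [abs_nonneg R]
  calc groundState (tilt U c) d ρ t z
      ≤ D * (M * Real.exp (C * Y) * ((|R| + B) * Real.exp ((C' + 1) * Y))) := by
        unfold groundState
        have h5 : Real.exp (-(1 / 2) * tilt U c z) * ρ t z
            ≤ M * Real.exp (C * Y) * ((|R| + B) * Real.exp ((C' + 1) * Y)) := by
          refine (mul_le_mul_of_nonneg_left hρ' (Real.exp_pos _).le).trans
            (mul_le_mul_of_nonneg_right ((hW z).trans ?_) (by positivity))
          gcongr
        refine (mul_le_mul_of_nonneg_left h5 (Real.exp_pos _).le).trans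
          (mul_le_mul_of_nonneg_right hDt (by positivity))
    _ = _ := by
      rw [add_mul C, Real.exp_add]
      ring

end Reduction

/-- **Matrix differential Harnack inequality, case `k₁ = k₂ = 0`** (Theorem 2.1 (5)):
`∇² log ρ − ½∇²U ≥ [[−(6/t³) I, (3/t²) I], [(3/t²) I, −(2/t) I]]`. -/
theorem matrix_harnack_case5
    (n : ℕ) (hn : 1 ≤ n) (T : ℝ) (hT : 0 < T)
    (U : E n × E n → ℝ) (hU : ContDiff ℝ (⊤ : ℕ∞) U)
    (ρ : ℝ → E n × E n → ℝ)
    (hρ : ContDiffOn ℝ (⊤ : ℕ∞) (fun q : ℝ × (E n × E n) => ρ q.1 q.2) (Ioo 0 T ×ˢ univ))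
    (hpos : ∀ t ∈ Ioo 0 T, ∀ p : E n × E n, 0 < ρ t p)
    (hpde : ∀ t ∈ Ioo 0 T, ∀ p : E n × E n,
      deriv (fun τ => ρ τ p) t =
        lapV (ρ t) p - (∑ i : Fin n, pd U (Sum.inr i) p * pd (ρ t) (Sum.inr i) p)
          - ∑ i : Fin n, p.2 i * pd (ρ t) (Sum.inl i) p)
    (a₀ a₁ : ℝ) (ha₀ : 0 < a₀) (ha₁ : 0 < a₁)
    (hgrow1 : ∀ t ∈ Ioo 0 T, ∀ p : E n × E n,
      Real.sqrt (gradNormSq (ρ t) p) ≤ a₀ * Real.exp (-U p / 2) * (‖p.1‖ + ‖p.2‖))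
    (hgrow2 : ∀ t ∈ Ioo 0 T, ∀ p : E n × E n,
      (Hess (ρ t) p + (a₀ * Real.exp (a₁ * (‖p.1‖ ^ 2 + ‖p.2‖ ^ 2))) •
        (1 : Matrix (Fin n ⊕ Fin n) (Fin n ⊕ Fin n) ℝ)).PosSemidef)
    (hgrow3 : ∀ p : E n × E n,
      ((a₀ * Real.exp (a₁ * (‖p.1‖ ^ 2 + ‖p.2‖ ^ 2))) •
        (1 : Matrix (Fin n ⊕ Fin n) (Fin n ⊕ Fin n) ℝ) - Hess U p).PosSemidef)
    (hh : ∀ p : E n × E n, (Hess (hfun U) p).PosSemidef) :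
    ∀ t ∈ Ioo 0 T, ∀ p : E n × E n,
      (Hess (fun q => Real.log (ρ t q)) p - (1/2 : ℝ) • Hess U p
        - Matrix.fromBlocks (-(6 / t ^ 3) • 1) ((3 / t ^ 2) • 1)
            ((3 / t ^ 2) • 1) (-(2 / t) • 1)).PosSemidef := by
  intro t ht p
  have hU2 : ContDiff ℝ 2 U := contDiff_infty.1 hU 2
  have hopen : IsOpen (Ioo 0 T ×ˢ (univ : Set (E n × E n))) := isOpen_Ioo.prod isOpen_univ
  have hρat : ∀ t ∈ Ioo 0 T, ∀ z, ContDiffAt ℝ (⊤ : ℕ∞)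
      (fun q : ℝ × (E n × E n) => ρ q.1 q.2) (t, z) := fun t ht z =>
    (hρ (t, z) ⟨ht, mem_univ _⟩).contDiffAt (hopen.mem_nhds ⟨ht, mem_univ _⟩)
  have hρd : ∀ t ∈ Ioo 0 T, ∀ z,
      DifferentiableAt ℝ (fun q : ℝ × (E n × E n) => ρ q.1 q.2) (t, z) :=
    fun t ht z => (hρat t ht z).differentiableAt (by simp)
  have hρt : ∀ t ∈ Ioo 0 T, ∀ z, DifferentiableAt ℝ (fun τ => ρ τ z) t := fun t ht z =>
    (hρd t ht z).comp t (f := fun τ => (τ, z)) (by fun_prop)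
  have hρ2 : ∀ t ∈ Ioo 0 T, ContDiff ℝ 2 (ρ t) := fun t ht => contDiff_iff_contDiffAt.2 fun z =>
    ((hρat t ht z).of_le (WithTop.coe_le_coe.2 le_top)).comp z (f := fun z => (t, z)) (by fun_prop)
  obtain ⟨d, c, hdc⟩ := exists_hfun_eq hU hh
  have hV2 : ContDiff ℝ 2 (tilt U c) := contDiff_tilt hU2 c
  have hd : ∀ z, hfun (tilt U c) z = d := fun z => by
    rw [hfun_tilt hU2, hdc]
    ring
  obtain ⟨M, C, hM, hC, hW⟩ := exists_exp_neg_half_le hV2 ha₀ ha₁ (fun p y => by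
    rw [secondDeriv_tilt hU2]
    exact secondDeriv_le hU2 (hgrow3 p) y) hd
  have key := fun y => secondDeriv_log_ge_of_solution (f := groundState (tilt U c) d ρ) (T := T)
    (fun t ht z => by
      have h1 := hρd t ht z
      have h2 := (differentiable_of_contDiff_two hV2) z
      unfold groundState
      fun_prop)
    (fun t ht => contDiff_const.mul ((contDiff_const.mul hV2).exp.mul (hρ2 t ht)))
    (fun t ht z => by
      refine hasDerivAt_groundState hV2 hd (hρ2 t ht) (hρt t ht z).hasDerivAt ?_
      simp only [hpde t ht z, kolm, pd_tilt_inr hU2]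
      ring)
    (fun t ht z => mul_pos (Real.exp_pos _) (mul_pos (Real.exp_pos _) (hpos t ht z)))
    (fun t₀ t₁ h0 h1 => exists_groundState_le ha₀ hM hC hW
      (fun t ht => (hρt t ht 0).continuousAt)
      (fun t ht => differentiable_of_contDiff_two (hρ2 t ht)) hgrow1 h0 h1)
    ht p y
  have hlog : ContDiff ℝ 2 fun q => Real.log (ρ t q) := (hρ2 t ht).log fun z => (hpos t ht z).ne'
  rw [sub_sub]
  refine posSemidef_of_secondDeriv hlog p
    (((Hess_isHermitian hU2 p).smul (by simp [IsSelfAdjoint])).add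
      (isHermitian_fromBlocks_smul_one _ _ _)) fun y => ?_
  have hy := key y
  rw [secondDeriv_log_groundState hV2 (hρ2 t ht) (hpos t ht), secondDeriv_tilt hU2,
    secondDeriv_eq hU2] at hy
  rw [add_mulVec, dotProduct_add, coords_dotProduct_fromBlocks, smul_mulVec, dotProduct_smul,
    smul_eq_mul]
  rw [show 2 * (3 / t ^ 2) = 6 / t ^ 2 by ring]
  linarith
end
end

section
/- Let K be a positive semidefinite symmetric 2n×2n real matrix. Then there exist ε > 0 and a differentiable family N(t), t ∈ (0, ε], of invertible symmetric 2n×2n matrices solving the matrix Riccati equation N'(t) = N(t)C + Cᵀ N(t) + N(t) D N(t) − K, such that N(t)⁻¹ → 0 as t → 0⁺, N(t) ≤ 0 for all t ∈ (0, ε], and N'(t) ≥ 0 for all t ∈ (0, ε]. -/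
noncomputable section
open Real Set Matrix Filter

/-- The `2n × 2n` matrix `C = [[0, −I], [0, 0]]` in `n × n` block form. -/
def Cmat (n : ℕ) : Matrix (Fin n ⊕ Fin n) (Fin n ⊕ Fin n) ℝ :=
  Matrix.fromBlocks 0 (-1) 0 0

/-- The `2n × 2n` matrix `D = [[0, 0], [0, 2I]]` in `n × n` block form. -/
def Dmat (n : ℕ) : Matrix (Fin n ⊕ Fin n) (Fin n ⊕ Fin n) ℝ :=
  Matrix.fromBlocks 0 0 0 ((2 : ℝ) • 1)

open scoped Matrix.Norms.Operator Topology

section HamiltonianSystem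

theorem LinearMap.hasDerivAt_comp {E F : Type*} [NormedAddCommGroup E] [NormedSpace ℝ E]
    [FiniteDimensional ℝ E] [NormedAddCommGroup F] [NormedSpace ℝ F] (L : E →ₗ[ℝ] F)
    {f : ℝ → E} {f' : E} {t : ℝ} (hf : HasDerivAt f f' t) :
    HasDerivAt (fun s => L (f s)) (L f') t :=
  L.toContinuousLinearMap.hasFDerivAt.comp_hasDerivAt t hf

variable {m : Type*} [Fintype m]

theorem HasDerivAt.matrix_transpose {X : ℝ → Matrix m m ℝ} {X' : Matrix m m ℝ} {t : ℝ}
    (hX : HasDerivAt X X' t) : HasDerivAt (fun s => (X s)ᵀ) X'ᵀ t :=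
  (Matrix.transposeLinearEquiv m m ℝ ℝ).toLinearMap.hasDerivAt_comp hX

theorem HasDerivAt.matrix_apply {X : ℝ → Matrix m m ℝ} {X' : Matrix m m ℝ} {t : ℝ}
    (hX : HasDerivAt X X' t) (i j : m) : HasDerivAt (fun s => X s i j) (X' i j) t :=
  (Matrix.entryLinearMap ℝ ℝ i j).hasDerivAt_comp hX

theorem HasDerivAt.matrix_mulVec {X : ℝ → Matrix m m ℝ} {X' : Matrix m m ℝ} {t : ℝ}
    (hX : HasDerivAt X X' t) (v : m → ℝ) : HasDerivAt (fun s => X s *ᵥ v) (X' *ᵥ v) t :=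
  ((Matrix.mulVecBilin ℝ ℝ).flip v).hasDerivAt_comp hX

theorem Matrix.eq_of_hasDerivAt_zero {G : ℝ → Matrix m m ℝ} (hG : ∀ t, HasDerivAt G 0 t)
    (s t : ℝ) : G s = G t :=
  is_const_of_deriv_eq_zero (fun t => (hG t).differentiableAt) (fun t => (hG t).deriv) s t

variable [DecidableEq m]

theorem HasDerivAt.matrix_inv {X : ℝ → Matrix m m ℝ} {X' : Matrix m m ℝ} {t : ℝ}
    (hX : HasDerivAt X X' t) (hu : IsUnit (X t)) :
    HasDerivAt (fun s => (X s)⁻¹) (-((X t)⁻¹ * X' * (X t)⁻¹)) t := by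
  obtain ⟨u, hu⟩ := hu
  have h := hasFDerivAt_ringInverse (𝕜 := ℝ) u
  rw [hu] at h
  have h2 := h.comp_hasDerivAt t hX
  simp only [Matrix.nonsing_inv_eq_ringInverse]
  rw [← hu, Ring.inverse_unit]
  exact h2

/-- The linear Hamiltonian system `X' = CᵀX + KY`, `Y' = DX - CY` with `X(0) = 1`, `Y(0) = 0`,
whose solutions give the solution `-XY⁻¹` of the Riccati equation. -/
structure IsHamiltonianSolution (C D K : Matrix m m ℝ) (X Y : ℝ → Matrix m m ℝ) : Prop where
  hasDerivAt_fst : ∀ t, HasDerivAt X (Cᵀ * X t + K * Y t) t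
  hasDerivAt_snd : ∀ t, HasDerivAt Y (D * X t - C * Y t) t
  fst_zero : X 0 = 1
  snd_zero : Y 0 = 0

theorem exists_isHamiltonianSolution (C D K : Matrix m m ℝ) :
    ∃ X Y, IsHamiltonianSolution C D K X Y := by
  let H : Matrix (m ⊕ m) (m ⊕ m) ℝ := Matrix.fromBlocks Cᵀ K D (-C)
  let Z : ℝ → Matrix (m ⊕ m) (m ⊕ m) ℝ := fun t => NormedSpace.exp (t • H)
  have hZ : ∀ t, HasDerivAt Z (H * Z t) t := fun t => hasDerivAt_exp_smul_const' H t
  have hHZ : ∀ t, H * Z t = Matrix.fromBlocks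
      (Cᵀ * (Z t).toBlocks₁₁ + K * (Z t).toBlocks₂₁) (Cᵀ * (Z t).toBlocks₁₂ + K * (Z t).toBlocks₂₂)
      (D * (Z t).toBlocks₁₁ + -C * (Z t).toBlocks₂₁)
      (D * (Z t).toBlocks₁₂ + -C * (Z t).toBlocks₂₂) := fun t => by
    conv_lhs => rw [← Matrix.fromBlocks_toBlocks (Z t)]
    exact Matrix.fromBlocks_multiply ..
  have hZ0 : Z 0 = Matrix.fromBlocks 1 0 0 1 := by
    simp [Z, NormedSpace.exp_zero, Matrix.fromBlocks_one]
  let L₁ : Matrix (m ⊕ m) (m ⊕ m) ℝ →ₗ[ℝ] Matrix m m ℝ :=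
    { toFun := Matrix.toBlocks₁₁, map_add' := fun _ _ => rfl, map_smul' := fun _ _ => rfl }
  let L₂ : Matrix (m ⊕ m) (m ⊕ m) ℝ →ₗ[ℝ] Matrix m m ℝ :=
    { toFun := Matrix.toBlocks₂₁, map_add' := fun _ _ => rfl, map_smul' := fun _ _ => rfl }
  refine ⟨fun t => (Z t).toBlocks₁₁, fun t => (Z t).toBlocks₂₁, fun t => ?_, fun t => ?_, ?_, ?_⟩
  · convert! L₁.hasDerivAt_comp (hZ t) using 1
    rw [hHZ]
    rfl
  · convert! L₂.hasDerivAt_comp (hZ t) using 1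
    rw [hHZ, sub_eq_add_neg, ← neg_mul]
    rfl
  · simp only [hZ0, Matrix.toBlocks_fromBlocks₁₁]
  · simp only [hZ0, Matrix.toBlocks_fromBlocks₂₁]

namespace IsHamiltonianSolution

variable {C D K : Matrix m m ℝ} {X Y : ℝ → Matrix m m ℝ}

theorem hasDerivAt_transpose_mul (h : IsHamiltonianSolution C D K X Y) (hK : Kᵀ = K) (t : ℝ) :
    HasDerivAt (fun s => (X s)ᵀ * Y s) ((Y t)ᵀ * K * Y t + (X t)ᵀ * D * X t) t := by
  convert! (h.hasDerivAt_fst t).matrix_transpose.mul (h.hasDerivAt_snd t) using 1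
  simp only [Matrix.transpose_add, Matrix.transpose_mul, Matrix.transpose_transpose, hK]
  noncomm_ring

theorem transpose_mul_comm (h : IsHamiltonianSolution C D K X Y) (hK : Kᵀ = K) (hD : Dᵀ = D)
    (t : ℝ) : (Y t)ᵀ * X t = (X t)ᵀ * Y t := by
  have hG : ∀ s, HasDerivAt (fun s => (Y s)ᵀ * X s - (X s)ᵀ * Y s) 0 s := fun s => by
    have h1 := h.hasDerivAt_transpose_mul hK s
    convert! h1.matrix_transpose.sub h1 using 1
    · ext1 s
      simp
    · simp [hK, hD, Matrix.mul_assoc]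
  have := Matrix.eq_of_hasDerivAt_zero hG t 0
  simpa [h.snd_zero, sub_eq_zero] using this

/-- The symplectic pairing of a solution with its own derivative is constant. -/
theorem symplectic_deriv_eq (h : IsHamiltonianSolution C D K X Y) (hK : Kᵀ = K) (hD : Dᵀ = D)
    (t : ℝ) :
    (X t)ᵀ * (D * X t - C * Y t) - (Y t)ᵀ * (Cᵀ * X t + K * Y t) = D := by
  have hG : ∀ s, HasDerivAt (fun s => (X s)ᵀ * (D * X s - C * Y s)
      - (Y s)ᵀ * (Cᵀ * X s + K * Y s)) 0 s := fun s => by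
    have hX := h.hasDerivAt_fst s
    have hY := h.hasDerivAt_snd s
    convert! (hX.matrix_transpose.mul ((hX.const_mul D).sub (hY.const_mul C))).sub
      (hY.matrix_transpose.mul ((hX.const_mul Cᵀ).add (hY.const_mul K))) using 1
    simp only [Matrix.transpose_add, Matrix.transpose_sub, Matrix.transpose_mul,
      Matrix.transpose_transpose, hK, hD, Pi.add_apply, Pi.sub_apply]
    noncomm_ring
  have := Matrix.eq_of_hasDerivAt_zero hG t 0
  simpa [h.fst_zero, h.snd_zero] using this

/-- `XᵀY` is positive definite for positive times, under the observability condition that the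
kernel of `D` contains no nonzero arc of `x' = Cᵀx`. -/
theorem posDef_transpose_mul (h : IsHamiltonianSolution C D K X Y) (hK : K.PosSemidef)
    (hD : D.PosSemidef)
    (hCD : ∀ (x : ℝ → m → ℝ) (b : ℝ), (∀ s ∈ Ioo 0 b, HasDerivAt x (Cᵀ *ᵥ x s) s) →
      (∀ s ∈ Ioo 0 b, D *ᵥ x s = 0) → ∀ s ∈ Ioo 0 b, x s = 0)
    {t : ℝ} (ht : 0 < t) : ((X t)ᵀ * Y t).PosDef := by
  have hKt : Kᵀ = K := hK.isHermitian
  have hDt : Dᵀ = D := hD.isHermitian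
  refine Matrix.PosDef.of_dotProduct_mulVec_pos ?_ fun v hv => ?_
  · simpa [Matrix.IsHermitian] using h.transpose_mul_comm hKt hDt t
  set f : ℝ → ℝ := fun s => v ⬝ᵥ (((X s)ᵀ * Y s) *ᵥ v) with hf
  have hf' : ∀ s, HasDerivAt f
      ((Y s *ᵥ v) ⬝ᵥ (K *ᵥ (Y s *ᵥ v)) + (X s *ᵥ v) ⬝ᵥ (D *ᵥ (X s *ᵥ v))) s := fun s => by
    convert! (dotProductBilin ℝ ℝ v).hasDerivAt_comp
      ((h.hasDerivAt_transpose_mul hKt s).matrix_mulVec v) using 1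
    simp [Matrix.add_mulVec, ← Matrix.mulVec_mulVec, Matrix.dotProduct_mulVec,
      Matrix.vecMul_transpose]
  have hKn : ∀ w, 0 ≤ w ⬝ᵥ (K *ᵥ w) := fun w => by simpa using hK.dotProduct_mulVec_nonneg w
  have hDn : ∀ w, 0 ≤ w ⬝ᵥ (D *ᵥ w) := fun w => by simpa using hD.dotProduct_mulVec_nonneg w
  have hmono : Monotone f := monotone_of_hasDerivAt_nonneg hf' fun s => add_nonneg (hKn _) (hDn _)
  have hf0 : f 0 = 0 := by simp [hf, h.snd_zero]
  simp only [star_trivial]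
  refine lt_of_le_of_ne (hf0 ▸ hmono ht.le) fun hft => hv ?_
  have hzero : ∀ s ∈ Ioo 0 t, f s = 0 := fun s hs =>
    le_antisymm ((hmono hs.2.le).trans hft.symm.le) (hf0 ▸ hmono hs.1.le)
  have hder : ∀ s ∈ Ioo 0 t, K *ᵥ (Y s *ᵥ v) = 0 ∧ D *ᵥ (X s *ᵥ v) = 0 := fun s hs => by
    have h0 : HasDerivAt f 0 s := (hasDerivAt_const s (0 : ℝ)).congr_of_eventuallyEq <| by
      filter_upwards [isOpen_Ioo.mem_nhds hs] using hzero
    have hsum := (hf' s).unique h0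
    have h1 := hKn (Y s *ᵥ v)
    have h2 := hDn (X s *ᵥ v)
    rw [← hK.dotProduct_mulVec_zero_iff, ← hD.dotProduct_mulVec_zero_iff]
    simp only [star_trivial]
    constructor <;> linarith
  have hx : ∀ s ∈ Ioo 0 t, X s *ᵥ v = 0 := by
    refine hCD (fun s => X s *ᵥ v) t (fun s hs => ?_) fun s hs => (hder s hs).2
    convert! (h.hasDerivAt_fst s).matrix_mulVec v using 1
    simp [Matrix.add_mulVec, ← Matrix.mulVec_mulVec, (hder s hs).1]
  have hcont : Tendsto (fun s => X s *ᵥ v) (𝓝[>] 0) (𝓝 v) := by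
    have := ((h.hasDerivAt_fst 0).matrix_mulVec v).continuousAt.tendsto
    simp only [h.fst_zero, Matrix.one_mulVec] at this
    exact this.mono_left nhdsWithin_le_nhds
  refine tendsto_nhds_unique (hcont.congr' ?_) tendsto_const_nhds
  filter_upwards [Ioo_mem_nhdsGT ht] using hx

theorem riccati (h : IsHamiltonianSolution C D K X Y) {t : ℝ} (hY : IsUnit (Y t)) :
    HasDerivAt (fun s => -(X s * (Y s)⁻¹))
      (-(X t * (Y t)⁻¹) * C + Cᵀ * -(X t * (Y t)⁻¹)
        + -(X t * (Y t)⁻¹) * D * -(X t * (Y t)⁻¹) - K) t := by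
  have hYi : Y t * (Y t)⁻¹ = 1 := Matrix.mul_nonsing_inv _ ((Matrix.isUnit_iff_isUnit_det _).1 hY)
  convert! ((h.hasDerivAt_fst t).mul ((h.hasDerivAt_snd t).matrix_inv hY)).neg using 1
  simp only [add_mul, sub_mul, mul_sub, mul_neg, neg_mul, Matrix.mul_assoc, hYi, mul_one]
  abel

theorem mul_inv_eq_conj (h : IsHamiltonianSolution C D K X Y) (hK : Kᵀ = K) (hD : Dᵀ = D)
    {t : ℝ} (hY : IsUnit (Y t)) :
    X t * (Y t)⁻¹ = ((Y t)⁻¹)ᵀ * ((X t)ᵀ * Y t) * (Y t)⁻¹ := by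
  have hYi : Y t * (Y t)⁻¹ = 1 := Matrix.mul_nonsing_inv _ ((Matrix.isUnit_iff_isUnit_det _).1 hY)
  rw [← h.transpose_mul_comm hK hD, ← Matrix.mul_assoc, ← Matrix.transpose_mul, hYi]
  simp

theorem transpose_mul_inv (h : IsHamiltonianSolution C D K X Y) (hK : Kᵀ = K) (hD : Dᵀ = D)
    {t : ℝ} (hY : IsUnit (Y t)) : (X t * (Y t)⁻¹)ᵀ = X t * (Y t)⁻¹ := by
  rw [h.mul_inv_eq_conj hK hD hY]
  simp only [Matrix.transpose_mul, Matrix.transpose_transpose, h.transpose_mul_comm hK hD,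
    Matrix.mul_assoc]

theorem riccati_rhs_eq (h : IsHamiltonianSolution C D K X Y) (hK : Kᵀ = K) (hD : Dᵀ = D)
    {t : ℝ} (hY : IsUnit (Y t)) :
    -(X t * (Y t)⁻¹) * C + Cᵀ * -(X t * (Y t)⁻¹)
        + -(X t * (Y t)⁻¹) * D * -(X t * (Y t)⁻¹) - K = ((Y t)⁻¹)ᵀ * D * (Y t)⁻¹ := by
  have hYi : Y t * (Y t)⁻¹ = 1 := Matrix.mul_nonsing_inv _ ((Matrix.isUnit_iff_isUnit_det _).1 hY)
  have hYt : ((Y t)⁻¹)ᵀ * (Y t)ᵀ = 1 := by rw [← Matrix.transpose_mul, hYi, Matrix.transpose_one]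
  have hN : ((Y t)⁻¹)ᵀ * (X t)ᵀ = X t * (Y t)⁻¹ := by
    rw [← Matrix.transpose_mul, h.transpose_mul_inv hK hD hY]
  conv_rhs => rw [← h.symplectic_deriv_eq hK hD t]
  simp only [mul_sub, mul_add, sub_mul, add_mul]
  simp only [← Matrix.mul_assoc, hN, hYt]
  simp only [Matrix.mul_assoc, hYi, one_mul, mul_one, neg_mul, mul_neg]
  abel

theorem tendsto_inv (h : IsHamiltonianSolution C D K X Y)
    (hX : ∀ t > 0, IsUnit (X t)) (hY : ∀ t > 0, IsUnit (Y t)) :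
    Tendsto (fun t => (-(X t * (Y t)⁻¹))⁻¹) (𝓝[>] 0) (𝓝 0) := by
  have hu : IsUnit (X 0) := by simp [h.fst_zero]
  have hlim : Tendsto (fun t => -(Y t * (X t)⁻¹)) (𝓝[>] 0) (𝓝 0) := by
    have := ((h.hasDerivAt_snd 0).mul ((h.hasDerivAt_fst 0).matrix_inv hu)).neg.continuousAt.tendsto
    simp only [Pi.neg_apply, Pi.mul_apply, h.snd_zero, zero_mul, neg_zero] at this
    exact this.mono_left nhdsWithin_le_nhds
  refine hlim.congr' ?_
  filter_upwards [self_mem_nhdsWithin] with t ht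
  have hXd := (Matrix.isUnit_iff_isUnit_det _).1 (hX t ht)
  have hYd := (Matrix.isUnit_iff_isUnit_det _).1 (hY t ht)
  refine (Matrix.inv_eq_left_inv ?_).symm
  rw [neg_mul_neg, Matrix.mul_assoc, Matrix.nonsing_inv_mul_cancel_left _ _ hXd,
    Matrix.mul_nonsing_inv _ hYd]

end IsHamiltonianSolution

end HamiltonianSystem

theorem posSemidef_Dmat (n : ℕ) : (Dmat n).PosSemidef := by
  have : Dmat n = Matrix.diagonal (Sum.elim 0 2) := by
    simp [Dmat, ← Matrix.fromBlocks_diagonal, Matrix.smul_one_eq_diagonal, Pi.zero_def]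
  rw [this]
  refine Matrix.PosSemidef.diagonal fun i => ?_
  cases i <;> simp

theorem Cmat_transpose_Dmat_observable {n : ℕ} (x : ℝ → Fin n ⊕ Fin n → ℝ) (b : ℝ)
    (hx : ∀ s ∈ Ioo 0 b, HasDerivAt x ((Cmat n)ᵀ *ᵥ x s) s)
    (hD : ∀ s ∈ Ioo 0 b, Dmat n *ᵥ x s = 0) (s : ℝ) (hs : s ∈ Ioo 0 b) : x s = 0 := by
  have hr : ∀ s ∈ Ioo 0 b, ∀ i, x s (Sum.inr i) = 0 := fun s hs i => by
    have := congrFun (hD s hs) (Sum.inr i)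
    simpa [Dmat, Matrix.fromBlocks_mulVec, Matrix.smul_mulVec] using this
  funext i
  rcases i with i | i
  · have h1 := hasDerivAt_pi.1 (hx s hs) (Sum.inr i)
    have h0 : HasDerivAt (fun s => x s (Sum.inr i)) 0 s :=
      (hasDerivAt_const s (0 : ℝ)).congr_of_eventuallyEq <| by
        filter_upwards [isOpen_Ioo.mem_nhds hs] with r hrs using hr r hrs i
    have := h1.unique h0
    simpa [Cmat, Matrix.fromBlocks_transpose, Matrix.fromBlocks_mulVec, Matrix.neg_mulVec]
      using this
  · exact hr s hs i

/-- **Existence of a suitable solution of the matrix Riccati equation** (Lemma 3.1):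
for any positive semidefinite `K` there is, on some interval `(0, ε]`, a differentiable family
`N(t)` of invertible symmetric matrices solving `N' = NC + CᵀN + NDN − K` with `N(t)⁻¹ → 0` as
`t → 0⁺`, `N ≤ 0`, and `N' ≥ 0`. -/
theorem riccati_existence (n : ℕ) (hn : 1 ≤ n)
    (K : Matrix (Fin n ⊕ Fin n) (Fin n ⊕ Fin n) ℝ) (hK : K.PosSemidef) :
    ∃ ε > (0 : ℝ), ∃ N : ℝ → Matrix (Fin n ⊕ Fin n) (Fin n ⊕ Fin n) ℝ,
      (∀ t ∈ Ioc 0 ε, (N t).IsSymm ∧ IsUnit (N t)) ∧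
      (∀ t ∈ Ioc 0 ε, ∀ i j, HasDerivAt (fun τ => N τ i j)
        ((N t * Cmat n + (Cmat n)ᵀ * N t + N t * Dmat n * N t - K) i j) t) ∧
      (∀ i j, Tendsto (fun t => (N t)⁻¹ i j) (nhdsWithin 0 (Ioi 0)) (nhds 0)) ∧
      (∀ t ∈ Ioc 0 ε, (-(N t)).PosSemidef) ∧
      (∀ t ∈ Ioc 0 ε,
        (N t * Cmat n + (Cmat n)ᵀ * N t + N t * Dmat n * N t - K).PosSemidef) := by
  have hKt : Kᵀ = K := hK.isHermitian
  have hD := posSemidef_Dmat n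
  have hDt : (Dmat n)ᵀ = Dmat n := hD.isHermitian
  obtain ⟨X, Y, h⟩ := exists_isHamiltonianSolution (Cmat n) (Dmat n) K
  have hpos : ∀ t > 0, ((X t)ᵀ * Y t).PosDef := fun t ht =>
    h.posDef_transpose_mul hK hD Cmat_transpose_Dmat_observable ht
  have hX : ∀ t > 0, IsUnit (X t) := fun t ht => by
    have := (Matrix.isUnit_iff_isUnit_det _).1 (hpos t ht).isUnit
    rw [Matrix.det_mul, Matrix.det_transpose] at this
    exact (Matrix.isUnit_iff_isUnit_det _).2 (isUnit_of_mul_isUnit_left this)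
  have hY : ∀ t > 0, IsUnit (Y t) := fun t ht => by
    have := (Matrix.isUnit_iff_isUnit_det _).1 (hpos t ht).isUnit
    rw [Matrix.det_mul] at this
    exact (Matrix.isUnit_iff_isUnit_det _).2 (isUnit_of_mul_isUnit_right this)
  refine ⟨1, one_pos, fun t => -(X t * (Y t)⁻¹), fun t ht => ⟨?_, ?_⟩, fun t ht i j => ?_,
    fun i j => ?_, fun t ht => ?_, fun t ht => ?_⟩
  · simpa [Matrix.IsSymm] using h.transpose_mul_inv hKt hDt (hY t ht.1)
  · exact ((hX t ht.1).mul (Matrix.isUnit_nonsing_inv_iff.2 (hY t ht.1))).neg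
  · exact (h.riccati (hY t ht.1)).matrix_apply i j
  · exact ((continuous_id.matrix_elem i j).tendsto 0).comp (h.tendsto_inv hX hY)
  · rw [neg_neg, h.mul_inv_eq_conj hKt hDt (hY t ht.1)]
    exact (hpos t ht.1).posSemidef.conjTranspose_mul_mul_same _
  · rw [h.riccati_rhs_eq hKt hDt (hY t ht.1)]
    exact hD.conjTranspose_mul_mul_same _
end
end
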